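/- For every signed planar graph (G,σ), the chromatic number of the exact-distance -2 graph of (G,σ) is at most 76. -/

import Mathlib

open SimpleGraph

/-- The number of negative edges of a walk, where `σ e = true` means edge `e` is negative. -/
def negCount {V : Type} {G : SimpleGraph V} (σ : Sym2 V → Bool) {x y : V}
    (p : G.Walk x y) : ℕ :=
  (p.edges.filter (fun e => σ e)).length

/-- A walk is negative if it contains an odd number of negative edges. -/
def IsNegWalk {V : Type} {G : SimpleGraph V} (σ : Sym2 V → Bool) {x y : V}
    (p : G.Walk x y) : Prop :=
  Odd (negCount σ p)

/-- The exact-distance `-k` graph of the signed graph `(G, σ)`: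
`xy` is an edge iff `d_G(x,y) = k` and every `xy`-path of length `k` is negative. -/
def exactDistNeg {V : Type} (G : SimpleGraph V) (σ : Sym2 V → Bool) (k : ℕ) :
    SimpleGraph V :=
  SimpleGraph.fromRel (fun x y =>
    G.dist x y = k ∧ ∀ p : G.Walk x y, p.IsPath → p.length = k → IsNegWalk σ p)

/-- The strong exact-distance `-k` graph of the signed graph `(G, σ)`:
`xy` is an edge iff `d_G(x,y) = k` and some `xy`-path of length `k` is negative. -/
def strongExactDistNeg {V : Type} (G : SimpleGraph V) (σ : Sym2 V → Bool) (k : ℕ) :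
    SimpleGraph V :=
  SimpleGraph.fromRel (fun x y =>
    G.dist x y = k ∧ ∃ p : G.Walk x y, p.IsPath ∧ p.length = k ∧ IsNegWalk σ p)

/-- `WReach G L k y` : the set of vertices weakly `k`-reachable from `y` w.r.t. ordering `L`. -/
def WReach {V : Type} (G : SimpleGraph V) (L : LinearOrder V) (k : ℕ) (y : V) : Set V :=
  {x | ∃ p : G.Walk x y, p.IsPath ∧ p.length ≤ k ∧ ∀ z ∈ p.support, L.le x z}

/-- The weak `k`-colouring number of `G`. -/
noncomputable def wcol {V : Type} (G : SimpleGraph V) (k : ℕ) : ℕ :=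
  ⨅ L : LinearOrder V, ⨆ y : V, (WReach G L k y).ncard

/-- `DReach G L k y` : the set of vertices `x` such that there is an `xy`-path
`z_0, …, z_s` (`x = z_0`, `y = z_s`) of length `s ≤ k` on which `x` is the `L`-minimum
and `y ≤_L z_i` for all `⌊k/2⌋ + 1 ≤ i ≤ s`. -/
def DReach {V : Type} (G : SimpleGraph V) (L : LinearOrder V) (k : ℕ) (y : V) : Set V :=
  {x | ∃ p : G.Walk x y, p.IsPath ∧ p.length ≤ k ∧ (∀ z ∈ p.support, L.le x z) ∧
        ∀ i, k / 2 + 1 ≤ i → i ≤ p.length → L.le y (p.support.getD i y)}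

/-- The distance-`k`-colouring number of `G`. -/
noncomputable def dcol {V : Type} (G : SimpleGraph V) (k : ℕ) : ℕ :=
  ⨅ L : LinearOrder V, ⨆ y : V, (DReach G L k y).ncard

/-- `SReach G L k y` : the set of vertices strongly `k`-reachable from `y` w.r.t. `L`. -/
def SReach {V : Type} (G : SimpleGraph V) (L : LinearOrder V) (k : ℕ) (y : V) : Set V :=
  {x | ∃ p : G.Walk x y, p.IsPath ∧ p.length ≤ k ∧ (∀ z ∈ p.support, L.le x z) ∧
        ∀ z ∈ p.support, z ≠ x → L.le y z}

/-- The strong `k`-colouring number of `G`. -/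
noncomputable def scol {V : Type} (G : SimpleGraph V) (k : ℕ) : ℕ :=
  ⨅ L : LinearOrder V, ⨆ y : V, (SReach G L k y).ncard

/-- `H` is a minor of `G` (branch-set definition). -/
def IsMinor {W V : Type} (H : SimpleGraph W) (G : SimpleGraph V) : Prop :=
  ∃ B : W → Set V,
    (∀ w, (B w).Nonempty) ∧
    (∀ w, (G.induce (B w)).Connected) ∧
    (Pairwise (Function.onFun Disjoint B)) ∧
    ∀ w w', H.Adj w w' → ∃ u ∈ B w, ∃ v ∈ B w', G.Adj u v

/-- `G` is planar iff it has no `K₅` and no `K₃,₃` minor (Wagner's theorem). -/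
def IsPlanar {V : Type} (G : SimpleGraph V) : Prop :=
  ¬ IsMinor (completeGraph (Fin 5)) G ∧
  ¬ IsMinor (completeBipartiteGraph (Fin 3) (Fin 3)) G

/-- `G` is outerplanar iff it has no `K₄` and no `K₂,₃` minor. -/
def IsOuterplanar {V : Type} (G : SimpleGraph V) : Prop :=
  ¬ IsMinor (completeGraph (Fin 4)) G ∧
  ¬ IsMinor (completeBipartiteGraph (Fin 2) (Fin 3)) G

/-- `G` has treewidth at most `t` (tree-decomposition definition). -/
def HasTreewidthLE {V : Type} (G : SimpleGraph V) (t : ℕ) : Prop :=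
  ∃ (ι : Type) (T : SimpleGraph ι) (B : ι → Finset V),
    T.Connected ∧ T.IsAcyclic ∧
    (∀ v, ∃ i, v ∈ B i) ∧
    (∀ u v, G.Adj u v → ∃ i, u ∈ B i ∧ v ∈ B i) ∧
    (∀ v, (T.induce {i | v ∈ B i}).Connected) ∧
    (∀ i, (B i).card ≤ t + 1)

section

/-- A minor model of `H` in `F` in which the branch sets with index in `J` meet `X`. -/
def XMinor {V ι : Type} (F : SimpleGraph V) (X : Set V) (H : SimpleGraph ι) (J : Set ι) : Prop :=
  ∃ B : ι → Set V, (∀ i, (F.induce (B i)).Connected) ∧ (∀ i j, i ≠ j → Disjoint (B i) (B j)) ∧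
    (∀ i j, H.Adj i j → ∃ a ∈ B i, ∃ b ∈ B j, F.Adj a b) ∧ ∀ j ∈ J, (B j ∩ X).Nonempty

/-- `M` exhibits `F'` (up to isolated vertices) as a minor of `F` on the same vertex set. -/
structure IsModel {V : Type} (F' F : SimpleGraph V) (M : V → Set V) : Prop where
  mem : ∀ v ∈ F'.support, v ∈ M v
  conn : ∀ v ∈ F'.support, (F.induce (M v)).Connected
  disj : ∀ v ∈ F'.support, ∀ v' ∈ F'.support, v ≠ v' → Disjoint (M v) (M v')
  adj : ∀ v v', F'.Adj v v' → ∃ a ∈ M v, ∃ b ∈ M v', F.Adj a b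

variable {V ι : Type}

lemma induce_singleton_connected (F : SimpleGraph V) (v : V) : (F.induce {v}).Connected := by
  have : Nonempty ({v} : Set V) := ⟨⟨v, rfl⟩⟩
  refine ⟨fun a b => ?_⟩
  have : a = b := Subtype.ext (a.2.trans b.2.symm)
  rw [this]

lemma induce_reachable_mono {F : SimpleGraph V} {S T : Set V} (h : S ⊆ T) {a b : V}
    (ha : a ∈ S) (hb : b ∈ S) (hr : (F.induce S).Reachable ⟨a, ha⟩ ⟨b, hb⟩) :
    (F.induce T).Reachable ⟨a, h ha⟩ ⟨b, h hb⟩ :=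
  hr.map (induceHomOfLE F h).toHom

lemma induce_connected_mono {F F' : SimpleGraph V} (hF : F ≤ F') {S : Set V}
    (h : (F.induce S).Connected) : (F'.induce S).Connected :=
  h.mono (fun _ _ hab => hF hab)

/-- If a connected set meets a set closed under adjacency, it is contained in it. -/
lemma subset_of_connected {F : SimpleGraph V} {S T : Set V} (h : (F.induce S).Connected)
    (hT : ∀ a b, a ∈ T → F.Adj a b → b ∈ T) {x : V} (hx : x ∈ S) (hxT : x ∈ T) : S ⊆ T := by
  intro y hy
  obtain ⟨w⟩ := h.preconnected ⟨x, hx⟩ ⟨y, hy⟩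
  have : ∀ (a b : S), (F.induce S).Walk a b → a.1 ∈ T → b.1 ∈ T := by
    intro a b w
    induction w with
    | nil => exact id
    | cons hab _ ih => exact fun ha => ih (hT _ _ ha hab)
  exact this _ _ w hxT

lemma support_closed (F : SimpleGraph V) : ∀ a b, a ∈ F.support → F.Adj a b → b ∈ F.support :=
  fun a _ _ hab => ⟨a, hab.symm⟩

lemma IsModel.connected_biUnion {F' F : SimpleGraph V} {M : V → Set V} (hM : IsModel F' F M)
    {B : Set V} (hB : (F'.induce B).Connected) (hs : B ⊆ F'.support) :
    (F.induce (⋃ v ∈ B, M v)).Connected := by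
  have hsub : ∀ v ∈ B, M v ⊆ ⋃ v ∈ B, M v := fun v hv => Set.subset_biUnion_of_mem hv
  have key : ∀ (x y : B), (F'.induce B).Walk x y → ∀ a (ha : a ∈ M x) b (hb : b ∈ M y),
      (F.induce (⋃ v ∈ B, M v)).Reachable ⟨a, hsub _ x.2 ha⟩ ⟨b, hsub _ y.2 hb⟩ := by
    intro x y w
    induction w with
    | @nil u =>
      intro a ha b hb
      exact induce_reachable_mono (hsub _ u.2) ha hb ((hM.conn _ (hs u.2)).preconnected _ _)
    | @cons u v _ huv _ ih =>
      intro a ha b hb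
      obtain ⟨c, hc, d, hd, hcd⟩ := hM.adj _ _ (show F'.Adj u v from huv)
      have h1 := induce_reachable_mono (hsub _ u.2) ha hc
        ((hM.conn _ (hs u.2)).preconnected ⟨a, ha⟩ ⟨c, hc⟩)
      have h2 : (F.induce (⋃ v ∈ B, M v)).Adj ⟨c, hsub _ u.2 hc⟩ ⟨d, hsub _ v.2 hd⟩ := hcd
      exact (h1.trans h2.reachable).trans (ih d hd b hb)
  obtain ⟨x⟩ := hB.nonempty
  have : Nonempty ↑(⋃ v ∈ B, M v) := ⟨⟨x, hsub _ x.2 (hM.mem _ (hs x.2))⟩⟩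
  refine ⟨fun a b => ?_⟩
  obtain ⟨a, ha⟩ := a
  obtain ⟨b, hb⟩ := b
  obtain ⟨u, hu, hau⟩ := Set.mem_iUnion₂.1 ha
  obtain ⟨v, hv, hbv⟩ := Set.mem_iUnion₂.1 hb
  obtain ⟨w⟩ := hB.preconnected ⟨u, hu⟩ ⟨v, hv⟩
  exact key _ _ w a hau b hbv

lemma XMinor.of_isModel {F' F : SimpleGraph V} {M : V → Set V} (hM : IsModel F' F M)
    {X : Set V} {H : SimpleGraph ι} {J : Set ι} (hH : ∀ i, ∃ j, H.Adj i j)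
    (h : XMinor F' X H J) : XMinor F X H J := by
  obtain ⟨B, hc, hd, ha, hX⟩ := h
  have hs : ∀ i, B i ⊆ F'.support := by
    intro i
    obtain ⟨j, hij⟩ := hH i
    obtain ⟨a, hai, b, -, hab⟩ := ha i j hij
    exact subset_of_connected (hc i) (support_closed F') hai ⟨b, hab⟩
  refine ⟨fun i => ⋃ v ∈ B i, M v, fun i => hM.connected_biUnion (hc i) (hs i), ?_, ?_, ?_⟩
  · intro i j hij
    simp only [Set.disjoint_iUnion_left, Set.disjoint_iUnion_right]
    intro v hv v' hv'
    refine hM.disj _ (hs _ ‹_›) _ (hs _ ‹_›) ?_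
    rintro rfl
    exact Set.disjoint_left.1 (hd i j hij) ‹_› ‹_›
  · intro i j hij
    obtain ⟨a, hai, b, hbj, hab⟩ := ha i j hij
    obtain ⟨c, hc, d, hd, hcd⟩ := hM.adj _ _ hab
    exact ⟨c, Set.mem_biUnion hai hc, d, Set.mem_biUnion hbj hd, hcd⟩
  · intro j hj
    obtain ⟨x, hx, hxX⟩ := hX j hj
    exact ⟨x, Set.mem_biUnion hx (hM.mem _ (hs j hx)), hxX⟩

/-- The planarity-type condition on `F`: adding a vertex adjacent to `X` creates neither a `K₃,₃`
minor nor a `K₅` minor in which the new vertex is a branch set. -/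
structure Cone (F : SimpleGraph V) (X : Set V) : Prop where
  noK23 : ¬ XMinor F X (completeBipartiteGraph (Fin 3) (Fin 2)) {i | i.isLeft}
  noK4 : ¬ XMinor F X (completeGraph (Fin 4)) Set.univ

lemma Cone.of_isModel {F' F : SimpleGraph V} {M : V → Set V} (hM : IsModel F' F M) {X : Set V}
    (h : Cone F X) : Cone F' X := by
  refine ⟨fun h' => h.noK23 (h'.of_isModel hM ?_), fun h' => h.noK4 (h'.of_isModel hM ?_)⟩
  · rintro (i | i)
    · exact ⟨Sum.inr 0, by simp⟩
    · exact ⟨Sum.inl 0, by simp⟩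
  · intro i
    exact exists_ne i |>.imp fun j hj => hj.symm

lemma Cone.mono {F' F : SimpleGraph V} (hF : F' ≤ F) {X : Set V} (h : Cone F X) : Cone F' X :=
  h.of_isModel (M := fun v => {v}) ⟨fun _ _ => rfl, fun v _ => induce_singleton_connected F v,
    fun v _ v' _ hvv => by simpa using hvv,
    fun v v' hv => ⟨v, rfl, v', rfl, hF hv⟩⟩

/-- Usable form of the exclusion of `K₂,₃`. -/
lemma Cone.k23 {F : SimpleGraph V} {X : Set V} (h : Cone F X) {A : Fin 3 → Set V} {B C : Set V}
    (hA : ∀ i, (F.induce (A i)).Connected) (hB : (F.induce B).Connected)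
    (hC : (F.induce C).Connected) (hAA : ∀ i j, i ≠ j → Disjoint (A i) (A j))
    (hAB : ∀ i, Disjoint (A i) B) (hAC : ∀ i, Disjoint (A i) C) (hBC : Disjoint B C)
    (hX : ∀ i, (A i ∩ X).Nonempty) (h1 : ∀ i, ∃ a ∈ A i, ∃ b ∈ B, F.Adj a b)
    (h2 : ∀ i, ∃ a ∈ A i, ∃ c ∈ C, F.Adj a c) : False := by
  refine h.noK23 ⟨Sum.elim A ![B, C], ?_, ?_, ?_, ?_⟩
  · rintro (i | i)
    · exact hA i
    · fin_cases i
      · exact hB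
      · exact hC
  · rintro (i | i) (j | j) hij
    · exact hAA i j (by simpa using hij)
    · fin_cases j
      · exact hAB i
      · exact hAC i
    · fin_cases i
      · exact (hAB j).symm
      · exact (hAC j).symm
    · fin_cases i <;> fin_cases j
      · simp at hij
      · exact hBC
      · exact hBC.symm
      · simp at hij
  · rintro (i | i) (j | j) hij
    · simp at hij
    · fin_cases j
      · exact h1 i
      · exact h2 i
    · fin_cases i
      · obtain ⟨a, ha, b, hb, hab⟩ := h1 j
        exact ⟨b, hb, a, ha, hab.symm⟩
      · obtain ⟨a, ha, b, hb, hab⟩ := h2 j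
        exact ⟨b, hb, a, ha, hab.symm⟩
    · simp at hij
  · rintro (i | i) hi
    · exact hX i
    · simp at hi

end

section

variable {V : Type}

/-- `l` is a chain of `Λ` without repetitions. -/
structure IsPathList (Λ : SimpleGraph V) (N : Finset V) (l : List V) : Prop where
  nodup : l.Nodup
  sub : ∀ x ∈ l, x ∈ N
  adj : ∀ i (h : i + 1 < l.length), Λ.Adj l[i] l[i + 1]

lemma IsPathList.cons {Λ : SimpleGraph V} {N : Finset V} {l : List V} (h : IsPathList Λ N l)
    {x : V} (hx : x ∈ N) (hxl : x ∉ l) (h0 : ∀ h : 0 < l.length, Λ.Adj x l[0]) :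
    IsPathList Λ N (x :: l) := by
  refine ⟨List.nodup_cons.2 ⟨hxl, h.nodup⟩, ?_, ?_⟩
  · simpa using ⟨hx, h.sub⟩
  · rintro (_ | i) hi
    · simpa using h0 (by simpa using hi)
    · simpa using h.adj i (by simpa using hi)

lemma IsPathList.snoc {Λ : SimpleGraph V} {N : Finset V} {l : List V} (h : IsPathList Λ N l)
    {x : V} (hx : x ∈ N) (hxl : x ∉ l)
    (h0 : ∀ i (h : i < l.length), i + 1 = l.length → Λ.Adj l[i] x) :
    IsPathList Λ N (l ++ [x]) := by
  refine ⟨?_, ?_, ?_⟩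
  · rw [List.nodup_append]
    refine ⟨h.nodup, by simp, ?_⟩
    rintro a ha b hb rfl
    simp only [List.mem_singleton] at hb
    exact hxl (hb ▸ ha)
  · intro y hy
    rcases List.mem_append.1 hy with hy | hy
    · exact h.sub y hy
    · rw [List.mem_singleton.1 hy]
      exact hx
  · intro i hi
    simp only [List.length_append, List.length_singleton] at hi
    rw [List.getElem_append_left (by omega)]
    by_cases hi' : i + 1 < l.length
    · rw [List.getElem_append_left hi']
      exact h.adj i hi'
    · rw [List.getElem_append_right (by omega)]
      simpa using h0 i (by omega) (by omega)

/-- A graph of maximum degree at most two has a cycle, or its vertices can be listed so that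
edges join consecutive vertices. -/
lemma exists_cycle_or_list (Λ : SimpleGraph V) (N : Finset V)
    (hdeg : ∀ n ∈ N, ∀ a ∈ N, ∀ b ∈ N, ∀ c ∈ N, Λ.Adj n a → Λ.Adj n b → Λ.Adj n c →
      a = b ∨ a = c ∨ b = c) :
    (∃ l : List V, IsPathList Λ N l ∧ ∃ h : 3 ≤ l.length, Λ.Adj l[0] l[l.length - 1]) ∨
    ∃ l : List V, l.Nodup ∧ (∀ x, x ∈ l ↔ x ∈ N) ∧
      ∀ i j (hi : i < l.length) (hj : j < l.length), Λ.Adj l[i] l[j] → j = i + 1 ∨ i = j + 1 := by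
  classical
  induction N using Finset.strongInduction with
  | H N ih =>
  rcases N.eq_empty_or_nonempty with rfl | ⟨x0, hx0⟩
  · right
    exact ⟨[], by simp, by simp, by simp⟩
  have hbound : ∀ l, IsPathList Λ N l → l.length ≤ N.card := by
    intro l hl
    rw [← List.toFinset_card_of_nodup hl.nodup]
    exact Finset.card_le_card fun x hx => hl.sub x (List.mem_toFinset.1 hx)
  obtain ⟨P, hP, hmax⟩ : ∃ P, IsPathList Λ N P ∧ ∀ l, IsPathList Λ N l → l.length ≤ P.length := by
    have hs := Nat.findGreatest_spec (P := fun m => ∃ l, IsPathList Λ N l ∧ l.length = m)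
      (m := 1) (n := N.card) (Finset.card_pos.2 ⟨x0, hx0⟩)
      ⟨[x0], ⟨by simp, by simpa using hx0, by simp⟩, rfl⟩
    obtain ⟨P, hP, hPl⟩ := hs
    refine ⟨P, hP, fun l hl => ?_⟩
    rw [hPl]
    exact Nat.le_findGreatest (hbound l hl) ⟨l, hl, rfl⟩
  have hpos : 0 < P.length :=
    hmax [x0] ⟨by simp, by simpa using hx0, by simp⟩
  by_cases hcyc : ∃ h : 3 ≤ P.length, Λ.Adj P[0] P[P.length - 1]
  · exact Or.inl ⟨P, hP, hcyc⟩
  have hcyc' : ∀ h : 3 ≤ P.length, ¬ Λ.Adj P[0] P[P.length - 1] := fun h h' => hcyc ⟨h, h'⟩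
  have hinj : ∀ i j (hi : i < P.length) (hj : j < P.length), P[i] = P[j] → i = j :=
    fun i j hi hj h => (hP.nodup.getElem_inj_iff).1 h
  have hN : ∀ i (hi : i < P.length), P[i] ∈ N := fun i hi => hP.sub _ (List.getElem_mem hi)
  -- a vertex of `P` with two neighbours on `P` has no other neighbour
  have hint : ∀ i (hi : i + 2 < P.length), ∀ x ∈ N, Λ.Adj P[i + 1] x → x = P[i] ∨ x = P[i + 2] := by
    intro i hi x hx hax
    rcases hdeg _ (hN (i + 1) (by omega)) _ (hN i (by omega)) _ (hN (i + 2) (by omega)) x hx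
      (hP.adj i (by omega)).symm (hP.adj (i + 1) (by omega)) hax with h | h | h
    · have := hinj _ _ _ _ h
      omega
    · exact Or.inl h.symm
    · exact Or.inr h.symm
  have hcl : ∀ i (hi : i < P.length), ∀ x ∈ N, Λ.Adj P[i] x →
      ∃ j, ∃ hj : j < P.length, x = P[j] ∧ (j = i + 1 ∨ i = j + 1) := by
    intro i hi x hx hax
    by_cases hi1 : 1 ≤ i ∧ i + 1 < P.length
    · obtain ⟨i, rfl⟩ : ∃ k, i = k + 1 := ⟨i - 1, by omega⟩
      rcases hint i (by omega) x hx hax with h | h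
      · exact ⟨i, by omega, h, by omega⟩
      · exact ⟨i + 2, by omega, h, by omega⟩
    have hxP : x ∈ P := by
      by_contra hxP
      by_cases hi0 : i = 0
      · subst hi0
        have := hmax _ (hP.cons hx hxP fun _ => hax.symm)
        simp at this
      · have := hmax _ (hP.snoc hx hxP fun j hj hjl => by
          have : j = i := by omega
          subst this
          exact hax)
        simp at this
    obtain ⟨j, hj, rfl⟩ := List.getElem_of_mem hxP
    refine ⟨j, hj, rfl, ?_⟩
    by_contra hcon
    have hij : i ≠ j := by
      rintro rfl
      exact hax.ne rfl
    by_cases hj1 : 1 ≤ j ∧ j + 1 < P.length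
    · obtain ⟨j, rfl⟩ : ∃ k, j = k + 1 := ⟨j - 1, by omega⟩
      rcases hint j (by omega) _ (hN i hi) hax.symm with h | h
      · have := hinj _ _ _ _ h
        omega
      · have := hinj _ _ _ _ h
        omega
    · by_cases hi0 : i = 0
      · subst hi0
        have : j = P.length - 1 := by omega
        subst this
        exact hcyc' (by omega) hax
      · have h1 : i = P.length - 1 := by omega
        have h2 : j = 0 := by omega
        subst h1 h2
        exact hcyc' (by omega) hax.symm
  have hss : N.filter (fun x => x ∉ P) ⊂ N := by
    refine Finset.filter_ssubset.2 ⟨P[0], hN 0 hpos, ?_⟩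
    simp
  rcases ih _ hss (fun n hn a ha b hb c hc => hdeg n (Finset.mem_filter.1 hn).1 a
    (Finset.mem_filter.1 ha).1 b (Finset.mem_filter.1 hb).1 c (Finset.mem_filter.1 hc).1) with
    ⟨l, hl, h3⟩ | ⟨l, hl, hmem, hadj⟩
  · exact Or.inl ⟨l, ⟨hl.nodup, fun x hx => (Finset.mem_filter.1 (hl.sub x hx)).1, hl.adj⟩, h3⟩
  · right
    have hmem' : ∀ x ∈ l, x ∈ N ∧ x ∉ P := fun x hx => Finset.mem_filter.1 ((hmem x).1 hx)
    have hcross : ∀ i (hi : i < P.length), ∀ x ∈ l, ¬ Λ.Adj P[i] x := by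
      intro i hi x hx hax
      obtain ⟨j, hj, rfl, -⟩ := hcl i hi x (hmem' x hx).1 hax
      exact (hmem' _ hx).2 (List.getElem_mem hj)
    refine ⟨P ++ l, ?_, ?_, ?_⟩
    · rw [List.nodup_append]
      refine ⟨hP.nodup, hl, ?_⟩
      rintro a ha b hb rfl
      exact (hmem' _ hb).2 ha
    · intro x
      rw [List.mem_append, hmem, Finset.mem_filter]
      have := hP.sub x
      tauto
    · intro i j hi hj hij
      by_cases hiP : i < P.length <;> by_cases hjP : j < P.length
      · rw [List.getElem_append_left hiP, List.getElem_append_left hjP] at hij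
        obtain ⟨k, hk, hkj, hik⟩ := hcl i hiP _ (hN j hjP) hij
        have := hinj _ _ _ _ hkj
        omega
      · rw [List.getElem_append_left hiP, List.getElem_append_right (by omega)] at hij
        exact (hcross i hiP _ (List.getElem_mem _) hij).elim
      · rw [List.getElem_append_left hjP, List.getElem_append_right (by omega)] at hij
        exact (hcross j hjP _ (List.getElem_mem _) hij.symm).elim
      · rw [List.getElem_append_right (by omega), List.getElem_append_right (by omega)] at hij
        have := hadj _ _ _ _ hij
        omega

end

section

variable {V : Type}

/-- `F` without the edges meeting the closed neighbourhood of `h`. -/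
def innerGraph (F : SimpleGraph V) (h : V) : SimpleGraph V where
  Adj x y := F.Adj x y ∧ (¬ F.Adj h x ∧ x ≠ h) ∧ ¬ F.Adj h y ∧ y ≠ h
  symm := ⟨fun _ _ hxy => ⟨hxy.1.symm, hxy.2.2, hxy.2.1⟩⟩
  loopless := ⟨fun _ hx => hx.1.ne rfl⟩

/-- The neighbours of `h` seen from the component of `x` outside the neighbourhood of `h`. -/
def attach (F : SimpleGraph V) (h x : V) : Set V :=
  {n | F.Adj h n ∧ ∃ y, (innerGraph F h).Reachable x y ∧ F.Adj y n}

/-- Neighbours of `h` joined by an edge or through a component outside the neighbourhood. -/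
def linkGraph (F : SimpleGraph V) (h : V) : SimpleGraph V where
  Adj a b := a ≠ b ∧ F.Adj h a ∧ F.Adj h b ∧ (F.Adj a b ∨ ∃ x, (¬ F.Adj h x ∧ x ≠ h) ∧
    a ∈ attach F h x ∧ b ∈ attach F h x)
  symm := ⟨fun _ _ hab => ⟨hab.1.symm, hab.2.2.1, hab.2.1, hab.2.2.2.imp Adj.symm
    fun ⟨x, h1, h2, h3⟩ => ⟨x, h1, h3, h2⟩⟩⟩
  loopless := ⟨fun _ hx => hx.1 rfl⟩

/-- The link graph together with the hub. -/
def wheelGraph (F : SimpleGraph V) (h : V) : SimpleGraph V where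
  Adj a b := (linkGraph F h).Adj a b ∨ (a = h ∧ F.Adj h b) ∨ (b = h ∧ F.Adj h a)
  symm := ⟨fun a b hab => by
    rcases hab with hab | hab | hab
    · exact Or.inl hab.symm
    · exact Or.inr (Or.inr hab)
    · exact Or.inr (Or.inl hab)⟩
  loopless := ⟨fun x hx => by
    rcases hx with hx | ⟨rfl, hx⟩ | ⟨rfl, hx⟩
    · exact hx.ne rfl
    · exact hx.ne rfl
    · exact hx.ne rfl⟩

lemma innerGraph_reachable_out {F : SimpleGraph V} {h x y : V} (hx : ¬ F.Adj h x ∧ x ≠ h)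
    (hxy : (innerGraph F h).Reachable x y) : ¬ F.Adj h y ∧ y ≠ h := by
  obtain ⟨w⟩ := hxy
  induction w with
  | nil => exact hx
  | cons hab _ ih => exact ih hab.2.2

lemma attach_eq {F : SimpleGraph V} {h x y : V} (hxy : (innerGraph F h).Reachable x y) :
    attach F h x = attach F h y := by
  ext n
  exact ⟨fun ⟨h1, z, h2, h3⟩ => ⟨h1, z, hxy.symm.trans h2, h3⟩,
    fun ⟨h1, z, h2, h3⟩ => ⟨h1, z, hxy.trans h2, h3⟩⟩

lemma innerGraph_le (F : SimpleGraph V) (h : V) : innerGraph F h ≤ F := fun _ _ hab => hab.1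

lemma connected_component_induce (F : SimpleGraph V) (h x : V) :
    (F.induce {y | (innerGraph F h).Reachable x y}).Connected := by
  apply induce_connected_mono (innerGraph_le F h)
  have := ((innerGraph F h).connectedComponentMk x).maximal_connected_induce_supp.1
  convert this using 2
  ext y
  simp [ConnectedComponent.supp, SimpleGraph.reachable_comm]

lemma attach_card {F : SimpleGraph V} {X : Set V} (hF : Cone F X) {h x : V}
    (hN : ∀ n, F.Adj h n → n ∈ X) (hx : ¬ F.Adj h x ∧ x ≠ h) {a b c : V}
    (ha : a ∈ attach F h x) (hb : b ∈ attach F h x) (hc : c ∈ attach F h x) :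
    a = b ∨ a = c ∨ b = c := by
  by_contra hcon
  push Not at hcon
  obtain ⟨hab, hac, hbc⟩ := hcon
  have hall : ∀ i : Fin 3, ![a, b, c] i ∈ attach F h x := by
    intro i
    fin_cases i <;> assumption
  refine hF.k23 (A := fun i => {![a, b, c] i}) (B := {h})
    (C := {y | (innerGraph F h).Reachable x y}) (fun i => induce_singleton_connected F _)
    (induce_singleton_connected F _) (connected_component_induce F h x) ?_ ?_ ?_ ?_ ?_ ?_ ?_
  · intro i j hij
    fin_cases i <;> fin_cases j <;> simp_all [eq_comm]
  · intro i
    rw [Set.disjoint_singleton]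
    exact (hall i).1.ne'
  · intro i
    rw [Set.disjoint_singleton_left]
    exact fun hr => (innerGraph_reachable_out hx hr).1 (hall i).1
  · rw [Set.disjoint_singleton_left]
    exact fun hr => (innerGraph_reachable_out hx hr).2 rfl
  · exact fun i => ⟨_, rfl, hN _ (hall i).1⟩
  · exact fun i => ⟨_, rfl, h, rfl, (hall i).1.symm⟩
  · intro i
    obtain ⟨-, y, hy, hyn⟩ := hall i
    exact ⟨_, rfl, y, hy, hyn.symm⟩

lemma exists_home (V : Type) [Nonempty V] : ∃ home : Set V → V, ∀ S, S.Nonempty → home S ∈ S := by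
  classical
  exact ⟨fun S => if hS : S.Nonempty then hS.some else Classical.arbitrary V, fun S hS => by
    simp only [dif_pos hS]
    exact hS.some_mem⟩

lemma wheelGraph_isModel {F : SimpleGraph V} {X : Set V} (hF : Cone F X) {h : V}
    (hN : ∀ n, F.Adj h n → n ∈ X) : ∃ M, IsModel (wheelGraph F h) F M := by
  have : Nonempty V := ⟨h⟩
  obtain ⟨home, hhome⟩ := exists_home V
  let M : V → Set V := fun v =>
    {y | y = v ∨ (¬ F.Adj h y ∧ y ≠ h) ∧ (attach F h y).Nonempty ∧ home (attach F h y) = v}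
  have hsup : ∀ v ∈ (wheelGraph F h).support, F.Adj h v ∨ v = h := by
    rintro v ⟨w, hw | hw | hw⟩
    · exact Or.inl hw.2.1
    · exact Or.inr hw.1
    · exact Or.inl hw.2
  have hlink : ∀ a b x, a ≠ b → (¬ F.Adj h x ∧ x ≠ h) → a ∈ attach F h x → b ∈ attach F h x →
      home (attach F h x) = a → ∃ y ∈ M a, ∃ z ∈ M b, F.Adj y z := by
    intro a b x hab hx hax hbx hm
    obtain ⟨-, y, hxy, hyb⟩ := hbx
    refine ⟨y, Or.inr ⟨innerGraph_reachable_out hx hxy, ?_⟩, b, Or.inl rfl, hyb⟩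
    rw [← attach_eq hxy]
    exact ⟨⟨_, hax⟩, hm⟩
  refine ⟨M, fun v _ => Or.inl rfl, ?_, ?_, ?_⟩
  · intro v hv
    apply induce_connected_of_patches v (Or.inl rfl)
    rintro y (rfl | ⟨hy, hne, hvy⟩)
    · exact ⟨{y}, by simp [M], rfl, rfl, Reachable.refl _⟩
    · have hva : v ∈ attach F h y := hvy ▸ hhome _ hne
      obtain ⟨-, z, hyz, hzv⟩ := hva
      refine ⟨{v} ∪ {z | (innerGraph F h).Reachable y z}, ?_, Or.inl rfl,
        Or.inr (Reachable.refl _), ?_⟩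
      · rintro z (hz | hz)
        · exact Or.inl hz
        · refine Or.inr ⟨innerGraph_reachable_out hy hz, ?_⟩
          rw [← attach_eq hz]
          exact ⟨hne, hvy⟩
      · exact (connected_induce_union (induce_singleton_connected F v).preconnected
          (connected_component_induce F h y).preconnected rfl hyz hzv.symm).preconnected _ _
  · intro v hv v' hv' hvv
    rw [Set.disjoint_left]
    rintro y (rfl | ⟨hy, hne, rfl⟩) (rfl | ⟨hy', hne', rfl⟩)
    · exact hvv rfl
    · rcases hsup _ hv with h1 | h1
      · exact hy'.1 h1
      · exact hy'.2 h1
    · rcases hsup _ hv' with h1 | h1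
      · exact hy.1 h1
      · exact hy.2 h1
    · exact hvv rfl
  · rintro a b (⟨hab, ha, hb, hadj | ⟨x, hx, hax, hbx⟩⟩ | ⟨rfl, hb⟩ | ⟨rfl, ha⟩)
    · exact ⟨a, Or.inl rfl, b, Or.inl rfl, hadj⟩
    · have hm := hhome _ ⟨a, hax⟩
      rcases attach_card hF hN hx hax hbx hm with h1 | h1 | h1
      · exact (hab h1).elim
      · exact hlink a b x hab hx hax hbx h1.symm
      · obtain ⟨y, hy, z, hz, hyz⟩ := hlink b a x hab.symm hx hbx hax h1.symm
        exact ⟨z, hz, y, hy, hyz.symm⟩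
    · exact ⟨_, Or.inl rfl, b, Or.inl rfl, hb⟩
    · exact ⟨a, Or.inl rfl, _, Or.inl rfl, ha.symm⟩

lemma wheelGraph_cone {F : SimpleGraph V} {X : Set V} (hF : Cone F X) {h : V}
    (hN : ∀ n, F.Adj h n → n ∈ X) : Cone (wheelGraph F h) X :=
  let ⟨_, hM⟩ := wheelGraph_isModel hF hN
  hF.of_isModel hM

lemma linkGraph_degree {F : SimpleGraph V} {X : Set V} (hF : Cone F X) {h : V}
    (hN : ∀ n, F.Adj h n → n ∈ X) {n a b c : V} (ha : (linkGraph F h).Adj n a)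
    (hb : (linkGraph F h).Adj n b) (hc : (linkGraph F h).Adj n c) : a = b ∨ a = c ∨ b = c := by
  by_contra hcon
  push Not at hcon
  obtain ⟨hab, hac, hbc⟩ := hcon
  have hall : ∀ i : Fin 3, (linkGraph F h).Adj n (![a, b, c] i) := by
    intro i
    fin_cases i <;> assumption
  refine (wheelGraph_cone hF hN).k23 (A := fun i => {![a, b, c] i}) (B := {h}) (C := {n})
    (fun i => induce_singleton_connected _ _) (induce_singleton_connected _ _)
    (induce_singleton_connected _ _) ?_ ?_ ?_ ?_ ?_ ?_ ?_
  · intro i j hij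
    fin_cases i <;> fin_cases j <;> simp_all [eq_comm]
  · intro i
    rw [Set.disjoint_singleton]
    exact (hall i).2.2.1.ne'
  · intro i
    rw [Set.disjoint_singleton]
    exact (hall i).1.symm
  · rw [Set.disjoint_singleton]
    exact ha.2.1.ne
  · exact fun i => ⟨_, rfl, hN _ (hall i).2.2.1⟩
  · intro i
    refine ⟨![a, b, c] i, rfl, h, rfl, ?_⟩
    exact Or.inr (Or.inr ⟨rfl, (hall i).2.2.1⟩)
  · intro i
    refine ⟨![a, b, c] i, rfl, n, rfl, ?_⟩
    exact Or.inl (hall i).symm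

lemma induce_connected_drop {K : SimpleGraph V} {l : List V} (k : ℕ) (hk : k < l.length)
    (hl : ∀ i (h : i + 1 < l.length), K.Adj l[i] l[i + 1]) :
    (K.induce {x | ∃ i, ∃ h : i < l.length, k ≤ i ∧ x = l[i]}).Connected := by
  refine induce_connected_of_patches (s := {x | ∃ i, ∃ h : i < l.length, k ≤ i ∧ x = l[i]})
    l[k] ⟨k, hk, le_rfl, rfl⟩ ?_
  have key : ∀ d (h : k + d < l.length),
      (K.induce {x | ∃ i, ∃ h : i < l.length, k ≤ i ∧ x = l[i]}).Reachable
        ⟨l[k], ⟨k, hk, le_rfl, rfl⟩⟩ ⟨l[k + d], ⟨k + d, h, by omega, rfl⟩⟩ := by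
    intro d
    induction d with
    | zero => exact fun _ => Reachable.refl _
    | succ d ih =>
      intro h
      refine (ih (by omega)).trans (Adj.reachable ?_)
      exact hl (k + d) (by omega)
  rintro _ ⟨i, hi, hki, rfl⟩
  refine ⟨_, le_rfl, ⟨k, hk, le_rfl, rfl⟩, ⟨i, hi, hki, rfl⟩, ?_⟩
  obtain ⟨d, rfl⟩ := Nat.exists_eq_add_of_le hki
  exact key d hi

lemma linkGraph_no_cycle {F : SimpleGraph V} {X : Set V} (hF : Cone F X) {h : V}
    (hN : ∀ n, F.Adj h n → n ∈ X) {N : Finset V} {l : List V}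
    (hl : IsPathList (linkGraph F h) N l) (h3 : 3 ≤ l.length)
    (hcl : (linkGraph F h).Adj l[0] l[l.length - 1]) {Y : Set V} (hY : h ∈ Y)
    (hYc : ((wheelGraph F h).induce Y).Connected) (hYX : (Y ∩ X).Nonempty)
    (hYl : ∀ y ∈ Y, y ∉ l) : False := by
  have hadj : ∀ i (hi : i + 1 < l.length), (wheelGraph F h).Adj l[i] l[i + 1] :=
    fun i hi => Or.inl (hl.adj i hi)
  have hinj : ∀ i j (hi : i < l.length) (hj : j < l.length), l[i] = l[j] → i = j :=
    fun i j hi hj h => (hl.nodup.getElem_inj_iff).1 h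
  have hnb : ∀ i (hi : i < l.length), F.Adj h l[i] := by
    intro i hi
    by_cases hi' : i + 1 < l.length
    · exact (hl.adj i hi').2.1
    · obtain ⟨j, rfl⟩ : ∃ j, i = j + 1 := ⟨i - 1, by omega⟩
      exact (hl.adj j hi).2.2.1
  have hw : ∀ i (hi : i < l.length), (wheelGraph F h).Adj h l[i] :=
    fun i hi => Or.inr (Or.inl ⟨rfl, hnb i hi⟩)
  let R : Set V := {x | ∃ i, ∃ h : i < l.length, 2 ≤ i ∧ x = l[i]}
  let B : Fin 4 → Set V := ![{l[0]}, {l[1]}, R, Y]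
  have hdis : ∀ i j, i < j → Disjoint (B i) (B j) := by
    have d01 : Disjoint (B 0) (B 1) := by
      simp only [B, Matrix.cons_val, Set.disjoint_singleton]
      exact fun h => absurd (hinj _ _ _ _ h) (by decide)
    have d02 : Disjoint (B 0) (B 2) := by
      simp only [B, Matrix.cons_val, Set.disjoint_singleton_left]
      rintro ⟨i, hi, h2, h⟩
      have := hinj _ _ _ _ h
      omega
    have d12 : Disjoint (B 1) (B 2) := by
      simp only [B, Matrix.cons_val, Set.disjoint_singleton_left]
      rintro ⟨i, hi, h2, h⟩
      have := hinj _ _ _ _ h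
      omega
    have d03 : Disjoint (B 0) (B 3) := by
      simp only [B, Matrix.cons_val, Set.disjoint_singleton_left]
      exact fun h => hYl _ h (List.getElem_mem _)
    have d13 : Disjoint (B 1) (B 3) := by
      simp only [B, Matrix.cons_val, Set.disjoint_singleton_left]
      exact fun h => hYl _ h (List.getElem_mem _)
    have d23 : Disjoint (B 2) (B 3) := by
      simp only [B, Matrix.cons_val, Set.disjoint_left]
      rintro _ ⟨i, hi, -, rfl⟩ h
      exact hYl _ h (List.getElem_mem _)
    intro i j hij
    fin_cases i <;> fin_cases j <;> first | assumption | simp at hij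
  have hBadj : ∀ i j, i < j → ∃ a ∈ B i, ∃ b ∈ B j, (wheelGraph F h).Adj a b := by
    have d01 : ∃ a ∈ B 0, ∃ b ∈ B 1, (wheelGraph F h).Adj a b :=
      ⟨l[0], rfl, l[1], rfl, hadj 0 (by omega)⟩
    have d02 : ∃ a ∈ B 0, ∃ b ∈ B 2, (wheelGraph F h).Adj a b :=
      ⟨l[0], rfl, l[l.length - 1], ⟨_, by omega, by omega, rfl⟩, Or.inl hcl⟩
    have d12 : ∃ a ∈ B 1, ∃ b ∈ B 2, (wheelGraph F h).Adj a b :=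
      ⟨l[1], rfl, l[2], ⟨_, by omega, by omega, rfl⟩, hadj 1 (by omega)⟩
    have d03 : ∃ a ∈ B 0, ∃ b ∈ B 3, (wheelGraph F h).Adj a b :=
      ⟨l[0], rfl, h, hY, (hw 0 (by omega)).symm⟩
    have d13 : ∃ a ∈ B 1, ∃ b ∈ B 3, (wheelGraph F h).Adj a b :=
      ⟨l[1], rfl, h, hY, (hw 1 (by omega)).symm⟩
    have d23 : ∃ a ∈ B 2, ∃ b ∈ B 3, (wheelGraph F h).Adj a b :=
      ⟨l[2], ⟨2, by omega, le_rfl, rfl⟩, h, hY, (hw 2 (by omega)).symm⟩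
    intro i j hij
    fin_cases i <;> fin_cases j <;> first | assumption | simp at hij
  refine (wheelGraph_cone hF hN).noK4 ⟨B, ?_, ?_, ?_, ?_⟩
  · intro i
    fin_cases i
    · exact induce_singleton_connected _ _
    · exact induce_singleton_connected _ _
    · exact induce_connected_drop 2 (by omega) hadj
    · exact hYc
  · intro i j hij
    rcases lt_or_gt_of_ne hij with hlt | hlt
    · exact hdis i j hlt
    · exact (hdis j i hlt).symm
  · intro i j hij
    rcases lt_or_gt_of_ne hij.ne with hlt | hlt
    · exact hBadj i j hlt
    · obtain ⟨a, ha, b, hb, hab⟩ := hBadj j i hlt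
      exact ⟨b, hb, a, ha, hab.symm⟩
  · intro i _
    fin_cases i
    · exact ⟨l[0], rfl, hN _ (hnb 0 (by omega))⟩
    · exact ⟨l[1], rfl, hN _ (hnb 1 (by omega))⟩
    · exact ⟨l[2], ⟨2, by omega, le_rfl, rfl⟩, hN _ (hnb 2 (by omega))⟩
    · exact hYX

end

section

variable {V : Type}

lemma hub_list [Finite V] {F : SimpleGraph V} {X : Set V} (hF : Cone F X) {h : V}
    (hN : ∀ n, F.Adj h n → n ∈ X) :
    (∃ l : List V, (∀ x ∈ l, F.Adj h x) ∧ l.Nodup ∧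
      (∀ i (h' : i + 1 < l.length), (linkGraph F h).Adj l[i] l[i + 1]) ∧
      (∃ h' : 3 ≤ l.length, (linkGraph F h).Adj l[0] l[l.length - 1]) ∧
      ∀ Y : Set V, h ∈ Y → ((wheelGraph F h).induce Y).Connected → (Y ∩ X).Nonempty →
        ∃ y ∈ Y, y ∈ l) ∨
    ∃ l : List V, l.Nodup ∧ (∀ x, x ∈ l ↔ F.Adj h x) ∧
      ∀ i j (hi : i < l.length) (hj : j < l.length), (linkGraph F h).Adj l[i] l[j] →
        j = i + 1 ∨ i = j + 1 := by
  have hfin : (F.neighborSet h).Finite := Set.toFinite _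
  have hmem : ∀ x, x ∈ hfin.toFinset ↔ F.Adj h x := fun x => by simp
  rcases exists_cycle_or_list (linkGraph F h) hfin.toFinset
    (fun n _ a _ b _ c _ ha hb hc => linkGraph_degree hF hN ha hb hc) with
    ⟨l, hl, h3, hcl⟩ | ⟨l, hl, hm, hadj⟩
  · refine Or.inl ⟨l, fun x hx => (hmem x).1 (hl.sub x hx), hl.nodup, hl.adj, ⟨h3, hcl⟩, ?_⟩
    intro Y hY hYc hYX
    by_contra hcon
    push Not at hcon
    exact linkGraph_no_cycle hF hN hl h3 hcl hY hYc hYX hcon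
  · exact Or.inr ⟨l, hl, fun x => (hm x).trans (hmem x), hadj⟩

/-- The neighbours of a hub in `X`, listed linearly. -/
lemma hub_linear [Finite V] {F : SimpleGraph V} {X : Set V} (hF : Cone F X) {h : V}
    (hN : ∀ n, F.Adj h n → n ∈ X) (hX : h ∈ X) :
    ∃ (n : ℕ → V) (m : ℕ), (∀ i j, i < m → j < m → n i = n j → i = j) ∧
      (∀ x, F.Adj h x ↔ ∃ i < m, n i = x) ∧
      ∀ a b, (linkGraph F h).Adj a b → ∃ i, i + 1 < m ∧
        (a = n i ∧ b = n (i + 1) ∨ b = n i ∧ a = n (i + 1)) := by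
  rcases hub_list hF hN with ⟨l, hl, -, -, -, hY⟩ | ⟨l, hnd, hmem, hadj⟩
  · obtain ⟨y, rfl, hyl⟩ := hY {h} rfl (induce_singleton_connected _ _) ⟨h, rfl, hX⟩
    exact ((hl _ hyl).ne rfl).elim
  · have hget : ∀ i (hi : i < l.length), l.getD i h = l[i] := fun i hi => by simp [hi]
    refine ⟨fun i => l.getD i h, l.length, ?_, ?_, ?_⟩
    · intro i j hi hj hij
      simp only [hget i hi, hget j hj] at hij
      exact (hnd.getElem_inj_iff).1 hij
    · intro x
      rw [← hmem x]
      constructor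
      · intro hx
        obtain ⟨i, hi, rfl⟩ := List.getElem_of_mem hx
        exact ⟨i, hi, hget i hi⟩
      · rintro ⟨i, hi, rfl⟩
        simp only [hget i hi]
        exact List.getElem_mem hi
    · intro a b hab
      obtain ⟨i, hi, rfl⟩ := List.getElem_of_mem ((hmem a).2 hab.2.1)
      obtain ⟨j, hj, rfl⟩ := List.getElem_of_mem ((hmem b).2 hab.2.2.1)
      rcases hadj i j hi hj hab with rfl | rfl
      · exact ⟨i, hj, Or.inl ⟨(hget _ _).symm, (hget _ _).symm⟩⟩
      · exact ⟨j, hi, Or.inr ⟨(hget _ _).symm, (hget _ _).symm⟩⟩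

/-- The neighbours of a hub outside `X`, listed cyclically. -/
lemma hub_cyclic [Finite V] {F : SimpleGraph V} {X : Set V} (hF : Cone F X) {h : V}
    (hN : ∀ n, F.Adj h n → n ∈ X) {x0 x1 : V} (h0 : F.Adj h x0) (h1 : F.Adj h x1) (h01 : x0 ≠ x1) :
    ∃ (n : ℕ → V) (m : ℕ), 2 ≤ m ∧ (∀ i j, n i = n j ↔ i ≡ j [MOD m]) ∧
      (∀ x, F.Adj h x ↔ ∃ i, n i = x) ∧
      ∀ a b, (linkGraph F h).Adj a b → ∃ i,
        (a = n i ∧ b = n (i + 1) ∨ b = n i ∧ a = n (i + 1)) := by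
  have main : ∀ l : List V, 2 ≤ l.length → l.Nodup → (∀ x, x ∈ l ↔ F.Adj h x) →
      ∃ n : ℕ → V, (∀ i (hi : i < l.length), n i = l[i]) ∧
        (∀ i j, n i = n j ↔ i ≡ j [MOD l.length]) ∧ (∀ x, F.Adj h x ↔ ∃ i, n i = x) := by
    intro l h2 hnd hmem
    have hlt : ∀ i, i % l.length < l.length := fun i => Nat.mod_lt _ (by omega)
    refine ⟨fun i => getElem l (i % l.length) (hlt i), ?_, ?_, ?_⟩
    · intro i hi
      simp only [Nat.mod_eq_of_lt hi]
    · intro i j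
      simp only [hnd.getElem_inj_iff, Nat.ModEq]
    · intro x
      rw [← hmem x]
      constructor
      · intro hx
        obtain ⟨i, hi, rfl⟩ := List.getElem_of_mem hx
        exact ⟨i, by simp only [Nat.mod_eq_of_lt hi]⟩
      · rintro ⟨i, rfl⟩
        exact List.getElem_mem _
  rcases hub_list hF hN with ⟨l, hl, hnd, hadj, ⟨h3, hcl⟩, hY⟩ | ⟨l, hnd, hmem, hadj⟩
  · have hmem : ∀ x, x ∈ l ↔ F.Adj h x := by
      refine fun x => ⟨hl x, fun hx => ?_⟩
      have hc : ((wheelGraph F h).induce {h, x}).Connected :=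
        induce_pair_connected_of_adj (Or.inr (Or.inl ⟨rfl, hx⟩))
      obtain ⟨y, rfl | rfl, hyl⟩ := hY _ (Or.inl rfl) hc ⟨x, Or.inr rfl, hN x hx⟩
      · exact ((hl _ hyl).ne rfl).elim
      · exact hyl
    obtain ⟨n, hn, hmod, hnN⟩ := main l (by omega) hnd hmem
    refine ⟨n, l.length, by omega, hmod, hnN, ?_⟩
    have hper : ∀ i, n i = n (i % l.length) := fun i => (hmod _ _).2 (Nat.mod_modEq _ _).symm
    have hstep : ∀ i, (linkGraph F h).Adj (n i) (n (i + 1)) := by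
      intro i
      have hlt : i % l.length < l.length := Nat.mod_lt _ (by omega)
      have e1 : n (i + 1) = n (i % l.length + 1) :=
        (hmod _ _).2 ((Nat.mod_modEq _ _).symm.add_right 1)
      rw [hper i, e1]
      by_cases hi : i % l.length + 1 < l.length
      · rw [hn _ hlt, hn _ hi]
        exact hadj _ hi
      · have e2 : i % l.length = l.length - 1 := by omega
        have e3 : n (i % l.length + 1) = n 0 := by
          rw [hmod, e2, Nat.sub_add_cancel (by omega)]
          exact (Nat.modEq_zero_iff_dvd.2 dvd_rfl)
        rw [e3, e2, hn 0 (by omega), hn _ (by omega)]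
        exact hcl.symm
    intro a b hab
    obtain ⟨i, rfl⟩ := (hnN a).1 hab.2.1
    have e : n i = n (i + (l.length - 1) + 1) := by
      rw [hmod, add_assoc, Nat.sub_add_cancel (by omega)]
      exact (Nat.add_modEq_right).symm
    have hprev := (hstep (i + (l.length - 1))).symm
    rw [← e] at hprev
    have hne : n (i + 1) ≠ n (i + (l.length - 1)) := by
      rw [Ne, hmod]
      intro hc
      have := Nat.ModEq.add_left_cancel' i hc
      rw [Nat.modEq_iff_dvd' (by omega)] at this
      have := Nat.le_of_dvd (by omega) this
      omega
    rcases linkGraph_degree hF hN (hstep i) hprev hab with h' | h' | h'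
    · exact (hne h').elim
    · exact ⟨i, Or.inl ⟨rfl, h'.symm⟩⟩
    · exact ⟨_, Or.inr ⟨h'.symm, e⟩⟩
  · have h2 : 2 ≤ l.length := by
      classical
      have : ({x0, x1} : Finset V).card ≤ l.toFinset.card := by
        apply Finset.card_le_card
        intro x hx
        rw [List.mem_toFinset, hmem]
        simp only [Finset.mem_insert, Finset.mem_singleton] at hx
        rcases hx with rfl | rfl <;> assumption
      rw [Finset.card_pair h01, List.toFinset_card_of_nodup hnd] at this
      exact this
    obtain ⟨n, hn, hmod, hnN⟩ := main l h2 hnd hmem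
    refine ⟨n, l.length, h2, hmod, hnN, ?_⟩
    intro a b hab
    obtain ⟨i, hi, rfl⟩ := List.getElem_of_mem ((hmem a).2 hab.2.1)
    obtain ⟨j, hj, rfl⟩ := List.getElem_of_mem ((hmem b).2 hab.2.2.1)
    rcases hadj i j hi hj hab with rfl | rfl
    · exact ⟨i, Or.inl ⟨(hn _ _).symm, (hn _ _).symm⟩⟩
    · exact ⟨j, Or.inr ⟨(hn _ _).symm, (hn _ _).symm⟩⟩

/-- Every vertex away from the hub is assigned to a consecutive pair of the list `n`. -/
lemma exists_host {F : SimpleGraph V} {X : Set V} (hF : Cone F X) {h : V}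
    (hN : ∀ n, F.Adj h n → n ∈ X) {n : ℕ → V} {m : ℕ} (hm : 0 < m)
    (hcov : ∀ a, F.Adj h a → ∃ i < m, a = n i ∨ a = n (i + 1))
    (hlink : ∀ a b, (linkGraph F h).Adj a b → ∃ i < m,
        (a = n i ∧ b = n (i + 1) ∨ b = n i ∧ a = n (i + 1))) :
    ∃ host : V → ℕ, (∀ x, host x < m) ∧
      (∀ x y, F.Adj x y → x ≠ h → y ≠ h → ¬ F.Adj h x → ¬ F.Adj h y → host x = host y) ∧
      (∀ x a, F.Adj x a → x ≠ h → ¬ F.Adj h x → F.Adj h a →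
        a = n (host x) ∨ a = n (host x + 1)) ∧
      (∀ a b, F.Adj a b → F.Adj h a → F.Adj h b → ∃ i < m,
        (a = n i ∧ b = n (i + 1) ∨ b = n i ∧ a = n (i + 1))) := by
  have key : ∀ x, x ≠ h → ¬ F.Adj h x →
      ∃ i < m, ∀ a ∈ attach F h x, a = n i ∨ a = n (i + 1) := by
    intro x hxh hx
    by_cases h2 : ∃ a ∈ attach F h x, ∃ b ∈ attach F h x, a ≠ b
    · obtain ⟨a, ha, b, hb, hab⟩ := h2
      obtain ⟨i, hi, hi'⟩ := hlink a b ⟨hab, ha.1, hb.1, Or.inr ⟨x, ⟨hx, hxh⟩, ha, hb⟩⟩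
      refine ⟨i, hi, fun c hc => ?_⟩
      rcases attach_card hF hN ⟨hx, hxh⟩ ha hb hc with h1 | h1 | h1
      · exact (hab h1).elim
      · subst h1
        tauto
      · subst h1
        tauto
    · push Not at h2
      by_cases h1 : ∃ a, a ∈ attach F h x
      · obtain ⟨a, ha⟩ := h1
        obtain ⟨i, hi, hi'⟩ := hcov a ha.1
        exact ⟨i, hi, fun c hc => h2 a ha c hc ▸ hi'⟩
      · exact ⟨0, hm, fun a ha => (h1 ⟨a, ha⟩).elim⟩
  have hH : ∀ S : Set V, ∃ i < m, (∃ j < m, ∀ a ∈ S, a = n j ∨ a = n (j + 1)) →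
      ∀ a ∈ S, a = n i ∨ a = n (i + 1) := by
    intro S
    by_cases hS : ∃ j < m, ∀ a ∈ S, a = n j ∨ a = n (j + 1)
    · obtain ⟨j, hj, hS'⟩ := hS
      exact ⟨j, hj, fun _ => hS'⟩
    · exact ⟨0, hm, fun h => (hS h).elim⟩
  choose H hHm hHS using hH
  refine ⟨fun x => H (attach F h x), fun x => hHm _, ?_, ?_, ?_⟩
  · intro x y hxy hx hy hhx hhy
    have : (innerGraph F h).Adj x y := ⟨hxy, ⟨hhx, hx⟩, hhy, hy⟩
    simp only [attach_eq this.reachable]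
  · intro x a hxa hx hhx hha
    exact hHS _ (key x hx hhx) a ⟨hha, x, Reachable.refl _, hxa⟩
  · intro a b hab ha hb
    exact hlink a b ⟨hab.ne, ha, hb, Or.inl hab⟩

/-- The subgraph of `F` on `T` together with the edge `ab`. -/
def pieceGraph (F : SimpleGraph V) (T : Set V) (a b : V) : SimpleGraph V where
  Adj x y := (F.Adj x y ∧ x ∈ T ∧ y ∈ T) ∨ (a ≠ b ∧ (x = a ∧ y = b ∨ x = b ∧ y = a))
  symm := ⟨fun _ _ hxy => hxy.imp (fun h => ⟨h.1.symm, h.2.2, h.2.1⟩)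
    (fun h => ⟨h.1, h.2.symm.imp And.symm And.symm⟩)⟩
  loopless := ⟨fun x hx => by
    rcases hx with hx | ⟨hab, ⟨rfl, rfl⟩ | ⟨rfl, rfl⟩⟩
    · exact hx.1.ne rfl
    · exact hab rfl
    · exact hab rfl⟩

lemma pieceGraph_cone {F : SimpleGraph V} {X T : Set V} {a b h : V} (hF : Cone F X) (hh : h ∉ T)
    (haT : a ∈ T) (hbT : b ∈ T) (ha : F.Adj h a) (hb : F.Adj h b) :
    Cone (pieceGraph F T a b) X := by
  classical
  have hsup : ∀ v ∈ (pieceGraph F T a b).support, v ∈ T := by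
    rintro v ⟨w, ⟨-, hv, -⟩ | ⟨-, ⟨rfl, -⟩ | ⟨rfl, -⟩⟩⟩ <;> assumption
  refine hF.of_isModel (M := fun v => if v = b then {b, h} else {v}) ⟨?_, ?_, ?_, ?_⟩
  · intro v _
    by_cases hv : v = b <;> simp [hv]
  · intro v _
    have gen : ∀ S : Set V, S = {b, h} ∨ S = {v} → (F.induce S).Connected := by
      rintro S (rfl | rfl)
      · exact induce_pair_connected_of_adj hb.symm
      · exact induce_singleton_connected _ _
    apply gen
    by_cases hv : v = b <;> simp [hv]
  · intro v hv v' hv' hvv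
    have h1 : v ≠ h := fun e => hh (e ▸ hsup v hv)
    have h2 : v' ≠ h := fun e => hh (e ▸ hsup v' hv')
    by_cases hvb : v = b <;> by_cases hvb' : v' = b
    · exact (hvv (hvb.trans hvb'.symm)).elim
    · simp only [hvb, hvb', if_true, if_false]
      rw [Set.disjoint_singleton_right]
      rintro (e | e)
      · exact hvb' e
      · exact h2 e
    · simp only [hvb, hvb', if_true, if_false]
      rw [Set.disjoint_singleton_left]
      rintro (e | e)
      · exact hvb e
      · exact h1 e
    · simp only [hvb, hvb', if_false]
      rwa [Set.disjoint_singleton]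
  · have hm : ∀ v, v ∈ (if v = b then {b, h} else {v} : Set V) := by
      intro v
      by_cases hv : v = b <;> simp [hv]
    rintro v v' (⟨hvv, -, -⟩ | ⟨hab, ⟨rfl, rfl⟩ | ⟨rfl, rfl⟩⟩)
    · exact ⟨v, hm v, v', hm v', hvv⟩
    · exact ⟨v, hm v, h, by simp, ha.symm⟩
    · exact ⟨h, by simp, v', hm v', ha⟩

lemma pieceGraph_card_lt [Finite V] {F : SimpleGraph V} {T : Set V} {a b h : V} (hh : h ∉ T)
    (ha : F.Adj h a) (hb : F.Adj h b) (hab : a ≠ b) :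
    (pieceGraph F T a b).edgeSet.ncard < F.edgeSet.ncard := by
  have hne : s(h, a) ≠ s(h, b) := by
    intro h'
    rw [Sym2.eq_iff] at h'
    rcases h' with ⟨-, h'⟩ | ⟨h', -⟩
    · exact hab h'
    · exact hb.ne h'
  have hsub : (pieceGraph F T a b).edgeSet ⊆
      insert s(a, b) ((F.edgeSet \ {s(h, a)}) \ {s(h, b)}) := by
    intro e
    induction e using Sym2.ind with
    | _ x y =>
    rintro (⟨hxy, hx, hy⟩ | ⟨-, ⟨rfl, rfl⟩ | ⟨rfl, rfl⟩⟩)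
    · refine Or.inr ⟨⟨hxy, ?_⟩, ?_⟩
      · simp only [Set.mem_singleton_iff, Sym2.eq_iff]
        rintro (⟨rfl, -⟩ | ⟨-, rfl⟩) <;> exact hh ‹_›
      · simp only [Set.mem_singleton_iff, Sym2.eq_iff]
        rintro (⟨rfl, -⟩ | ⟨-, rfl⟩) <;> exact hh ‹_›
    · exact Or.inl rfl
    · exact Or.inl Sym2.eq_swap
  have h1 := Set.ncard_le_ncard hsub (Set.toFinite _)
  have h2 := Set.ncard_insert_le s(a, b) ((F.edgeSet \ {s(h, a)}) \ {s(h, b)})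
  have h3 : ((F.edgeSet \ {s(h, a)}) \ {s(h, b)}).ncard + 1 = (F.edgeSet \ {s(h, a)}).ncard :=
    Set.ncard_sdiff_singleton_add_one ⟨hb, fun e => hne e.symm⟩ (Set.toFinite _)
  have h4 : (F.edgeSet \ {s(h, a)}).ncard + 1 = F.edgeSet.ncard :=
    Set.ncard_sdiff_singleton_add_one ha (Set.toFinite _)
  omega

end

/-- A colouring problem on graphs with vertices in `X ∪ W`: the vertices of `X` receive states,
adjacent ones have to satisfy `ok`, and the states around a vertex of `W` have to satisfy `Pol`.
The last three fields are the extension properties of the problem. -/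
structure ColSystem (V St : Type) where
  X : Set V
  W : Set V
  real : V → V → Prop
  ok : V → V → St → St → Prop
  strict : V → V → St → St → Prop
  Pol : V → Set V → (V → St) → Prop
  disj : ∀ x ∈ X, x ∉ W
  real_symm : ∀ x y, real x y → real y x
  ok_symm : ∀ x y s t, ok x y s t → ok y x t s
  pol_congr : ∀ w N f g, (∀ x ∈ N, f x = g x) → Pol w N f → Pol w N g
  pol_triv : ∀ w N f, N.Subsingleton → Pol w N f
  init : ∀ x y, x ≠ y → ∃ s t, ok x y s t
  child : ∀ u a x s t, u ≠ a → u ≠ x → a ≠ x → ok u a s t →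
    ∃ p, ok u x s p ∧ ok a x t p ∧ strict u x s p ∧ strict a x t p ∧
      (¬ strict x u p s → ¬ strict x a p t → real u a)
  poly : ∀ w ∈ W, ∀ (n : ℕ → V) (m : ℕ), 2 ≤ m → (∀ i j, n i = n j ↔ i ≡ j [MOD m]) →
    ∀ s t, ok (n 0) (n 1) s t → ∃ f : V → St, f (n 0) = s ∧ f (n 1) = t ∧
      (∀ i, ok (n i) (n (i + 1)) (f (n i)) (f (n (i + 1)))) ∧
      (3 ≤ m → strict (n 1) (n 2) t (f (n 2)) ∧ strict (n 0) (n (m - 1)) s (f (n (m - 1)))) ∧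
      (∀ i, i + 2 < m → ¬ strict (n (i + 2)) (n (i + 3)) (f (n (i + 2))) (f (n (i + 3))) →
        ¬ strict (n (i + 2)) (n (i + 1)) (f (n (i + 2))) (f (n (i + 1))) → real (n (i + 1)) (n (i + 3))) ∧
      Pol w (Set.range n) f

namespace ColSystem

variable {V St : Type} (S : ColSystem V St)

/-- `F` has only edges within `X` and between `X` and `W`. -/
def Fits (F : SimpleGraph V) : Prop :=
  ∀ x y, F.Adj x y → x ∈ S.X ∧ (y ∈ S.X ∨ y ∈ S.W) ∨ x ∈ S.W ∧ y ∈ S.X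

/-- `f` solves the colouring problem on `F`. -/
structure Sol (F : SimpleGraph V) (f : V → St) : Prop where
  ok : ∀ x y, x ∈ S.X → y ∈ S.X → F.Adj x y → S.ok x y (f x) (f y)
  pol : ∀ w ∈ S.W, S.Pol w {x | F.Adj w x} f
  bot : ∀ x y y', x ∈ S.X → y ∈ S.X → y' ∈ S.X → F.Adj x y → F.Adj x y' → y ≠ y' →
    ¬ S.strict x y (f x) (f y) → ¬ S.strict x y' (f x) (f y') → S.real y y'

/-- Every admissible pair of states on an edge `uv` extends to a solution which is strict at `u`
and `v`. -/
def Rooted (F : SimpleGraph V) : Prop :=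
  ∀ u v, u ∈ S.X → v ∈ S.X → F.Adj u v → ∀ s t, S.ok u v s t → ∃ f, S.Sol F f ∧ f u = s ∧ f v = t ∧
    (∀ y ∈ S.X, F.Adj u y → y ≠ v → S.strict u y s (f y)) ∧
    (∀ y ∈ S.X, F.Adj v y → y ≠ u → S.strict v y t (f y))

variable {S}

lemma Fits.piece {F : SimpleGraph V} (h : S.Fits F) {T : Set V} {a b : V} (ha : a ∈ S.X)
    (hb : b ∈ S.X) : S.Fits (pieceGraph F T a b) := by
  rintro x y (⟨hxy, -, -⟩ | ⟨-, ⟨rfl, rfl⟩ | ⟨rfl, rfl⟩⟩)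
  · exact h x y hxy
  · exact Or.inl ⟨ha, Or.inl hb⟩
  · exact Or.inl ⟨hb, Or.inl ha⟩

lemma Fits.nbr {F : SimpleGraph V} (h : S.Fits F) {w x : V} (hw : w ∈ S.W) (hx : F.Adj w x) :
    x ∈ S.X := by
  rcases h w x hx with h1 | h1
  · exact (S.disj _ h1.1 hw).elim
  · exact h1.2

/-- The vertices of a piece: those hosted at `i`, and the two vertices of the `i`-th pair. -/
def pieceSet (F : SimpleGraph V) (h : V) (n : ℕ → V) (host : V → ℕ) (i : ℕ) : Set V :=
  {x | (host x = i ∧ ¬ F.Adj h x ∧ x ≠ h) ∨ x = n i ∨ x = n (i + 1)}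

/-- The conclusions of `exists_host` for the first `m` pairs. -/
structure IsHost (F : SimpleGraph V) (h : V) (n : ℕ → V) (m : ℕ) (host : V → ℕ) : Prop where
  lt : ∀ x, host x < m
  const : ∀ x y, F.Adj x y → x ≠ h → y ≠ h → ¬ F.Adj h x → ¬ F.Adj h y → host x = host y
  att : ∀ x a, F.Adj x a → x ≠ h → ¬ F.Adj h x → F.Adj h a → a = n (host x) ∨ a = n (host x + 1)
  edge : ∀ a b, F.Adj a b → F.Adj h a → F.Adj h b → ∃ i < m,
    (a = n i ∧ b = n (i + 1) ∨ b = n i ∧ a = n (i + 1))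

lemma IsHost.nbr_mem {F : SimpleGraph V} {h : V} {n : ℕ → V} {m : ℕ} {host : V → ℕ}
    (hh : IsHost F h n m host) {x y : V} (hx : ¬ F.Adj h x) (hxh : x ≠ h) (hxy : F.Adj x y) :
    y ∈ pieceSet F h n host (host x) := by
  by_cases hy : F.Adj h y
  · exact Or.inr (hh.att x y hxy hxh hx hy)
  · have hyh : y ≠ h := by
      rintro rfl
      exact hx hxy.symm
    exact Or.inl ⟨(hh.const x y hxy hxh hyh hx hy).symm, hy, hyh⟩

lemma IsHost.mem_piece {F : SimpleGraph V} {h : V} {n : ℕ → V} {m : ℕ} {host : V → ℕ}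
    (hh : IsHost F h n m host) {x y : V} (hxh : x ≠ h) (hyh : y ≠ h) (hxy : F.Adj x y) :
    ∃ i < m, x ∈ pieceSet F h n host i ∧ y ∈ pieceSet F h n host i := by
  by_cases hx : F.Adj h x
  · by_cases hy : F.Adj h y
    · obtain ⟨i, hi, hi'⟩ := hh.edge x y hxy hx hy
      refine ⟨i, hi, ?_⟩
      rcases hi' with ⟨rfl, rfl⟩ | ⟨rfl, rfl⟩
      · exact ⟨Or.inr (Or.inl rfl), Or.inr (Or.inr rfl)⟩
      · exact ⟨Or.inr (Or.inr rfl), Or.inr (Or.inl rfl)⟩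
    · exact ⟨host y, hh.lt y, hh.nbr_mem hy hyh hxy.symm, Or.inl ⟨rfl, hy, hyh⟩⟩
  · exact ⟨host x, hh.lt x, Or.inl ⟨rfl, hx, hxh⟩, hh.nbr_mem hx hxh hxy⟩

/-- Solutions of the pieces which agree on the neighbours of the hub can be glued. -/
lemma glue {F : SimpleGraph V} {h : V} {n : ℕ → V} {m : ℕ} {host : V → ℕ}
    (hh : IsHost F h n m host) (hnX : ∀ x, F.Adj h x → x ∈ S.X)
    (hn : ∀ i < m, F.Adj h (n i) ∧ F.Adj h (n (i + 1)) ) (g : V → St) (fi : ℕ → V → St)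
    (hfi : ∀ i < m, S.Sol (pieceGraph F (pieceSet F h n host i) (n i) (n (i + 1))) (fi i))
    (hg : ∀ i < m, g (n i) = fi i (n i) ∧ g (n (i + 1)) = fi i (n (i + 1))) :
    ∃ f : V → St, (∀ x, F.Adj h x → f x = g x) ∧ f h = g h ∧
      (∀ i < m, ∀ x ∈ pieceSet F h n host i, f x = fi i x) ∧
      (∀ x y, x ∈ S.X → y ∈ S.X → F.Adj x y → x ≠ h → y ≠ h → S.ok x y (f x) (f y)) ∧
      (∀ w ∈ S.W, w ≠ h → S.Pol w {x | F.Adj w x} f ∨ F.Adj w h) ∧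
      (∀ x y y', x ∈ S.X → y ∈ S.X → y' ∈ S.X → F.Adj x y → F.Adj x y' → y ≠ y' →
        x ≠ h → ¬ F.Adj h x → ¬ S.strict x y (f x) (f y) → ¬ S.strict x y' (f x) (f y') → S.real y y') := by
  classical
  let f : V → St := fun x => if F.Adj h x ∨ x = h then g x else fi (host x) x
  have hfg : ∀ x, F.Adj h x → f x = g x := fun x hx => if_pos (Or.inl hx)
  have hf : ∀ i < m, ∀ x ∈ pieceSet F h n host i, f x = fi i x := by
    rintro i hi x (⟨rfl, hx, hxh⟩ | rfl | rfl)
    · exact if_neg (fun h' => h'.elim hx hxh)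
    · rw [hfg _ (hn i hi).1, (hg i hi).1]
    · rw [hfg _ (hn i hi).2, (hg i hi).2]
  refine ⟨f, hfg, if_pos (Or.inr rfl), hf, ?_, ?_, ?_⟩
  · intro x y hx hy hxy hxh hyh
    obtain ⟨i, hi, hxi, hyi⟩ := hh.mem_piece hxh hyh hxy
    rw [hf i hi x hxi, hf i hi y hyi]
    exact (hfi i hi).ok x y hx hy (Or.inl ⟨hxy, hxi, hyi⟩)
  · intro w hw hwh
    by_cases hwN : F.Adj h w
    · exact Or.inr hwN.symm
    left
    have hwi : w ∈ pieceSet F h n host (host w) := Or.inl ⟨rfl, hwN, hwh⟩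
    have heq : {x | (pieceGraph F (pieceSet F h n host (host w)) (n (host w))
        (n (host w + 1))).Adj w x} = {x | F.Adj w x} := by
      ext x
      constructor
      · rintro (hx | ⟨-, ⟨h1, -⟩ | ⟨h1, -⟩⟩)
        · exact hx.1
        · exact (S.disj _ (hnX _ (hn _ (hh.lt w)).1) (h1 ▸ hw)).elim
        · exact (S.disj _ (hnX _ (hn _ (hh.lt w)).2) (h1 ▸ hw)).elim
      · exact fun hx => Or.inl ⟨hx, hwi, hh.nbr_mem hwN hwh hx⟩
    have := (hfi _ (hh.lt w)).pol w hw
    rw [heq] at this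
    refine S.pol_congr w _ _ _ (fun x hx => ?_) this
    exact (hf _ (hh.lt w) x (hh.nbr_mem hwN hwh hx)).symm
  · intro x y y' hx hy hy' hxy hxy' hyy hxh hxN
    have hxi : x ∈ pieceSet F h n host (host x) := Or.inl ⟨rfl, hxN, hxh⟩
    rw [hf _ (hh.lt x) x hxi, hf _ (hh.lt x) y (hh.nbr_mem hxN hxh hxy),
      hf _ (hh.lt x) y' (hh.nbr_mem hxN hxh hxy')]
    exact (hfi _ (hh.lt x)).bot x y y' hx hy hy' (Or.inl ⟨hxy, hxi, hh.nbr_mem hxN hxh hxy⟩)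
      (Or.inl ⟨hxy', hxi, hh.nbr_mem hxN hxh hxy'⟩) hyy

/-- Extending a solution of one piece around a hub in `W`. -/
lemma polygon_step {F : SimpleGraph V} (hfit : S.Fits F) {h : V} (hW : h ∈ S.W)
    {n : ℕ → V} {m : ℕ} {host : V → ℕ} (hm : 2 ≤ m) (hmod : ∀ i j, n i = n j ↔ i ≡ j [MOD m])
    (hN : ∀ x, F.Adj h x ↔ ∃ i, n i = x) (hh : IsHost F h n m host)
    (IH : ∀ i < m, S.Rooted (pieceGraph F (pieceSet F h n host i) (n i) (n (i + 1))))
    {j : ℕ} (hj : j < m) {f0 : V → St}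
    (hf0 : S.Sol (pieceGraph F (pieceSet F h n host j) (n j) (n (j + 1))) f0) :
    ∃ f, S.Sol F f ∧ (∀ x ∈ pieceSet F h n host j, f x = f0 x) ∧
      ∀ x ∈ pieceSet F h n host j, x ≠ h → ∀ y ∈ S.X, F.Adj x y →
        y ∉ pieceSet F h n host j → S.strict x y (f x) (f y) := by
  classical
  have hnX : ∀ x, F.Adj h x → x ∈ S.X := fun x hx => hfit.nbr hW hx
  have hnA : ∀ i, F.Adj h (n i) := fun i => (hN _).2 ⟨i, rfl⟩
  have hhX : ∀ x ∈ S.X, x ≠ h := by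
    rintro x hx rfl
    exact S.disj _ hx hW
  have hne : ∀ i, n i ≠ n (i + 1) := by
    intro i hi
    rw [hmod, Nat.modEq_iff_dvd' (by omega)] at hi
    have := Nat.le_of_dvd (by omega) hi
    omega
  have hsucc : ∀ i k, n (i + 1) = n (k + 1) ↔ n i = n k := by
    intro i k
    rw [hmod, hmod]
    exact ⟨fun h => Nat.ModEq.add_right_cancel' 1 h, fun h => h.add_right 1⟩
  have hadjp : ∀ i, (pieceGraph F (pieceSet F h n host i) (n i) (n (i + 1))).Adj (n i) (n (i + 1)) :=
    fun i => Or.inr ⟨hne i, Or.inl ⟨rfl, rfl⟩⟩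
  obtain ⟨g, hg0, hg1, hgok, hgs, hgb, hgP⟩ := S.poly h hW (fun i => n (i + j)) m hm
    (by
      intro i k
      rw [hmod]
      exact ⟨fun h => Nat.ModEq.add_right_cancel' j h, fun h => h.add_right j⟩)
    (f0 (n j)) (f0 (n (j + 1))) (by
      have := hf0.ok _ _ (hnX _ (hnA j)) (hnX _ (hnA (j + 1))) (hadjp j)
      simpa [add_comm] using this)
  simp only [zero_add] at hg0 hgs
  have hrep : ∀ i, ∃ k < m, n i = n (k + j) := by
    intro i
    refine ⟨(i + (m - 1) * j) % m, Nat.mod_lt _ (by omega), ?_⟩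
    rw [hmod]
    have e1 : i ≡ i + m * j [MOD m] := by simp [Nat.ModEq]
    have e2 : i + m * j = i + (m - 1) * j + j := by
      obtain ⟨k, rfl⟩ : ∃ k, m = k + 1 := ⟨m - 1, by omega⟩
      simp only [Nat.add_sub_cancel]
      ring
    rw [e2] at e1
    exact e1.trans ((Nat.mod_modEq _ _).symm.add_right j)
  have hok : ∀ i, S.ok (n i) (n (i + 1)) (g (n i)) (g (n (i + 1))) := by
    intro i
    obtain ⟨k, -, hk⟩ := hrep i
    have hk' := (hsucc _ _).2 hk
    rw [hk, hk']
    have := hgok k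
    simpa only [Nat.add_right_comm k 1 j] using this
  have hpiece : ∀ i, ∃ fi : V → St, i < m →
      S.Sol (pieceGraph F (pieceSet F h n host i) (n i) (n (i + 1))) fi ∧
      g (n i) = fi (n i) ∧ g (n (i + 1)) = fi (n (i + 1)) ∧ (i = j → fi = f0) ∧
      (i ≠ j → ∀ y ∈ S.X, y ∈ pieceSet F h n host i →
        (F.Adj (n i) y → y ≠ n (i + 1) → S.strict (n i) y (g (n i)) (fi y)) ∧
        (F.Adj (n (i + 1)) y → y ≠ n i → S.strict (n (i + 1)) y (g (n (i + 1))) (fi y))) := by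
    intro i
    by_cases hij : i = j
    · subst hij
      refine ⟨f0, fun _ => ⟨hf0, hg0, ?_, fun _ => rfl, fun h' => (h' rfl).elim⟩⟩
      rw [add_comm]
      rw [add_comm i 1] at hg1
      exact hg1
    · by_cases hi : i < m
      · obtain ⟨fi, h1, h2, h3, h4, h5⟩ := IH i hi _ _ (hnX _ (hnA i)) (hnX _ (hnA (i + 1)))
          (hadjp i) _ _ (hok i)
        refine ⟨fi, fun _ => ⟨h1, h2.symm, h3.symm, fun h' => (hij h').elim, fun _ y hy hyi => ?_⟩⟩
        exact ⟨fun hadj => h4 y hy (Or.inl ⟨hadj, Or.inr (Or.inl rfl), hyi⟩),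
          fun hadj => h5 y hy (Or.inl ⟨hadj, Or.inr (Or.inr rfl), hyi⟩)⟩
      · exact ⟨f0, fun h' => (hi h').elim⟩
  choose fi hfi using hpiece
  obtain ⟨f, hfg, -, hfp, hfok, hfpol, hfbot⟩ := glue hh hnX (fun i _ => ⟨hnA i, hnA (i + 1)⟩)
    g fi (fun i hi => (hfi i hi).1) (fun i hi => ⟨(hfi i hi).2.1, (hfi i hi).2.2.1⟩)
  have hfj : ∀ x ∈ pieceSet F h n host j, f x = f0 x := by
    intro x hx
    rw [hfp j hj x hx, (hfi j hj).2.2.2.1 rfl]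
  -- edges at the neighbours of the hub which are not strict
  have hD : ∀ x y, F.Adj h x → y ∈ S.X → F.Adj x y → ¬ S.strict x y (f x) (f y) →
      (x ∈ pieceSet F h n host j ∧ y ∈ pieceSet F h n host j) ∨ ∃ i < m, i ≠ j ∧
        (x = n i ∧ y = n (i + 1) ∨ y = n i ∧ x = n (i + 1)) := by
    intro x y hx hy hxy hs
    obtain ⟨i, hi, hxi, hyi⟩ := hh.mem_piece hx.ne' (hhX y hy) hxy
    by_cases hij : i = j
    · subst hij
      exact Or.inl ⟨hxi, hyi⟩
    refine Or.inr ⟨i, hi, hij, ?_⟩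
    have hst := (hfi i hi).2.2.2.2 hij y hy hyi
    rcases hxi with hxi | rfl | rfl
    · exact (hxi.2.1 hx).elim
    · refine Or.inl ⟨rfl, ?_⟩
      by_contra hcon
      rw [hfg _ hx, hfp i hi y hyi] at hs
      exact hs (hst.1 hxy hcon)
    · refine Or.inr ⟨?_, rfl⟩
      by_contra hcon
      rw [hfg _ hx, hfp i hi y hyi] at hs
      exact hs (hst.2 hxy hcon)
  have hjlt : ∀ i < m, i ≠ j → n i ≠ n j := by
    intro i hi hij h'
    rw [hmod] at h'
    exact hij (Nat.ModEq.eq_of_lt_of_lt h' hi hj)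
  have hE : ∀ x ∈ pieceSet F h n host j, x ≠ h → ∀ y ∈ S.X, F.Adj x y →
        y ∉ pieceSet F h n host j → S.strict x y (f x) (f y) := by
    intro x hx hxh y hy hxy hyj
    have hjm : n j ∈ pieceSet F h n host j := Or.inr (Or.inl rfl)
    have hjm1 : n (1 + j) ∈ pieceSet F h n host j := Or.inr (Or.inr (by rw [add_comm]))
    by_cases hxN : F.Adj h x
    · by_contra hs
      rcases hD x y hxN hy hxy hs with h1 | ⟨i, hi, hij, ⟨rfl, rfl⟩ | ⟨rfl, rfl⟩⟩
      · exact hyj h1.2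
      · rcases hx with hx | hx | hx
        · exact hx.2.1 hxN
        · exact hjlt i hi hij hx
        · have e : n (i + 1) = n (2 + j) := by
            rw [show 2 + j = (j + 1) + 1 by omega]
            exact (hsucc _ _).2 hx
          by_cases hm2 : m = 2
          · apply hyj
            have : n (2 + j) = n j := by
              rw [hmod, hm2]
              simp [Nat.ModEq]
            rwa [e, this]
          · apply hs
            rw [hfg _ (hnA _), hfg _ (hnA _), hx, e, add_comm j 1, hg1, add_comm 1 j]
            have := (hgs (by omega)).1
            simpa only [add_comm 1 j] using this
      · rcases hx with hx | hx | hx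
        · exact hx.2.1 hxN
        · have e : n i = n (m - 1 + j) := by
            rw [← hsucc, hx, hmod, show m - 1 + j + 1 = j + m by omega]
            simp [Nat.ModEq]
          by_cases hm2 : m = 2
          · apply hyj
            rw [e, hm2]
            exact hjm1
          · apply hs
            rw [hfg _ (hnA _), hfg _ (hnA _), hx, e, hg0]
            exact (hgs (by omega)).2
        · exact hjlt i hi hij ((hsucc _ _).1 hx)
    · rcases hx with hx | rfl | rfl
      · exact (hyj (hx.1 ▸ hh.nbr_mem hxN hxh hxy)).elim
      · exact (hxN (hnA _)).elim
      · exact (hxN (hnA _)).elim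
  refine ⟨f, ⟨fun x y hx hy hxy => hfok x y hx hy hxy (hhX x hx) (hhX y hy), ?_, ?_⟩, hfj, hE⟩
  · intro w hw
    by_cases hwh : w = h
    · subst hwh
      have : {x | F.Adj w x} = Set.range fun i => n (i + j) := by
        ext x
        constructor
        · intro hx
          obtain ⟨i, rfl⟩ := (hN x).1 hx
          obtain ⟨k, -, hk⟩ := hrep i
          exact ⟨k, hk.symm⟩
        · rintro ⟨i, rfl⟩
          exact hnA _
      rw [this]
      refine S.pol_congr _ _ g f ?_ hgP
      rintro _ ⟨i, rfl⟩
      exact (hfg _ (hnA _)).symm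
    · rcases hfpol w hw hwh with h1 | h1
      · exact h1
      · exact (S.disj _ (hfit.nbr hw h1) hW).elim
  · intro x y y' hx hy hy' hxy hxy' hyy hs hs'
    by_cases hxN : F.Adj h x
    · by_cases hxj : x ∈ pieceSet F h n host j
      · have hyj : y ∈ pieceSet F h n host j := by
          by_contra hcon
          exact hs (hE x hxj (hhX x hx) y hy hxy hcon)
        have hyj' : y' ∈ pieceSet F h n host j := by
          by_contra hcon
          exact hs' (hE x hxj (hhX x hx) y' hy' hxy' hcon)
        rw [hfj x hxj, hfj y hyj] at hs
        rw [hfj x hxj, hfj y' hyj'] at hs'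
        exact hf0.bot x y y' hx hy hy' (Or.inl ⟨hxy, hxj, hyj⟩) (Or.inl ⟨hxy', hxj, hyj'⟩) hyy hs hs'
      · obtain ⟨k, hk, rfl⟩ : ∃ k < m, n (k + j) = x := by
          obtain ⟨i, rfl⟩ := (hN x).1 hxN
          obtain ⟨k, hk, hik⟩ := hrep i
          exact ⟨k, hk, hik.symm⟩
        obtain ⟨k, rfl⟩ : ∃ k', k = k' + 2 := by
          refine ⟨k - 2, ?_⟩
          have h0 : k ≠ 0 := by
            rintro rfl
            exact hxj (Or.inr (Or.inl (by rw [zero_add])))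
          have h1 : k ≠ 1 := by
            rintro rfl
            exact hxj (Or.inr (Or.inr (by rw [add_comm])))
          omega
        have hnb : ∀ z ∈ S.X, F.Adj (n (k + 2 + j)) z →
            ¬ S.strict (n (k + 2 + j)) z (f (n (k + 2 + j))) (f z) →
            z = n (k + 3 + j) ∨ z = n (k + 1 + j) := by
          intro z hz hxz hsz
          rcases hD _ z hxN hz hxz hsz with h1 | ⟨i', -, -, ⟨h1, rfl⟩ | ⟨rfl, h1⟩⟩
          · exact (hxj h1.1).elim
          · left
            rw [show k + 3 + j = k + 2 + j + 1 by omega]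
            exact ((hsucc _ _).2 h1).symm
          · right
            rw [show k + 2 + j = k + 1 + j + 1 by omega] at h1
            exact ((hsucc _ _).1 h1).symm
        have hfin := hgb k hk
        rw [hfg _ (hnA _)] at hs hs'
        rcases hnb y hy hxy (by rwa [hfg _ (hnA _)]) with rfl | rfl <;>
          rcases hnb y' hy' hxy' (by rwa [hfg _ (hnA _)]) with rfl | rfl
        · exact (hyy rfl).elim
        · rw [hfg _ (hnA _)] at hs hs'
          exact S.real_symm _ _ (hfin hs hs')
        · rw [hfg _ (hnA _)] at hs hs'
          exact hfin hs' hs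
        · exact (hyy rfl).elim
    · exact hfbot x y y' hx hy hy' hxy hxy' hyy (hhX x hx) hxN hs hs'

end ColSystem

namespace ColSystem

variable {V St : Type} {S : ColSystem V St}

/-- Repeated use of `child` along a sequence of vertices. -/
lemma child_chain (S : ColSystem V St) {u : V} {s t : St} (a : ℕ → V) (K : ℕ)
    (ha : ∀ i < K, a i ≠ a (i + 1)) (hu : ∀ i ≤ K, u ≠ a i) (h0 : S.ok u (a 0) s t) :
    ∃ q : ℕ → St, q 0 = t ∧ (∀ i ≤ K, S.ok u (a i) s (q i)) ∧
      ∀ i < K, S.ok (a i) (a (i + 1)) (q i) (q (i + 1)) ∧ S.strict u (a (i + 1)) s (q (i + 1)) ∧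
        S.strict (a i) (a (i + 1)) (q i) (q (i + 1)) ∧
        (¬ S.strict (a (i + 1)) u (q (i + 1)) s → ¬ S.strict (a (i + 1)) (a i) (q (i + 1)) (q i) →
          S.real u (a i)) := by
  induction K with
  | zero => exact ⟨fun _ => t, rfl, fun i hi => by rwa [Nat.le_zero.1 hi], fun i hi => by omega⟩
  | succ K ih =>
    obtain ⟨q, h1, h2, h3⟩ := ih (fun i hi => ha i (by omega)) (fun i hi => hu i (by omega))
    obtain ⟨p, p1, p2, p3, p4, p5⟩ := S.child u (a K) (a (K + 1)) s (q K) (hu _ (by omega))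
      (hu _ le_rfl) (ha K (by omega)) (h2 K le_rfl)
    have e : ∀ i ≤ K, Function.update q (K + 1) p i = q i := fun i hi =>
      Function.update_of_ne (by omega) _ _
    have e' : Function.update q (K + 1) p (K + 1) = p := Function.update_self _ _ _
    refine ⟨Function.update q (K + 1) p, by rw [e 0 (by omega), h1], ?_, ?_⟩
    · intro i hi
      rcases Nat.lt_or_eq_of_le hi with hi | rfl
      · rw [e i (by omega)]
        exact h2 i (by omega)
      · rwa [e']
    · intro i hi
      rcases Nat.lt_or_eq_of_le (Nat.le_of_lt_succ hi) with hi | rfl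
      · rw [e i (by omega), e (i + 1) (by omega)]
        exact h3 i hi
      · rw [e i le_rfl, e']
        exact ⟨p2, p3, p4, p5⟩

/-- Colouring the neighbours of `u` outwards from the neighbour with index `i0`. -/
lemma outward (S : ColSystem V St) {u : V} {s t : St} (n : ℕ → V) {m i0 : ℕ} (hi0 : i0 < m)
    (hn : ∀ i, i + 1 < m → n i ≠ n (i + 1)) (hu : ∀ i < m, u ≠ n i) (h0 : S.ok u (n i0) s t) :
    ∃ G : ℕ → St, G i0 = t ∧ (∀ i < m, S.ok u (n i) s (G i)) ∧
      (∀ i < m, i ≠ i0 → S.strict u (n i) s (G i)) ∧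
      (∀ i, i + 1 < m → S.ok (n i) (n (i + 1)) (G i) (G (i + 1))) ∧
      (∀ i, i0 ≤ i → i + 1 < m → S.strict (n i) (n (i + 1)) (G i) (G (i + 1)) ∧
        (¬ S.strict (n (i + 1)) u (G (i + 1)) s →
          ¬ S.strict (n (i + 1)) (n i) (G (i + 1)) (G i) → S.real u (n i))) ∧
      (∀ i < i0, S.strict (n (i + 1)) (n i) (G (i + 1)) (G i) ∧
        (¬ S.strict (n i) u (G i) s → ¬ S.strict (n i) (n (i + 1)) (G i) (G (i + 1)) →
          S.real u (n (i + 1)))) := by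
  obtain ⟨q, q0, q1, q2⟩ := S.child_chain (u := u) (s := s) (t := t) (fun i => n (i0 + i))
    (m - 1 - i0) (fun i hi => hn (i0 + i) (by omega)) (fun i hi => hu _ (by omega)) h0
  obtain ⟨r, r0, r1, r2⟩ := S.child_chain (u := u) (s := s) (t := t) (fun i => n (i0 - i))
    i0 (fun i hi => by
      have := hn (i0 - (i + 1)) (by omega)
      rw [show i0 - (i + 1) + 1 = i0 - i by omega] at this
      exact this.symm) (fun i hi => hu _ (by omega)) h0
  have eq1 : ∀ i, i0 ≤ i → (if i0 ≤ i then q (i - i0) else r (i0 - i)) = q (i - i0) :=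
    fun i hi => if_pos hi
  have eq2 : ∀ i, i ≤ i0 → (if i0 ≤ i then q (i - i0) else r (i0 - i)) = r (i0 - i) := by
    intro i hi
    by_cases h : i0 ≤ i
    · have : i = i0 := by omega
      subst this
      simp [q0, r0]
    · exact if_neg h
  have Q : ∀ i, i0 ≤ i → i + 1 < m → _ := fun i hi hi' => q2 (i - i0) (by omega)
  have R : ∀ i, i < i0 → _ := fun i hi => r2 (i0 - (i + 1)) (by omega)
  refine ⟨fun i => if i0 ≤ i then q (i - i0) else r (i0 - i), ?_, ?_, ?_, ?_, ?_, ?_⟩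
  · simp [q0]
  · intro i hi
    dsimp only
    rcases le_total i0 i with h | h
    · rw [eq1 i h]
      have := q1 (i - i0) (by omega)
      rwa [show i0 + (i - i0) = i by omega] at this
    · rw [eq2 i h]
      have := r1 (i0 - i) (by omega)
      rwa [show i0 - (i0 - i) = i by omega] at this
  · intro i hi hne
    dsimp only
    rcases le_total i0 i with h | h
    · rw [eq1 i h]
      have := (Q (i - 1) (by omega) (by omega)).2.1
      rwa [show i0 + (i - 1 - i0 + 1) = i by omega, show i - 1 - i0 + 1 = i - i0 by omega] at this
    · rw [eq2 i h]
      have := (R i (by omega)).2.1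
      rwa [show i0 - (i0 - (i + 1) + 1) = i by omega,
        show i0 - (i + 1) + 1 = i0 - i by omega] at this
  · intro i hi
    dsimp only
    rcases lt_or_ge i i0 with h | h
    · rw [eq2 i h.le, eq2 (i + 1) h]
      have := (R i h).1
      rw [show i0 - (i0 - (i + 1) + 1) = i by omega, show i0 - (i + 1) + 1 = i0 - i by omega,
        show i0 - (i0 - (i + 1)) = i + 1 by omega] at this
      exact S.ok_symm _ _ _ _ this
    · rw [eq1 i h, eq1 (i + 1) (by omega)]
      have := (Q i h hi).1
      rwa [show i0 + (i - i0 + 1) = i + 1 by omega, show i - i0 + 1 = i + 1 - i0 by omega,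
        show i0 + (i - i0) = i by omega] at this
  · intro i h hi
    dsimp only
    rw [eq1 i h, eq1 (i + 1) (by omega)]
    have := (Q i h hi).2.2
    rwa [show i0 + (i - i0 + 1) = i + 1 by omega, show i - i0 + 1 = i + 1 - i0 by omega,
      show i0 + (i - i0) = i by omega] at this
  · intro i h
    dsimp only
    rw [eq2 i h.le, eq2 (i + 1) h]
    have := (R i h).2.2
    rwa [show i0 - (i0 - (i + 1) + 1) = i by omega, show i0 - (i + 1) + 1 = i0 - i by omega,
      show i0 - (i0 - (i + 1)) = i + 1 by omega] at this

/-- Solving around a hub in `X`. -/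
lemma fan_step {F : SimpleGraph V} (hX : ∀ x y, F.Adj x y → y ∈ S.X) {u : V}
    {n : ℕ → V} {m : ℕ} {host : V → ℕ} (hinj : ∀ i j, i < m → j < m → n i = n j → i = j)
    (hN : ∀ x, F.Adj u x ↔ ∃ i < m, n i = x) (hh : IsHost F u n (m - 1) host)
    (IH : ∀ i, i + 1 < m → S.Rooted (pieceGraph F (pieceSet F u n host i) (n i) (n (i + 1))))
    {i0 : ℕ} (hi0 : i0 < m) {s t : St} (hst : S.ok u (n i0) s t) :
    ∃ f, S.Sol F f ∧ f u = s ∧ f (n i0) = t ∧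
      (∀ y ∈ S.X, F.Adj u y → y ≠ n i0 → S.strict u y s (f y)) ∧
      (∀ y ∈ S.X, F.Adj (n i0) y → y ≠ u → S.strict (n i0) y t (f y)) := by
  classical
  have hnA : ∀ i < m, F.Adj u (n i) := fun i hi => (hN _).2 ⟨i, hi, rfl⟩
  have hnX : ∀ i < m, n i ∈ S.X := fun i hi => hX _ _ (hnA i hi)
  have hne : ∀ i, i + 1 < m → n i ≠ n (i + 1) := fun i hi h => by
    have := hinj _ _ (by omega) hi h
    omega
  have hun : ∀ i < m, u ≠ n i := fun i hi => (hnA i hi).ne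
  obtain ⟨G, G0, G1, G2, G3, G4, G5⟩ := S.outward n hi0 hne hun hst
  obtain ⟨g, hgu, hgn⟩ : ∃ g : V → St, g u = s ∧ ∀ i < m, g (n i) = G i := by
    refine ⟨fun x => if x = u then s else if h : ∃ i < m, n i = x then G h.choose else s,
      if_pos rfl, fun i hi => ?_⟩
    have h : ∃ k < m, n k = n i := ⟨i, hi, rfl⟩
    dsimp only
    rw [if_neg (hun i hi).symm, dif_pos h]
    exact congrArg G (hinj _ _ h.choose_spec.1 hi h.choose_spec.2)
  have hadjp : ∀ i, i + 1 < m →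
      (pieceGraph F (pieceSet F u n host i) (n i) (n (i + 1))).Adj (n i) (n (i + 1)) :=
    fun i hi => Or.inr ⟨hne i hi, Or.inl ⟨rfl, rfl⟩⟩
  have hpiece : ∀ i, ∃ fi : V → St, i + 1 < m →
      S.Sol (pieceGraph F (pieceSet F u n host i) (n i) (n (i + 1))) fi ∧
      g (n i) = fi (n i) ∧ g (n (i + 1)) = fi (n (i + 1)) ∧
      (∀ y ∈ S.X, y ∈ pieceSet F u n host i →
        (F.Adj (n i) y → y ≠ n (i + 1) → S.strict (n i) y (g (n i)) (fi y)) ∧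
        (F.Adj (n (i + 1)) y → y ≠ n i → S.strict (n (i + 1)) y (g (n (i + 1))) (fi y))) := by
    intro i
    by_cases hi : i + 1 < m
    · obtain ⟨fi, h1, h2, h3, h4, h5⟩ := IH i hi _ _ (hnX _ (by omega)) (hnX _ hi)
        (hadjp i hi) _ _ (G3 i hi)
      refine ⟨fi, fun _ => ⟨h1, ?_, ?_, fun y hy hyi => ?_⟩⟩
      · rw [h2, hgn i (by omega)]
      · rw [h3, hgn _ hi]
      · rw [hgn i (by omega), hgn _ hi]
        exact ⟨fun hadj => h4 y hy (Or.inl ⟨hadj, Or.inr (Or.inl rfl), hyi⟩),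
          fun hadj => h5 y hy (Or.inl ⟨hadj, Or.inr (Or.inr rfl), hyi⟩)⟩
    · exact ⟨fun _ => s, fun h' => (hi h').elim⟩
  choose fi hfi using hpiece
  obtain ⟨f, hfg, hfu, hfp, hfok, -, hfbot⟩ := glue hh (fun x hx => hX _ _ hx)
    (fun i hi => ⟨hnA i (by omega), hnA (i + 1) (by omega)⟩)
    g fi (fun i hi => (hfi i (by omega)).1)
    (fun i hi => ⟨(hfi i (by omega)).2.1, (hfi i (by omega)).2.2.1⟩)
  have hfn : ∀ i < m, f (n i) = G i := fun i hi => by rw [hfg _ (hnA i hi), hgn i hi]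
  have hfu : f u = s := hfu.trans hgu
  -- edges at the neighbours of the hub which are not strict
  have hD : ∀ i < m, ∀ y ∈ S.X, F.Adj (n i) y → y ≠ u → ¬ S.strict (n i) y (f (n i)) (f y) →
      (i0 < i ∧ y = n (i - 1)) ∨ (i < i0 ∧ y = n (i + 1)) := by
    intro i hi y hy hxy hyu hs
    obtain ⟨k, hk, hxk, hyk⟩ := hh.mem_piece (hun i hi).symm hyu hxy
    have hk' : k + 1 < m := by omega
    have hst := (hfi k hk').2.2.2 y hy hyk
    rw [← hfp k hk y hyk, ← hfg _ (hnA k (by omega)), ← hfg _ (hnA _ hk')] at hst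
    rcases hxk with hxk | hxk | hxk
    · exact (hxk.2.1 (hnA i hi)).elim
    · obtain rfl := hinj _ _ hi (by omega) hxk
      have hy' : y = n (i + 1) := by
        by_contra hcon
        exact hs (hst.1 hxy hcon)
      refine Or.inr ⟨?_, hy'⟩
      by_contra hcon
      rw [hy', hfn _ hi, hfn _ hk'] at hs
      exact hs (G4 i (by omega) hk').1
    · obtain rfl := hinj _ _ hi hk' hxk
      have hy' : y = n k := by
        by_contra hcon
        exact hs (hst.2 hxy hcon)
      refine Or.inl ⟨?_, hy'⟩
      by_contra hcon
      rw [hy', hfn _ hi, hfn _ (by omega)] at hs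
      exact hs (G5 k (by omega)).1
  refine ⟨f, ⟨?_, ?_, ?_⟩, hfu, by rw [hfn _ hi0, G0], ?_, ?_⟩
  · intro x y hx hy hxy
    by_cases hxu : x = u
    · subst hxu
      obtain ⟨i, hi, rfl⟩ := (hN y).1 hxy
      rw [hfu, hfn i hi]
      exact G1 i hi
    by_cases hyu : y = u
    · subst hyu
      obtain ⟨i, hi, rfl⟩ := (hN x).1 hxy.symm
      rw [hfu, hfn i hi]
      exact S.ok_symm _ _ _ _ (G1 i hi)
    exact hfok x y hx hy hxy hxu hyu
  · intro w hw
    refine S.pol_triv _ _ _ fun x hx => ?_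
    exact (S.disj w (hX _ _ (SimpleGraph.Adj.symm hx)) hw).elim
  · intro x y y' hx hy hy' hxy hxy' hyy hs hs'
    by_cases hxu : x = u
    · subst hxu
      have key : ∀ z, F.Adj x z → ¬ S.strict x z (f x) (f z) → z = n i0 := by
        intro z hz hsz
        obtain ⟨i, hi, rfl⟩ := (hN z).1 hz
        by_cases hii : i = i0
        · rw [hii]
        · rw [hfu, hfn i hi] at hsz
          exact (hsz (G2 i hi hii)).elim
      exact (hyy ((key y hxy hs).trans (key y' hxy' hs').symm)).elim
    by_cases hxN : F.Adj u x
    · obtain ⟨i, hi, rfl⟩ := (hN x).1 hxN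
      have key : ∀ z ∈ S.X, z ≠ u → F.Adj (n i) z → ¬ S.strict (n i) z (f (n i)) (f z) →
          ¬ S.strict (n i) u (f (n i)) (f u) → S.real u z := by
        intro z hz hzu hxz hsz hsu
        rcases hD i hi z hz hxz hzu hsz with ⟨h1, rfl⟩ | ⟨h1, rfl⟩
        · have := (G4 (i - 1) (by omega) (by omega)).2
          rw [show i - 1 + 1 = i by omega] at this
          rw [hfu, hfn i hi] at hsu
          rw [hfn i hi, hfn _ (by omega)] at hsz
          exact this hsu hsz
        · rw [hfu, hfn i hi] at hsu
          rw [hfn i hi, hfn _ (by omega)] at hsz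
          exact (G5 i h1).2 hsu hsz
      by_cases hyu : y = u
      · subst hyu
        exact key y' hy' (Ne.symm hyy) hxy' hs' hs
      by_cases hyu' : y' = u
      · subst hyu'
        exact S.real_symm _ _ (key y hy hyu hxy hs hs')
      exfalso
      apply hyy
      rcases hD i hi y hy hxy hyu hs with ⟨h1, rfl⟩ | ⟨h1, rfl⟩ <;>
        rcases hD i hi y' hy' hxy' hyu' hs' with ⟨h2, rfl⟩ | ⟨h2, rfl⟩ <;>
        first | rfl | omega
    · exact hfbot x y y' hx hy hy' hxy hxy' hyy hxu hxN hs hs'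
  · intro y hy huy hyi
    obtain ⟨i, hi, rfl⟩ := (hN y).1 huy
    rw [hfn i hi]
    refine G2 i hi ?_
    rintro rfl
    exact hyi rfl
  · intro y hy hxy hyu
    by_contra hs
    rw [show t = f (n i0) by rw [hfn _ hi0, G0]] at hs
    rcases hD i0 hi0 y hy hxy hyu hs with ⟨h1, -⟩ | ⟨h1, -⟩ <;> omega

end ColSystem

namespace ColSystem

variable {V St : Type} {S : ColSystem V St}

lemma edgeSet_ncard_lt [Finite V] {F F' : SimpleGraph V} (h : F' < F) :
    F'.edgeSet.ncard < F.edgeSet.ncard :=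
  Set.ncard_lt_ncard (edgeSet_strict_mono h) (Set.toFinite _)

/-- The decomposition of `F` around a hub in `W`. -/
lemma wheel_data [Finite V] {F : SimpleGraph V} (hc : Cone F S.X) (hfit : S.Fits F) {w x0 x1 : V}
    (hw : w ∈ S.W) (h0 : F.Adj w x0) (h1 : F.Adj w x1) (h01 : x0 ≠ x1) {P : SimpleGraph V → Prop}
    (IH : ∀ F' : SimpleGraph V, F'.edgeSet.ncard < F.edgeSet.ncard → Cone F' S.X → S.Fits F' →
      P F') :
    ∃ (n : ℕ → V) (m : ℕ) (host : V → ℕ), 2 ≤ m ∧ (∀ i j, n i = n j ↔ i ≡ j [MOD m]) ∧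
      (∀ x, F.Adj w x ↔ ∃ i, n i = x) ∧ IsHost F w n m host ∧
      ∀ i < m, P (pieceGraph F (pieceSet F w n host i) (n i) (n (i + 1))) := by
  have hN : ∀ x, F.Adj w x → x ∈ S.X := fun x hx => hfit.nbr hw hx
  obtain ⟨n, m, hm, hmod, hnb, hlink⟩ := hub_cyclic hc hN h0 h1 h01
  have hA : ∀ i, F.Adj w (n i) := fun i => (hnb _).2 ⟨i, rfl⟩
  have hred : ∀ i, n i = n (i % m) ∧ n (i + 1) = n (i % m + 1) := by
    intro i
    rw [hmod, hmod]
    exact ⟨(Nat.mod_modEq _ _).symm, (Nat.mod_modEq _ _).symm.add_right 1⟩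
  have hlt : ∀ i, i % m < m := fun i => Nat.mod_lt _ (by omega)
  obtain ⟨host, g1, g2, g3, g4⟩ := exists_host (n := n) hc hN (by omega : 0 < m) (by
    intro a ha
    obtain ⟨i, rfl⟩ := (hnb a).1 ha
    exact ⟨i % m, hlt i, Or.inl (hred i).1⟩) (by
    intro a b hab
    obtain ⟨i, hi⟩ := hlink a b hab
    rw [(hred i).1, (hred i).2] at hi
    exact ⟨i % m, hlt i, hi⟩)
  refine ⟨n, m, host, hm, hmod, hnb, ⟨g1, g2, g3, g4⟩, fun i _ => ?_⟩
  have hne : n i ≠ n (i + 1) := by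
    intro hi
    rw [hmod, Nat.modEq_iff_dvd' (by omega)] at hi
    have := Nat.le_of_dvd (by omega) hi
    omega
  have hnot : w ∉ pieceSet F w n host i := by
    rintro (h' | h' | h')
    · exact h'.2.2 rfl
    · exact (hA i).ne h'
    · exact (hA (i + 1)).ne h'
  exact IH _ (pieceGraph_card_lt hnot (hA _) (hA _) hne)
    (pieceGraph_cone hc hnot (Or.inr (Or.inl rfl)) (Or.inr (Or.inr rfl)) (hA _) (hA _))
    (hfit.piece (hN _ (hA _)) (hN _ (hA _)))

/-- A root edge whose first end is a hub. -/
lemma rooted_fan [Finite V] {F : SimpleGraph V} (hc : Cone F S.X) (hfit : S.Fits F)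
    (hX : ∀ x y, F.Adj x y → y ∈ S.X)
    (IH : ∀ F' : SimpleGraph V, F'.edgeSet.ncard < F.edgeSet.ncard → Cone F' S.X → S.Fits F' →
      S.Rooted F') {u v v' : V} (huv : F.Adj u v) (huv' : F.Adj u v') (hvv : v' ≠ v) {s t : St}
    (hst : S.ok u v s t) :
    ∃ f, S.Sol F f ∧ f u = s ∧ f v = t ∧
      (∀ y ∈ S.X, F.Adj u y → y ≠ v → S.strict u y s (f y)) ∧
      (∀ y ∈ S.X, F.Adj v y → y ≠ u → S.strict v y t (f y)) := by
  obtain ⟨n, m, hinj, hnb, hlink⟩ := hub_linear hc (fun x hx => hX _ _ hx) (hX _ _ huv.symm)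
  obtain ⟨i0, hi0, rfl⟩ := (hnb v).1 huv
  obtain ⟨i1, hi1, rfl⟩ := (hnb v').1 huv'
  have hm : 2 ≤ m := by
    by_contra hcon
    exact hvv (by rw [show i1 = i0 by omega])
  have hA : ∀ i < m, F.Adj u (n i) := fun i hi => (hnb _).2 ⟨i, hi, rfl⟩
  obtain ⟨host, g1, g2, g3, g4⟩ := exists_host (n := n) (m := m - 1) hc (fun x hx => hX _ _ hx)
    (by omega) (by
    intro a ha
    obtain ⟨i, hi, rfl⟩ := (hnb a).1 ha
    by_cases h : i < m - 1
    · exact ⟨i, h, Or.inl rfl⟩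
    · refine ⟨i - 1, by omega, Or.inr ?_⟩
      rw [show i - 1 + 1 = i by omega]) (by
    intro a b hab
    obtain ⟨i, hi, hi'⟩ := hlink a b hab
    exact ⟨i, by omega, hi'⟩)
  refine fan_step hX hinj hnb ⟨g1, g2, g3, g4⟩ (fun i hi => ?_) hi0 hst
  have hne : n i ≠ n (i + 1) := fun h' => by
    have := hinj _ _ (by omega) hi h'
    omega
  have hnot : u ∉ pieceSet F u n host i := by
    rintro (h' | h' | h')
    · exact h'.2.2 rfl
    · exact (hA i (by omega)).ne h'
    · exact (hA (i + 1) hi).ne h'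
  have a1 := hA i (by omega)
  have a2 := hA _ hi
  exact IH _ (pieceGraph_card_lt hnot a1 a2 hne)
    (pieceGraph_cone hc hnot (Or.inr (Or.inl rfl)) (Or.inr (Or.inr rfl)) a1 a2)
    (hfit.piece (hX _ _ a1) (hX _ _ a2))

theorem rooted_and_solvable [Finite V] [Nonempty St] (S : ColSystem V St) (F : SimpleGraph V)
    (hc : Cone F S.X) (hfit : S.Fits F) : S.Rooted F ∧ ∃ f, S.Sol F f := by
  classical
  induction hk : F.edgeSet.ncard using Nat.strong_induction_on generalizing F with
  | _ k IH =>
  subst hk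
  replace IH : ∀ F' : SimpleGraph V, F'.edgeSet.ncard < F.edgeSet.ncard → Cone F' S.X →
    S.Fits F' → S.Rooted F' ∧ ∃ f, S.Sol F' f := fun F' h1 h2 h3 => IH _ h1 F' h2 h3 rfl
  have IHR : ∀ F' : SimpleGraph V, F'.edgeSet.ncard < F.edgeSet.ncard → Cone F' S.X →
    S.Fits F' → S.Rooted F' := fun F' h1 h2 h3 => (IH F' h1 h2 h3).1
  by_cases hW : ∃ w ∈ S.W, ∃ x0 x1, F.Adj w x0 ∧ F.Adj w x1 ∧ x0 ≠ x1
  · obtain ⟨w, hw, x0, x1, h0, h1, h01⟩ := hW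
    obtain ⟨n, m, host, hm, hmod, hnb, hh, IH'⟩ := wheel_data hc hfit hw h0 h1 h01 IH
    have hwX : ∀ x ∈ S.X, x ≠ w := by
      rintro x hx rfl
      exact S.disj _ hx hw
    constructor
    · intro u v hu hv huv s t hst
      obtain ⟨j, hj, huj, hvj⟩ := hh.mem_piece (hwX u hu) (hwX v hv) huv
      obtain ⟨f0, a1, a2, a3, a4, a5⟩ := (IH' j hj).1 u v hu hv (Or.inl ⟨huv, huj, hvj⟩) s t hst
      obtain ⟨f, b1, b2, b3⟩ :=
        polygon_step hfit hw hm hmod hnb hh (fun i hi => (IH' i hi).1) hj a1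
      have fu : f u = s := (b2 u huj).trans a2
      have fv : f v = t := (b2 v hvj).trans a3
      refine ⟨f, b1, fu, fv, fun y hy huy hyv => ?_, fun y hy hvy hyu => ?_⟩
      · by_cases hyj : y ∈ pieceSet F w n host j
        · rw [b2 y hyj]
          exact a4 y hy (Or.inl ⟨huy, huj, hyj⟩) hyv
        · rw [← fu]
          exact b3 u huj (hwX u hu) y hy huy hyj
      · by_cases hyj : y ∈ pieceSet F w n host j
        · rw [b2 y hyj]
          exact a5 y hy (Or.inl ⟨hvy, hvj, hyj⟩) hyu
        · rw [← fv]
          exact b3 v hvj (hwX v hv) y hy hvy hyj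
    · obtain ⟨f0, hf0⟩ := (IH' 0 (by omega)).2
      obtain ⟨f, b1, -⟩ := polygon_step hfit hw hm hmod hnb hh (fun i hi => (IH' i hi).1)
        (by omega : 0 < m) hf0
      exact ⟨f, b1⟩
  push Not at hW
  have hR : S.Rooted F := by
    by_cases hWe : ∃ w x, w ∈ S.W ∧ F.Adj w x
    · obtain ⟨w, x, hw, hwx⟩ := hWe
      let F' : SimpleGraph V :=
        { Adj := fun x y => F.Adj x y ∧ x ∈ S.X ∧ y ∈ S.X
          symm := ⟨fun _ _ h => ⟨h.1.symm, h.2.2, h.2.1⟩⟩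
          loopless := ⟨fun x h => h.1.ne rfl⟩ }
      have hle : F' ≤ F := fun _ _ h => h.1
      have hlt : F' < F := lt_of_le_of_ne hle (by
        intro h
        rw [← h] at hwx
        exact S.disj _ hwx.2.1 hw)
      have hfit' : S.Fits F' := fun x y h => Or.inl ⟨h.2.1, Or.inl h.2.2⟩
      intro u v hu hv huv s t hst
      obtain ⟨f, a1, a2, a3, a4, a5⟩ := IHR F' (edgeSet_ncard_lt hlt) (hc.mono hle) hfit'
        u v hu hv ⟨huv, hu, hv⟩ s t hst
      refine ⟨f, ⟨fun x y hx hy hxy => a1.ok x y hx hy ⟨hxy, hx, hy⟩, fun w hw =>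
        S.pol_triv _ _ _ (fun x hx y hy => hW w hw x y hx hy), ?_⟩, a2, a3,
        fun y hy huy => a4 y hy ⟨huy, hu, hy⟩, fun y hy hvy => a5 y hy ⟨hvy, hv, hy⟩⟩
      exact fun x y y' hx hy hy' hxy hxy' => a1.bot x y y' hx hy hy' ⟨hxy, hx, hy⟩ ⟨hxy', hx, hy'⟩
    · push Not at hWe
      have hX : ∀ x y, F.Adj x y → y ∈ S.X := by
        intro x y hxy
        rcases hfit y x hxy.symm with h | h
        · exact h.1
        · exact (hWe y x h.1 hxy.symm).elim
      intro u v hu hv huv s t hst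
      by_cases hu2 : ∃ v', F.Adj u v' ∧ v' ≠ v
      · obtain ⟨v', h1, h2⟩ := hu2
        exact rooted_fan hc hfit hX IHR huv h1 h2 hst
      by_cases hv2 : ∃ u', F.Adj v u' ∧ u' ≠ u
      · obtain ⟨u', h1, h2⟩ := hv2
        obtain ⟨f, a1, a2, a3, a4, a5⟩ :=
          rooted_fan hc hfit hX IHR huv.symm h1 h2 (S.ok_symm _ _ _ _ hst)
        exact ⟨f, a1, a3, a2, a5, a4⟩
      push Not at hu2 hv2
      have hle : F.deleteEdges {s(u, v)} ≤ F := F.deleteEdges_le _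
      have hlt : F.deleteEdges {s(u, v)} < F := lt_of_le_of_ne hle (by
        intro h
        rw [← h] at huv
        simp at huv)
      obtain ⟨f, hf⟩ := (IH _ (edgeSet_ncard_lt hlt) (hc.mono hle)
        (fun x y h => hfit x y (hle h))).2
      have hedge : ∀ x y, F.Adj x y → (x = u ∧ y = v) ∨ (x = v ∧ y = u) ∨
          ((F.deleteEdges {s(u, v)}).Adj x y ∧ x ≠ u ∧ x ≠ v ∧ y ≠ u ∧ y ≠ v) := by
        intro x y hxy
        by_cases hxu : x = u
        · subst hxu
          exact Or.inl ⟨rfl, hu2 y hxy⟩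
        by_cases hxv : x = v
        · subst hxv
          exact Or.inr (Or.inl ⟨rfl, hv2 y hxy⟩)
        have hyu : y ≠ u := by
          rintro rfl
          exact hxv (hu2 x hxy.symm)
        have hyv : y ≠ v := by
          rintro rfl
          exact hxu (hv2 x hxy.symm)
        refine Or.inr (Or.inr ⟨?_, hxu, hxv, hyu, hyv⟩)
        simp only [deleteEdges_adj, Set.mem_singleton_iff, Sym2.eq_iff]
        exact ⟨hxy, fun h => h.elim (fun h => hxu h.1) (fun h => hxv h.1)⟩
      have hvu : v ≠ u := huv.ne'
      let g : V → St := fun x => if x = u then s else if x = v then t else f x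
      have gu : g u = s := if_pos rfl
      have gv : g v = t := (if_neg hvu).trans (if_pos rfl)
      have gx : ∀ x, x ≠ u → x ≠ v → g x = f x := fun x h1 h2 => (if_neg h1).trans (if_neg h2)
      refine ⟨g, ⟨?_, ?_, ?_⟩, gu, gv, fun y _ h h' => (h' (hu2 y h)).elim,
        fun y _ h h' => (h' (hv2 y h)).elim⟩
      · intro x y hx hy hxy
        rcases hedge x y hxy with ⟨rfl, rfl⟩ | ⟨rfl, rfl⟩ | ⟨h, h1, h2, h3, h4⟩
        · rwa [gu, gv]
        · rw [gu, gv]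
          exact S.ok_symm _ _ _ _ hst
        · rw [gx x h1 h2, gx y h3 h4]
          exact hf.ok x y hx hy h
      · intro w hw
        exact S.pol_triv _ _ _ (fun x hx y hy => hW w hw x y hx hy)
      · intro x y y' hx hy hy' hxy hxy' hyy hs hs'
        rcases hedge x y hxy with ⟨rfl, rfl⟩ | ⟨rfl, rfl⟩ | ⟨h, h1, h2, h3, h4⟩
        · exact (hyy (hu2 y' hxy').symm).elim
        · exact (hyy (hv2 y' hxy').symm).elim
        · rcases hedge x y' hxy' with ⟨rfl, rfl⟩ | ⟨rfl, rfl⟩ | ⟨h', -, -, h3', h4'⟩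
          · exact (h1 rfl).elim
          · exact (h2 rfl).elim
          · rw [gx x h1 h2, gx y h3 h4] at hs
            rw [gx x h1 h2, gx y' h3' h4'] at hs'
            exact hf.bot x y y' hx hy hy' h h' hyy hs hs'
  refine ⟨hR, ?_⟩
  by_cases hE : ∃ u v, u ∈ S.X ∧ v ∈ S.X ∧ F.Adj u v
  · obtain ⟨u, v, hu, hv, huv⟩ := hE
    obtain ⟨s, t, hst⟩ := S.init u v huv.ne
    obtain ⟨f, hf, -⟩ := hR u v hu hv huv s t hst
    exact ⟨f, hf⟩
  · push Not at hE
    obtain ⟨s⟩ := ‹Nonempty St›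
    exact ⟨fun _ => s, fun x y hx hy hxy => (hE x y hx hy hxy).elim,
      fun w hw => S.pol_triv _ _ _ (fun x hx y hy => hW w hw x y hx hy),
      fun x y _ hx hy _ hxy => (hE x y hx hy hxy).elim⟩

end ColSystem

section

/-- The states are numbered `0, …, 479`. The `c`-th set contains the states with a plus at `c`. -/
def plusTab : List ℕ := [
  2065156733285956754621432459128283852050678330065192583384144432762827288055092278907760236419840492937492158409302812894726908611239132523398143,
  1836457205763570370688041880770878943825768633296627202235325087122332528469656695164308811352092351172517013103294524994203424739036116623096847,
  1248699345724835493872218991131323644315247874177443545356461665934861527475226017739698061276217102515273908715991658863850932088351653111471217,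
  1092916925295749445815654555999942406624341718704123878037362182131816717408903036196138443068127405106243401169045024250015705099317740037694866,
  266890561872397964636775449860912487274023126962361618512393529349250667803293804871269811581811054518947913332554224083112009476991582317220,
  1040582850105330745400197317647085070375723543865026025968601077029774254079749924243868697282170828603497163227226165060463221935464868469461832]

/-- The `c`-th set contains the states with a minus at `c`. -/
def minusTab : List ℕ := [
  1056591817030024388789073535570302401339056587247976892621623871292314176888407085707727661861203567095114261673345502510973710239007685875858432,
  1285291344507005531103856401622392900019058468388683749143898656839837413163526377220630502804755642892096724526540255596190118018786181335942128,
  1873049018565870738102489688694126703587166415799350535696243937215948935102424183604821340022587540160668749857666964083260811082456558643766158,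
  2028069665448789214950442006028660561155195813187569866950933850798100238036425550290479666097216246429806031370776349642447671375990950023436909,
  495255080294592326227872311319059755340380716461182249970137230214083023619869426372578505891445734353905710422915869155401640666855644484955,
  2081165700210661485981397330526635247606596610275102297926268405317123545093460986958750164908598510122472019812454316784815903403467447609666743]

/-- The states with sign `s` at the colour `c`, as a bit mask. -/
def sg (s : Bool) (c : ℕ) : ℕ := (Bool.rec minusTab plusTab s : List ℕ).getD c 0

def bit (m i : ℕ) : ℕ := Nat.land (Nat.shiftRight m i) 1

def without (a b : ℕ) : ℕ := Nat.xor a (Nat.land a b)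

def full : ℕ := 2 ^ 480 - 1

/-- The states of colour `c`. -/
def colSet (c : ℕ) : ℕ := Nat.shiftLeft (2 ^ 80 - 1) (80 * c)

/-- The union of the sets `f d`, `d < 6`, taken `w d` times. -/
def union (w f : ℕ → ℕ) : ℕ :=
  Nat.lor (Nat.mul (w 0) (f 0)) (Nat.lor (Nat.mul (w 1) (f 1)) (Nat.lor (Nat.mul (w 2) (f 2))
    (Nat.lor (Nat.mul (w 3) (f 3)) (Nat.lor (Nat.mul (w 4) (f 4)) (Nat.mul (w 5) (f 5))))))

/-- The states without undecided colour. -/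
def balanced : ℕ := union (fun _ => 1) fun c => Nat.shiftLeft (2 ^ 20 - 1) (80 * c)

/-- The states with sign `t` at a colour different from `c` at which `a` has sign `s`. -/
def meets (a : ℕ) (s t : Bool) (c : ℕ) : ℕ :=
  union (fun d => Nat.mul (bit (sg s d) a) (Nat.sub 1 (Nat.pow 0 (Nat.xor c d)))) (sg t)

/-- The states for which `c` is alone in its quadrant with respect to `a`. -/
def alone (a c : ℕ) : ℕ :=
  Nat.lor
    (Nat.mul (bit (sg true c) a)
      (Nat.lor (without (sg true c) (meets a true true c)) (without (sg false c) (meets a true false c))))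
    (Nat.mul (bit (sg false c) a)
      (Nat.lor (without (sg true c) (meets a false true c)) (without (sg false c) (meets a false false c))))

/-- The states compatible with `a`. -/
def good (a : ℕ) : ℕ :=
  without (without
    (Nat.land (Nat.land (meets a true true 6) (meets a true false 6))
      (Nat.land (meets a false true 6) (meets a false false 6)))
    (Nat.land (colSet (a / 80)) (alone a (a / 80))))
    (Nat.mul (Nat.sub 1 (bit balanced a)) (without (Nat.land (alone a (a / 80))
      (union (fun _ => 1) fun c => Nat.land (alone a c) (colSet c))) balanced))

/-- The sets `B p`, `p ∈ l`, `m p ≠ 0`, cover `R`. -/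
def covers (m B : ℕ → ℕ) (l : List ℕ) : ℕ → Bool :=
  List.rec (fun R => Nat.beq R 0)
    (fun p _ r R => Nat.rec (r R) (fun _ _ => r (without R (B p))) (m p)) l

def allOf (f : ℕ → Bool) (l : List ℕ) : Bool :=
  List.rec true (fun x _ r => Bool.rec false r (f x)) l

/-- The states `p` with the colour of `p` at sign `r` in `a`, and not sign `!r` at the colour of `a`. -/
def link (a : ℕ) (r : Bool) : ℕ :=
  without (union (fun d => bit (sg r d) a) colSet) (sg (!r) (a / 80))

def link' (p : ℕ) (r : Bool) : ℕ :=
  Nat.land (sg r (p / 80)) (union (fun d => Nat.sub 1 (bit (sg (!r) d) p)) colSet)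

def block (p : ℕ) : ℕ :=
  Nat.lor (Nat.land full (Nat.land (good p) (link' p false)))
    (Nat.lor (Nat.shiftLeft (Nat.land full (Nat.land (good p) (link' p true))) 480)
      (Nat.shiftLeft (Nat.land full (without (good p) (colSet (p / 80)))) 960))

def triple (m : ℕ) : ℕ := Nat.lor m (Nat.lor (Nat.shiftLeft m 480) (Nat.shiftLeft m 960))

/-- `1` if `c ≠ d`, and `0` otherwise. -/
def differ (c d : ℕ) : ℕ := Nat.sub 1 (Nat.pow 0 (Nat.xor c d))

/-- The balanced states of colour `c`. -/
def balList (c : ℕ) : List ℕ := (List.range 20).map (Nat.add (Nat.mul 80 c))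

/-- The states `y` such that `p` has sign `s` at the colour of `y`. -/
def hub (p : ℕ) (s : Bool) : ℕ := union (fun e => bit (sg s e) p) colSet

/-- The compatible states `y` such that `p` has sign `s` at the colour of `y`. -/
def near (s : Bool) (p : ℕ) : ℕ := Nat.land (good p) (hub p s)

/-- The states from which one can continue with a balanced state of colour `c`, with sign `s` at the
previous and sign `t` at the next colour `d`. -/
def sources (c d : ℕ) (s t : Bool) : ℕ :=
  without (without full (without (colSet c) balanced)) (Bool.rec 0 (colSet d) (Bool.xor s t))

def allBool (f : Bool → Bool) : Bool := Bool.and (f true) (f false)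

/-- The check `f` is only performed if `n` is not zero. -/
def onlyIf (n : ℕ) (f : Bool) : Bool := Nat.rec true (fun _ _ => f) n

set_option maxRecDepth 100000 in
theorem colour_check : allOf (fun a => allBool fun s => allBool fun t =>
    covers (fun e => Nat.mul (bit (sg t (Nat.mod e 6)) a)
        (Nat.mul (differ (Nat.div e 6) (Nat.mod e 6))
          (Nat.mul (differ (Nat.div e 6) (a / 80)) (differ (Nat.mod e 6) (a / 80)))))
      (fun e => without (without (sg s (Nat.div e 6)) (colSet (Nat.div e 6))) (colSet (Nat.mod e 6)))
      (List.range 36) (good a)) (List.range 480) = true := by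
  decide +kernel

set_option maxRecDepth 100000 in
theorem extend_check : allOf (fun c => allOf (fun d => allBool fun s => allBool fun t =>
    covers (bit (sg t d)) (near s) (balList c) (sources c d s t))
    (List.range 6)) (List.range 6) = true := by
  decide +kernel

set_option maxRecDepth 100000 in
theorem extend_avoid_check : allOf (fun c => allOf (fun q => allBool fun s => allBool fun t =>
    covers (fun p => Nat.mul (differ p q) (bit (sg t c) p)) (near s) (balList c) (sources c c s t))
    (balList c)) (List.range 6) = true := by
  decide +kernel

set_option maxRecDepth 100000 in
theorem close_check : allOf (fun c => allOf (fun d => onlyIf (differ c d)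
    (allOf (fun q => allBool fun s => allBool fun t =>
      covers (fun p => Nat.mul (bit (good q) p) (bit (sg t d) p)) (near s) (balList c)
        (sources c d s t)) (balList d))) (List.range 6)) (List.range 6) = true := by
  decide +kernel

set_option maxRecDepth 100000 in
theorem close_same_check : allOf (fun c => allOf (fun q => allOf (fun q' =>
    onlyIf (Nat.mul (Nat.sub q' q) (Nat.sub 1 (Nat.xor (bit (sg true c) q) (bit (sg true c) q'))))
    (allBool fun s => allBool fun t =>
      covers (fun p => Nat.mul (Nat.lor (bit (good q) p) (bit (good q') p)) (bit (sg t c) p))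
        (near s) (balList c) (sources c c s t))) (balList c)) (balList c)) (List.range 6) = true := by
  decide +kernel

set_option maxRecDepth 100000 in
theorem child_check : allOf (fun a => Bool.and
    (allBool fun r =>
      covers (bit (Nat.land (good a) (link a r))) block (List.range 480) (triple (good a)))
    (covers (bit (without (good a) (colSet (a / 80)))) block (List.range 480) (triple (good a))))
    (List.range 480) = true := by
  decide +kernel

set_option maxRecDepth 100000 in
theorem balanced_check : allOf (fun c => Bool.and (Nat.beq (Nat.land (sg true c) (sg false c)) 0)
    (Nat.beq (without balanced (Nat.lor (sg true c) (sg false c))) 0)) (List.range 6) = true := by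
  decide +kernel

set_option maxRecDepth 100000 in
theorem undecided_check : allOf (fun c => Bool.and
    (Nat.beq (without (colSet c) (Nat.lor (sg true c) (sg false c))) 0)
    (allOf (fun d => onlyIf (differ c d) (Nat.beq (without full
      (Nat.lor (Nat.lor (sg true c) (sg false c)) (Nat.lor (sg true d) (sg false d)))) 0))
      (List.range 6))) (List.range 6) = true := by
  decide +kernel

end

lemma testBit_without (a b i : ℕ) :
    (without a b).testBit i = true ↔ a.testBit i = true ∧ ¬ b.testBit i = true := by
  change (a ^^^ (a &&& b)).testBit i = true ↔ _
  rw [Nat.testBit_xor, Nat.testBit_land]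
  cases a.testBit i <;> cases b.testBit i <;> simp

lemma testBit_and (a b i : ℕ) :
    (Nat.land a b).testBit i = true ↔ a.testBit i = true ∧ b.testBit i = true := by
  change (a &&& b).testBit i = true ↔ _
  simp

lemma testBit_or (a b i : ℕ) :
    (Nat.lor a b).testBit i = true ↔ a.testBit i = true ∨ b.testBit i = true := by
  change (a ||| b).testBit i = true ↔ _
  simp

lemma bit_eq (m i : ℕ) : bit m i = (m.testBit i).toNat := by
  change (m >>> i) &&& 1 = _
  rw [Nat.and_one_is_mod, Nat.testBit_eq_decide_div_mod_eq, Nat.shiftRight_eq_div_pow]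
  rcases Nat.mod_two_eq_zero_or_one (m / 2 ^ i) with h | h <;> simp [h]

lemma bit_le (m i : ℕ) : bit m i ≤ 1 := by
  rw [bit_eq]; cases m.testBit i <;> simp

lemma bit_ne_zero (m i : ℕ) : bit m i ≠ 0 ↔ m.testBit i = true := by
  rw [bit_eq]; cases m.testBit i <;> simp

lemma one_sub_bit_ne_zero (m i : ℕ) : Nat.sub 1 (bit m i) ≠ 0 ↔ ¬ m.testBit i = true := by
  change 1 - bit m i ≠ 0 ↔ _
  rw [bit_eq]; cases m.testBit i <;> simp

lemma differ_eq (c d : ℕ) : differ c d = if c = d then 0 else 1 := by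
  change 1 - 0 ^ (c ^^^ d) = _
  split_ifs with h
  · subst h; simp
  · have : c ^^^ d ≠ 0 := fun h' => h (Nat.xor_eq_zero_iff.1 h')
    simp [this]

lemma differ_ne_zero (c d : ℕ) : differ c d ≠ 0 ↔ c ≠ d := by
  rw [differ_eq]; split_ifs with h <;> simp [h]

lemma mul_ne_zero' (a b : ℕ) : Nat.mul a b ≠ 0 ↔ a ≠ 0 ∧ b ≠ 0 := by
  change a * b ≠ 0 ↔ _
  exact mul_ne_zero_iff

lemma nat_mul_le_one {a b : ℕ} (ha : a ≤ 1) (hb : b ≤ 1) : Nat.mul a b ≤ 1 := by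
  change a * b ≤ 1
  simpa using Nat.mul_le_mul ha hb

lemma testBit_mul_of_le_one {a : ℕ} (ha : a ≤ 1) (b i : ℕ) :
    (Nat.mul a b).testBit i = true ↔ a ≠ 0 ∧ b.testBit i = true := by
  change (a * b).testBit i = true ↔ _
  interval_cases a <;> simp

lemma testBit_union {w f : ℕ → ℕ} (hw : ∀ d, w d ≤ 1) (i : ℕ) :
    (union w f).testBit i = true ↔ ∃ d < 6, w d ≠ 0 ∧ (f d).testBit i = true := by
  simp only [union, testBit_or, testBit_mul_of_le_one (hw _)]
  constructor
  · rintro (h | h | h | h | h | h)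
    exacts [⟨0, by norm_num, h⟩, ⟨1, by norm_num, h⟩, ⟨2, by norm_num, h⟩, ⟨3, by norm_num, h⟩,
      ⟨4, by norm_num, h⟩, ⟨5, by norm_num, h⟩]
  · rintro ⟨d, hd, h⟩
    interval_cases d <;> simp only [h] <;> tauto

lemma testBit_shiftLeft_mask (k m i : ℕ) :
    (Nat.shiftLeft (2 ^ k - 1) m).testBit i = true ↔ m ≤ i ∧ i < m + k := by
  change ((2 ^ k - 1) <<< m).testBit i = true ↔ _
  rw [Nat.testBit_shiftLeft, Nat.testBit_two_pow_sub_one]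
  simp only [ge_iff_le, Bool.and_eq_true, decide_eq_true_eq]
  omega

lemma testBit_colSet (c p : ℕ) : (colSet c).testBit p = true ↔ p / 80 = c := by
  rw [colSet, testBit_shiftLeft_mask]
  omega

lemma testBit_full (p : ℕ) : full.testBit p = true ↔ p < 480 := by
  rw [full, Nat.testBit_two_pow_sub_one]; simp

lemma testBit_balanced {p : ℕ} (hp : p < 480) : balanced.testBit p = true ↔ p % 80 < 20 := by
  rw [balanced, testBit_union (fun _ => le_rfl)]
  simp only [testBit_shiftLeft_mask]
  constructor
  · rintro ⟨d, hd, -, h⟩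
    omega
  · intro h
    exact ⟨p / 80, by omega, by norm_num, by omega⟩

lemma covers_sound {m B : ℕ → ℕ} {l : List ℕ} {R i : ℕ} (h : covers m B l R = true)
    (hi : R.testBit i = true) : ∃ p ∈ l, m p ≠ 0 ∧ (B p).testBit i = true := by
  induction l generalizing R with
  | nil =>
    have : R = 0 := Nat.eq_of_beq_eq_true h
    subst this
    simp at hi
  | cons p l ih =>
    change (Nat.rec (covers m B l R) (fun _ _ => covers m B l (without R (B p))) (m p) : Bool) = true at h
    rcases hm : m p with _ | k
    · rw [hm] at h
      obtain ⟨q, hq, h'⟩ := ih h hi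
      exact ⟨q, List.mem_cons_of_mem _ hq, h'⟩
    · rw [hm] at h
      by_cases hb : (B p).testBit i = true
      · exact ⟨p, List.mem_cons_self, by omega, hb⟩
      · obtain ⟨q, hq, h'⟩ := ih h ((testBit_without _ _ _).2 ⟨hi, hb⟩)
        exact ⟨q, List.mem_cons_of_mem _ hq, h'⟩

lemma allOf_sound {f : ℕ → Bool} {l : List ℕ} (h : allOf f l = true) {x : ℕ} (hx : x ∈ l) :
    f x = true := by
  induction l with
  | nil => simp at hx
  | cons y l ih =>
    change (Bool.rec false (allOf f l) (f y) : Bool) = true at h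
    rcases hy : f y with _ | _
    · rw [hy] at h
      cases h
    · rw [hy] at h
      rcases List.mem_cons.1 hx with rfl | hx
      · exact hy
      · exact ih h hx

lemma allBool_sound {f : Bool → Bool} (h : allBool f = true) (b : Bool) : f b = true := by
  have h' : (f true && f false) = true := h
  simp only [Bool.and_eq_true] at h'
  cases b
  exacts [h'.2, h'.1]

lemma onlyIf_sound {n : ℕ} {f : Bool} (h : onlyIf n f = true) (hn : n ≠ 0) : f = true := by
  rcases n with _ | n
  · exact (hn rfl).elim
  · exact h

/-- The state `p` has sign `s` at the colour `c`. -/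
def HasSign (p : ℕ) (s : Bool) (c : ℕ) : Prop := (sg s c).testBit p = true

/-- The states `p` and `q` are compatible. -/
def Compat (p q : ℕ) : Prop := (good p).testBit q = true

/-- The colour `c` is alone in its quadrant. -/
def Alone (a b c : ℕ) : Prop :=
  ∃ s t, HasSign a s c ∧ HasSign b t c ∧ ∀ d < 6, HasSign a s d → HasSign b t d → c = d

lemma Alone.symm {a b c : ℕ} (h : Alone a b c) : Alone b a c := by
  obtain ⟨s, t, hs, ht, h⟩ := h
  exact ⟨t, s, ht, hs, fun d hd h1 h2 => h d hd h2 h1⟩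

lemma testBit_meets (a b : ℕ) (s t : Bool) (c : ℕ) :
    (meets a s t c).testBit b = true ↔ ∃ d < 6, (HasSign a s d ∧ c ≠ d) ∧ HasSign b t d := by
  rw [meets, testBit_union]
  · simp only [mul_ne_zero', bit_ne_zero]
    refine exists_congr fun d => and_congr_right fun _ => and_congr_left fun _ => and_congr_right fun _ =>
      differ_ne_zero c d
  · intro d
    refine nat_mul_le_one (bit_le _ _) ?_
    change 1 - _ ≤ 1
    omega

lemma testBit_alone (a b c : ℕ) : (alone a c).testBit b = true ↔ Alone a b c := by
  simp only [alone, testBit_or, testBit_mul_of_le_one (bit_le _ _), bit_ne_zero, testBit_without,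
    testBit_meets]
  constructor
  · rintro (⟨hs, ⟨ht, h⟩ | ⟨ht, h⟩⟩ | ⟨hs, ⟨ht, h⟩ | ⟨ht, h⟩⟩)
    all_goals exact ⟨_, _, hs, ht, fun d hd h1 h2 => by_contra fun hc => h ⟨d, hd, ⟨h1, hc⟩, h2⟩⟩
  · rintro ⟨s, t, hs, ht, h⟩
    have h' : ¬ ∃ d < 6, (HasSign a s d ∧ c ≠ d) ∧ HasSign b t d :=
      fun ⟨d, hd, ⟨h1, hc⟩, h2⟩ => hc (h d hd h1 h2)
    unfold HasSign at hs ht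
    cases s <;> cases t <;> tauto

lemma compat_iff {a b : ℕ} (hb : b < 480) : Compat a b ↔
    (∀ s t, ∃ d < 6, HasSign a s d ∧ HasSign b t d) ∧ ¬ (a / 80 = b / 80 ∧ Alone a b (a / 80)) ∧
    ¬ ((¬ balanced.testBit a = true ∧ ¬ balanced.testBit b = true) ∧ Alone a b (a / 80) ∧ Alone a b (b / 80)) := by
  have hU : (union (fun _ => 1) fun c => Nat.land (alone a c) (colSet c)).testBit b = true ↔
      Alone a b (b / 80) := by
    rw [testBit_union (fun _ => le_rfl)]
    simp only [testBit_and, testBit_alone, testBit_colSet]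
    constructor
    · rintro ⟨d, -, -, h, rfl⟩
      exact h
    · intro h
      exact ⟨b / 80, by omega, by norm_num, h, rfl⟩
  have hq : ∀ s t, (meets a s t 6).testBit b = true ↔ ∃ d < 6, HasSign a s d ∧ HasSign b t d := by
    intro s t
    rw [testBit_meets]
    refine exists_congr fun d => and_congr_right fun hd => and_congr_left fun _ => ?_
    exact and_iff_left (by omega)
  have h1 : Nat.sub 1 (bit balanced a) ≤ 1 := Nat.sub_le 1 _
  unfold Compat good
  rw [testBit_without, testBit_without, testBit_and, testBit_and, testBit_and, testBit_and,
    testBit_colSet, testBit_alone, testBit_mul_of_le_one h1, one_sub_bit_ne_zero, testBit_without,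
    testBit_and, hU, testBit_alone, hq, hq, hq, hq]
  constructor
  · rintro ⟨⟨⟨⟨q1, q2⟩, q3, q4⟩, h2⟩, h3⟩
    refine ⟨fun s t => ?_, fun h => h2 ⟨h.1.symm, h.2⟩, fun h => h3 ⟨h.1.1, ⟨h.2.1, h.2.2⟩, h.1.2⟩⟩
    cases s <;> cases t <;> assumption
  · rintro ⟨q, h2, h3⟩
    exact ⟨⟨⟨⟨q _ _, q _ _⟩, q _ _, q _ _⟩, fun h => h2 ⟨h.1.symm, h.2⟩⟩,
      fun h => h3 ⟨⟨h.1, h.2.2⟩, h.2.1.1, h.2.1.2⟩⟩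

lemma Compat.symm {a b : ℕ} (ha : a < 480) (hb : b < 480) (h : Compat a b) : Compat b a := by
  rw [compat_iff hb] at h
  rw [compat_iff ha]
  obtain ⟨h1, h2, h3⟩ := h
  refine ⟨fun s t => ?_, fun ⟨h4, h5⟩ => h2 ⟨h4.symm, h4 ▸ h5.symm⟩,
    fun ⟨⟨h4, h5⟩, h6, h7⟩ => h3 ⟨⟨h5, h4⟩, h7.symm, h6.symm⟩⟩
  obtain ⟨d, hd, h4, h5⟩ := h1 t s
  exact ⟨d, hd, h5, h4⟩

/-- The edge relation between states `a` and `p`: an edge of the graph with sign `r`, or a virtual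
edge. -/
def Link (a p : ℕ) : Option Bool → Prop
  | some r => HasSign a r (p / 80) ∧ ¬ HasSign p (!r) (a / 80)
  | none => a / 80 ≠ p / 80

/-- The state `p` has no undecided colour. -/
def IsBalanced (p : ℕ) : Prop := balanced.testBit p = true

lemma testBit_triple {m i : ℕ} (k : ℕ) (hk : k < 3) (hi : m.testBit i = true) :
    (triple m).testBit (i + 480 * k) = true := by
  have h : ∀ j n, (Nat.shiftLeft m j).testBit n = true ↔ j ≤ n ∧ m.testBit (n - j) = true := by
    intro j n
    change (m <<< j).testBit n = true ↔ _
    rw [Nat.testBit_shiftLeft]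
    simp
  rw [triple, testBit_or, testBit_or, h, h]
  interval_cases k
  · exact Or.inl hi
  · exact Or.inr (Or.inl ⟨by omega, by simpa using hi⟩)
  · exact Or.inr (Or.inr ⟨by omega, by simpa using hi⟩)

lemma testBit_land_full (m i : ℕ) :
    (Nat.land full m).testBit i = true ↔ i < 480 ∧ m.testBit i = true := by
  rw [testBit_and, testBit_full]

lemma testBit_block {p b : ℕ} (hb : b < 480) (k : ℕ) (hk : k < 3)
    (h : (block p).testBit (b + 480 * k) = true) :
    (k = 0 ∧ (good p).testBit b = true ∧ (link' p false).testBit b = true) ∨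
    (k = 1 ∧ (good p).testBit b = true ∧ (link' p true).testBit b = true) ∨
    (k = 2 ∧ (good p).testBit b = true ∧ p / 80 ≠ b / 80) := by
  have hs : ∀ m j n, (Nat.shiftLeft m j).testBit n = true ↔ j ≤ n ∧ m.testBit (n - j) = true := by
    intro m j n
    change (m <<< j).testBit n = true ↔ _
    rw [Nat.testBit_shiftLeft]
    simp
  rw [block, testBit_or, testBit_or, hs, hs, testBit_land_full, testBit_land_full,
    testBit_land_full] at h
  rcases h with ⟨h1, h2⟩ | ⟨h0, h1, h2⟩ | ⟨h0, h1, h2⟩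
  · obtain rfl : k = 0 := by omega
    exact Or.inl ⟨rfl, (testBit_and _ _ _).1 h2⟩
  · obtain rfl : k = 1 := by omega
    exact Or.inr (Or.inl ⟨rfl, by simpa using (testBit_and _ _ _).1 h2⟩)
  · obtain rfl : k = 2 := by omega
    rw [Nat.add_sub_cancel, testBit_without, testBit_colSet] at h2
    exact Or.inr (Or.inr ⟨rfl, h2.1, fun h => h2.2 h.symm⟩)

lemma testBit_link {a p : ℕ} (hp : p < 480) (r : Bool) :
    (link a r).testBit p = true ↔ HasSign a r (p / 80) ∧ ¬ HasSign p (!r) (a / 80) := by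
  rw [link, testBit_without, testBit_union fun _ => bit_le _ _]
  refine and_congr_left fun _ => ?_
  simp only [bit_ne_zero, testBit_colSet]
  constructor
  · rintro ⟨d, -, h, rfl⟩
    exact h
  · intro h
    exact ⟨p / 80, by omega, h, rfl⟩

lemma testBit_link' {b p : ℕ} (hb : b < 480) (r : Bool) :
    (link' p r).testBit b = true ↔ HasSign b r (p / 80) ∧ ¬ HasSign p (!r) (b / 80) := by
  rw [link', testBit_and, testBit_union (w := fun d => Nat.sub 1 (bit (sg (!r) d) p)) fun _ => Nat.sub_le 1 _]
  refine and_congr_right fun _ => ?_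
  simp only [one_sub_bit_ne_zero, testBit_colSet]
  constructor
  · rintro ⟨d, -, h, rfl⟩
    exact h
  · intro h
    exact ⟨b / 80, by omega, h, rfl⟩

lemma Link_of_block {p b : ℕ} (hb : b < 480) (r : Option Bool)
    (h : (block p).testBit (b + 480 * (Option.elim r 2 Bool.toNat)) = true) :
    Compat p b ∧ Link b p r := by
  rcases r with _ | _ | _
  · rcases testBit_block hb _ (by simp) h with ⟨h0, h1, h2⟩ | ⟨h0, h1, h2⟩ | ⟨h0, h1, h2⟩
    · simp at h0
    · simp at h0
    · exact ⟨h1, h2.symm⟩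
  · rcases testBit_block hb _ (by simp) h with ⟨h0, h1, h2⟩ | ⟨h0, h1, h2⟩ | ⟨h0, h1, h2⟩
    · exact ⟨h1, (testBit_link' hb _).1 h2⟩
    · simp at h0
    · simp at h0
  · rcases testBit_block hb _ (by simp) h with ⟨h0, h1, h2⟩ | ⟨h0, h1, h2⟩ | ⟨h0, h1, h2⟩
    · simp at h0
    · exact ⟨h1, (testBit_link' hb _).1 h2⟩
    · simp at h0

lemma exists_child {a b : ℕ} (ha : a < 480) (hb : b < 480) (h : Compat a b) (r₁ r₂ : Option Bool) :
    ∃ p < 480, Compat a p ∧ Compat b p ∧ Link a p r₁ ∧ Link b p r₂ := by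
  have hc := allOf_sound child_check (List.mem_range.2 ha)
  replace hc := (Bool.and_eq_true _ _).mp hc
  have ht := testBit_triple (Option.elim r₂ 2 Bool.toNat) (by rcases r₂ with _ | _ | _ <;> simp) h
  rcases r₁ with _ | r
  · obtain ⟨p, hp, hm, hB⟩ := covers_sound hc.2 ht
    rw [bit_ne_zero, testBit_without, testBit_colSet] at hm
    have hp := List.mem_range.1 hp
    obtain ⟨h1, h2⟩ := Link_of_block hb r₂ hB
    exact ⟨p, hp, hm.1, h1.symm hp hb, fun h => hm.2 h.symm, h2⟩
  · obtain ⟨p, hp, hm, hB⟩ := covers_sound (allBool_sound hc.1 r) ht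
    have hp := List.mem_range.1 hp
    rw [bit_ne_zero, testBit_and, testBit_link hp] at hm
    obtain ⟨h1, h2⟩ := Link_of_block hb r₂ hB
    exact ⟨p, hp, hm.1, h1.symm hp hb, hm.2, h2⟩

lemma exists_colours {a b : ℕ} (ha : a < 480) (h : Compat a b) (s t : Bool) :
    ∃ c < 6, ∃ d < 6, c ≠ d ∧ c ≠ a / 80 ∧ d ≠ a / 80 ∧ c ≠ b / 80 ∧ d ≠ b / 80 ∧
      HasSign a t d ∧ HasSign b s c := by
  obtain ⟨e, he, hm, hB⟩ := covers_sound (allBool_sound (allBool_sound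
    (allOf_sound colour_check (List.mem_range.2 ha)) s) t) h
  have he := List.mem_range.1 he
  rw [mul_ne_zero', mul_ne_zero', mul_ne_zero', differ_ne_zero, differ_ne_zero, differ_ne_zero,
    bit_ne_zero] at hm
  rw [testBit_without, testBit_without, testBit_colSet, testBit_colSet] at hB
  exact ⟨e / 6, by omega, e % 6, by omega, hm.2.1, hm.2.2.1, hm.2.2.2, fun h => hB.1.2 h.symm,
    fun h => hB.2 h.symm, hm.1, hB.1.1⟩

/-- `y` can be followed by a balanced state of colour `c`, with sign `s` at the colour of `y` and
sign `t` at the colour `d`. -/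
def Source (y c d : ℕ) (s t : Bool) : Prop :=
  y < 480 ∧ (y / 80 = c → IsBalanced y) ∧ (y / 80 = d → s = t)

lemma Source.testBit {y c d : ℕ} {s t : Bool} (h : Source y c d s t) :
    (sources c d s t).testBit y = true := by
  obtain ⟨h1, h2, h3⟩ := h
  rw [sources, testBit_without, testBit_without, testBit_without, testBit_full, testBit_colSet]
  refine ⟨⟨h1, fun h => h.2 (h2 h.1)⟩, ?_⟩
  intro h
  cases s <;> cases t
  · simp at h
  · exact Bool.noConfusion (h3 ((testBit_colSet _ _).1 h))
  · exact Bool.noConfusion (h3 ((testBit_colSet _ _).1 h))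
  · simp at h

lemma testBit_near {s : Bool} {p y : ℕ} (hy : y < 480) :
    (near s p).testBit y = true ↔ Compat p y ∧ HasSign p s (y / 80) := by
  rw [near, testBit_and, hub, testBit_union fun _ => bit_le _ _]
  refine and_congr_right fun _ => ?_
  simp only [bit_ne_zero, testBit_colSet]
  constructor
  · rintro ⟨d, -, h, rfl⟩
    exact h
  · intro h
    exact ⟨y / 80, by omega, h, rfl⟩

lemma mem_balList {c p : ℕ} (hc : c < 6) (h : p ∈ balList c) : p < 480 ∧ p / 80 = c ∧ IsBalanced p := by
  obtain ⟨k, hk, rfl⟩ := List.mem_map.1 h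
  have hk := List.mem_range.1 hk
  have e : (Nat.mul 80 c).add k = 80 * c + k := rfl
  rw [e]
  have : 80 * c + k < 480 := by omega
  refine ⟨this, by omega, (testBit_balanced this).2 (by omega)⟩

lemma exists_extend' {y c d : ℕ} {s t : Bool} (hc : c < 6) (hd : d < 6) (h : Source y c d s t) :
    ∃ p ∈ balList c, Compat p y ∧ HasSign p s (y / 80) ∧ HasSign p t d := by
  obtain ⟨p, hp, hm, hB⟩ := covers_sound (allBool_sound (allBool_sound (allOf_sound
    (allOf_sound extend_check (List.mem_range.2 hc)) (List.mem_range.2 hd)) s) t) h.testBit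
  rw [testBit_near h.1] at hB
  exact ⟨p, hp, hB.1, hB.2, (bit_ne_zero _ _).1 hm⟩

lemma exists_extend {y c d : ℕ} {s t : Bool} (hc : c < 6) (hd : d < 6) (h : Source y c d s t) :
    ∃ p < 480, p / 80 = c ∧ IsBalanced p ∧ Compat y p ∧ HasSign p s (y / 80) ∧ HasSign p t d := by
  obtain ⟨p, hp, h1, h2, h3⟩ := exists_extend' hc hd h
  obtain ⟨h4, h5, h6⟩ := mem_balList hc hp
  exact ⟨p, h4, h5, h6, h1.symm h4 h.1, h2, h3⟩

lemma HasSign.not_not {p c : ℕ} {s : Bool} (hc : c < 6) (h : HasSign p s c) : ¬ HasSign p (!s) c := by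
  have h1 := ((Bool.and_eq_true _ _).mp (allOf_sound balanced_check (List.mem_range.2 hc))).1
  have h1 := Nat.eq_of_beq_eq_true h1
  have h2 := testBit_and (sg true c) (sg false c) p
  rw [h1] at h2
  intro h'
  have : HasSign p true c ∧ HasSign p false c := by
    cases s
    exacts [⟨h', h⟩, ⟨h, h'⟩]
  simpa using h2.2 this

lemma hasSign_or {p c d : ℕ} (hp : p < 480) (hc : c < 6) (hd : d < 6) (hcd : c ≠ d) :
    (HasSign p true c ∨ HasSign p false c) ∨ (HasSign p true d ∨ HasSign p false d) := by
  have h1 := onlyIf_sound (allOf_sound ((Bool.and_eq_true _ _).mp (allOf_sound undecided_check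
    (List.mem_range.2 hc))).2 (List.mem_range.2 hd)) ((differ_ne_zero _ _).2 hcd)
  have h1 := Nat.eq_of_beq_eq_true h1
  have h2 := testBit_without full (Nat.lor (Nat.lor (sg true c) (sg false c))
    (Nat.lor (sg true d) (sg false d))) p
  rw [h1, testBit_or, testBit_or, testBit_or, testBit_full] at h2
  by_contra h3
  simpa using h2.2 ⟨hp, h3⟩

lemma exists_close' {y c q q' : ℕ} {s t u : Bool} (hc : c < 6) (hq : q ∈ balList c)
    (hq' : q' ∈ balList c) (hlt : q < q') (hu : HasSign q u c) (hu' : HasSign q' u c)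
    (h : Source y c c s t) :
    ∃ p ∈ balList c, (Compat q p ∨ Compat q' p) ∧ Compat p y ∧ HasSign p s (y / 80) ∧
      HasSign p t c := by
  have hb : bit (sg true c) q = bit (sg true c) q' := by
    rw [bit_eq, bit_eq]
    congr 1
    cases u
    · have h1 := hu.not_not hc
      have h2 := hu'.not_not hc
      simp only [HasSign, Bool.not_false, Bool.not_eq_true] at h1 h2
      rw [h1, h2]
    · rw [hu, hu']
  have hn : Nat.mul (Nat.sub q' q)
      (Nat.sub 1 (Nat.xor (bit (sg true c) q) (bit (sg true c) q'))) ≠ 0 := by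
    rw [hb, mul_ne_zero']
    constructor
    · change q' - q ≠ 0
      omega
    · change 1 - (_ ^^^ _) ≠ 0
      simp
  obtain ⟨p, hp, hm, hB⟩ := covers_sound (allBool_sound (allBool_sound (onlyIf_sound (allOf_sound
    (allOf_sound (allOf_sound close_same_check (List.mem_range.2 hc)) hq) hq') hn) s) t) h.testBit
  rw [testBit_near h.1] at hB
  rw [mul_ne_zero', bit_ne_zero] at hm
  refine ⟨p, hp, ?_, hB.1, hB.2, hm.2⟩
  by_contra! hcon
  apply hm.1
  have e : ∀ n i, ¬ n.testBit i = true → bit n i = 0 := fun n i h => by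
    by_contra hne
    exact h ((bit_ne_zero _ _).1 hne)
  rw [e _ _ hcon.1, e _ _ hcon.2]
  rfl

lemma exists_close {y z c d : ℕ} {s₁ s₂ s₃ s₄ : Bool} (hc : c < 6) (hd : d < 6)
    (hy : Source y c d s₁ s₂) (hz : Source z d c s₄ s₃) :
    ∃ p < 480, ∃ q < 480, p / 80 = c ∧ q / 80 = d ∧ IsBalanced p ∧ IsBalanced q ∧
      Compat y p ∧ Compat p q ∧ Compat q z ∧ HasSign p s₁ (y / 80) ∧ HasSign p s₂ d ∧
      HasSign q s₃ c ∧ HasSign q s₄ (z / 80) := by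
  obtain ⟨q, hq, h1, h2, h3⟩ := exists_extend' hd hc hz
  obtain ⟨h4, h5, h6⟩ := mem_balList hd hq
  by_cases hcd : c = d
  · subst hcd
    obtain ⟨q', hq', hm', hB'⟩ := covers_sound (allBool_sound (allBool_sound (allOf_sound
      (allOf_sound extend_avoid_check (List.mem_range.2 hc)) hq) s₄) s₃) hz.testBit
    rw [testBit_near hz.1] at hB'
    rw [mul_ne_zero', bit_ne_zero, differ_ne_zero] at hm'
    obtain ⟨h4', h5', h6'⟩ := mem_balList hd hq'
    have hpq : ∃ p ∈ balList c, (Compat q p ∨ Compat q' p) ∧ Compat p y ∧ HasSign p s₁ (y / 80) ∧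
        HasSign p s₂ c := by
      rcases lt_or_gt_of_ne hm'.1 with hlt | hlt
      · obtain ⟨p, hp, ho, hr⟩ := exists_close' hc hq' hq hlt hm'.2 h3 hy
        exact ⟨p, hp, ho.symm, hr⟩
      · exact exists_close' hc hq hq' hlt h3 hm'.2 hy
    obtain ⟨p, hp, ho, hr1, hr2, hr3⟩ := hpq
    obtain ⟨g4, g5, g6⟩ := mem_balList hc hp
    rcases ho with ho | ho
    · exact ⟨p, g4, q, h4, g5, h5, g6, h6, hr1.symm g4 hy.1, ho.symm h4 g4, h1, hr2, hr3, h3, h2⟩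
    · exact ⟨p, g4, q', h4', g5, h5', g6, h6', hr1.symm g4 hy.1, ho.symm h4' g4, hB'.1, hr2, hr3,
        hm'.2, hB'.2⟩
  · obtain ⟨p, hp, hm, hB⟩ := covers_sound (allBool_sound (allBool_sound (allOf_sound
      (onlyIf_sound (allOf_sound (allOf_sound close_check (List.mem_range.2 hc))
        (List.mem_range.2 hd)) ((differ_ne_zero _ _).2 hcd)) hq) s₁) s₂) hy.testBit
    rw [testBit_near hy.1] at hB
    rw [mul_ne_zero', bit_ne_zero, bit_ne_zero] at hm
    obtain ⟨g4, g5, g6⟩ := mem_balList hc hp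
    exact ⟨p, g4, q, h4, g5, h5, g6, h6, hB.1.symm g4 hy.1, Compat.symm h4 g4 hm.1, h1, hB.2, hm.2,
      h3, h2⟩

lemma exists_fun_on_cycle {V St : Type} {n : ℕ → V} {m : ℕ}
    (hn : ∀ i j, n i = n j ↔ i ≡ j [MOD m]) (F : ℕ → St) : ∃ f : V → St, ∀ i, f (n i) = F (i % m) := by
  classical
  refine ⟨fun v => if h : ∃ i, n i = v then F (h.choose % m) else F 0, fun i => ?_⟩
  have h : ∃ j, n j = n i := ⟨i, rfl⟩
  simp only [dif_pos h]
  exact congrArg F ((hn _ _).1 h.choose_spec)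

lemma forall_cycle {V St : Type} {n : ℕ → V} {m : ℕ} (hm : 0 < m)
    (hn : ∀ i j, n i = n j ↔ i ≡ j [MOD m]) {F : ℕ → St} {f : V → St}
    (hf : ∀ i, f (n i) = F (i % m)) {R : V → V → St → St → Prop}
    (h : ∀ i, i + 1 < m → R (n i) (n (i + 1)) (F i) (F (i + 1)))
    (h0 : R (n (m - 1)) (n 0) (F (m - 1)) (F 0)) (i : ℕ) :
    R (n i) (n (i + 1)) (f (n i)) (f (n (i + 1))) := by
  have hlt := Nat.mod_lt i hm
  have e1 : n i = n (i % m) := (hn _ _).2 (Nat.mod_modEq _ _).symm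
  have e2 : n (i + 1) = n (i % m + 1) := (hn _ _).2 ((Nat.mod_modEq _ _).symm.add_right 1)
  rw [hf, hf]
  by_cases hi : i % m + 1 < m
  · have : (i + 1) % m = i % m + 1 := by
      rw [Nat.add_mod, Nat.mod_eq_of_lt (show 1 < m by omega), Nat.mod_eq_of_lt hi]
    rw [e1, e2, this]
    exact h _ hi
  · have e3 : i % m = m - 1 := by omega
    have e4 : (i + 1) % m = 0 := by
      rw [← Nat.mod_add_mod, e3, Nat.sub_add_cancel hm, Nat.mod_self]
    have e5 : n (i + 1) = n 0 := by rw [hn, Nat.ModEq, e4, Nat.zero_mod]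
    rw [e1, e5, e3, e4]
    exact h0

namespace ColSystem

/-- The sign which the code `a` reads off a state. -/
def val (s : Fin 3 × Bool) (a : Bool × Bool) : Bool :=
  Bool.xor s.2 (if s.1 = 0 then a.1 else if s.1 = 1 then a.2 else Bool.xor a.1 a.2)

lemma exists_code : ∀ s t : Fin 3 × Bool, s.1 ≠ t.1 → ∀ b c, ∃ a, val s a = b ∧ val t a = c := by
  decide

/-- The state with first component `i` from which `a` reads off `b`. -/
def stateOf (a : Bool × Bool) (i : Fin 3) (b : Bool) : Fin 3 × Bool := (i, Bool.xor b (val (i, false) a))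

lemma val_stateOf (a : Bool × Bool) (i : Fin 3) (b : Bool) : val (stateOf a i b) a = b := by
  simp only [val, stateOf]
  cases b <;> simp

lemma stateOf_val (a : Bool × Bool) (s : Fin 3 × Bool) : stateOf a s.1 (val s a) = s := by
  obtain ⟨i, b⟩ := s
  simp only [val, stateOf]
  cases b <;> simp

lemma exists_third : ∀ i j : Fin 3, ∃ k, k ≠ i ∧ k ≠ j := by decide

/-- Every vertex of `W` chooses a code which reads off the signs of the edges to `X` from the states
of its neighbours; adjacent vertices of `X` carry independent states. -/
def signSystem {V : Type} (σ : Sym2 V → Bool) (X W : Set V) (hXW : ∀ x ∈ X, x ∉ W) :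
    ColSystem V (Fin 3 × Bool) where
  X := X
  W := W
  real _ _ := False
  ok _ _ s t := s.1 ≠ t.1
  strict _ _ _ _ := True
  Pol w N f := ∃ a, ∀ z ∈ N, val (f z) a = σ s(w, z)
  disj := hXW
  real_symm _ _ h := h
  ok_symm _ _ _ _ h := h.symm
  pol_congr w N f g h := fun ⟨a, ha⟩ => ⟨a, fun z hz => by rw [← h z hz]; exact ha z hz⟩
  pol_triv w N f h := by
    rcases N.eq_empty_or_nonempty with rfl | ⟨z, hz⟩
    · exact ⟨(false, false), fun z hz => hz.elim⟩
    · obtain ⟨k, hk, -⟩ := exists_third (f z).1 (f z).1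
      obtain ⟨a, ha, -⟩ := exists_code (f z) (k, false) hk.symm (σ s(w, z)) false
      refine ⟨a, fun y hy => ?_⟩
      rw [h hy hz]
      exact ha
  init _ _ _ := ⟨(0, false), (1, false), by decide⟩
  child u a x s t _ _ _ _ := by
    obtain ⟨k, h1, h2⟩ := exists_third s.1 t.1
    exact ⟨(k, false), h1.symm, h2.symm, trivial, trivial, fun h => (h trivial).elim⟩
  poly w _ n m hm hn s t hst := by
    obtain ⟨k, hk1, hk2⟩ := exists_third s.1 t.1
    obtain ⟨a, ha1, ha2⟩ := exists_code s t hst (σ s(w, n 0)) (σ s(w, n 1))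
    set c : ℕ → Fin 3 := fun i => if i + 1 = m ∧ i % 2 = 0 then k else if i % 2 = 0 then s.1 else t.1
      with hc
    obtain ⟨f, hf⟩ := exists_fun_on_cycle hn fun i => stateOf a (c i) (σ s(w, n i))
    have hv : ∀ i, val (f (n i)) a = σ s(w, n i) := by
      intro i
      rw [hf, val_stateOf, (hn _ _).2 (Nat.mod_modEq i m)]
    refine ⟨f, ?_, ?_, ?_, fun _ => ⟨trivial, trivial⟩, fun _ _ h => (h trivial).elim, a, ?_⟩
    · have : c 0 = s.1 := by
        simp only [hc]
        rw [if_neg (by omega), if_pos (by decide)]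
      rw [hf, Nat.zero_mod, this, ← ha1, stateOf_val]
    · have : c 1 = t.1 := by
        simp only [hc]
        rw [if_neg (by omega), if_neg (by decide)]
      rw [hf, Nat.mod_eq_of_lt (by omega), this, ← ha2, stateOf_val]
    · refine fun i => forall_cycle (F := fun i => stateOf a (c i) (σ s(w, n i)))
        (R := fun _ _ s t => s.1 ≠ t.1) (by omega) hn hf ?_ ?_ i
      · intro i hi
        change c i ≠ c (i + 1)
        simp only [hc]
        have h1 : ¬ (i + 1 = m ∧ i % 2 = 0) := by omega
        rw [if_neg h1]
        rcases Nat.mod_two_eq_zero_or_one i with h | h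
        · rw [if_pos h, if_neg (by omega), if_neg (by omega)]
          exact hst
        · rw [if_neg (by omega), if_pos (show (i + 1) % 2 = 0 by omega)]
          split_ifs
          exacts [hk2.symm, hst.symm]
      · change c (m - 1) ≠ c 0
        simp only [hc]
        rw [if_neg (show ¬ (0 + 1 = m ∧ _) by omega), if_pos trivial]
        split_ifs
        · exact hk1
        · omega
        · exact hst.symm
    · rintro _ ⟨i, rfl⟩
      exact hv i

end ColSystem

/-- The colours of sign `b` under `τ` are numerous enough to avoid `r` and one of `c₁`, `c₂`. -/
def IsRich (τ : ℕ → Option Bool) (c₁ c₂ : ℕ) : Prop :=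
  ∀ b r l, l = c₁ ∨ l = c₂ → ∃ c < 6, τ c = some b ∧ c ≠ r ∧ c ≠ l

lemma isRich_of {τ : ℕ → Option Bool} {c₁ c₂ : ℕ}
    (h : ∀ b, ∃ x y z, (x < 6 ∧ y < 6 ∧ z < 6) ∧ (τ x = some b ∧ τ y = some b ∧ τ z = some b) ∧ x ≠ y ∧
      (z ≠ x ∧ z ≠ y ∨ (x ≠ c₁ ∧ x ≠ c₂) ∧ y ≠ c₁ ∧ y ≠ c₂)) : IsRich τ c₁ c₂ := by
  intro b r l hl
  obtain ⟨x, y, z, ⟨hx, hy, hz⟩, ⟨tx, ty, tz⟩, hxy, h⟩ := h b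
  by_cases h1 : x ≠ r ∧ x ≠ l
  · exact ⟨x, hx, tx, h1⟩
  by_cases h2 : y ≠ r ∧ y ≠ l
  · exact ⟨y, hy, ty, h2⟩
  refine ⟨z, hz, tz, ?_⟩
  omega

/-- The index form of `IsRich` for six colours with signs `v`. -/
abbrev RichIndex (v : Fin 6 → Option Bool) (p q : Fin 6) : Prop :=
  ∀ b, ∃ i j k, (v i = some b ∧ v j = some b ∧ v k = some b) ∧ i ≠ j ∧
    (k ≠ i ∧ k ≠ j ∨ (i ≠ p ∧ i ≠ q) ∧ j ≠ p ∧ j ≠ q)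

lemma RichIndex.isRich {v : Fin 6 → Option Bool} {p q : Fin 6} (h : RichIndex v p q) {u : Fin 6 → ℕ}
    (hu : u.Injective) (hu6 : ∀ i, u i < 6) : IsRich (Function.extend u v fun _ => none) (u p) (u q) := by
  refine isRich_of fun b => ?_
  obtain ⟨i, j, k, hv, hij, h⟩ := h b
  refine ⟨u i, u j, u k, ⟨hu6 i, hu6 j, hu6 k⟩, ?_, hu.ne hij, ?_⟩
  · rwa [hu.extend_apply, hu.extend_apply, hu.extend_apply]
  · rwa [hu.ne_iff, hu.ne_iff, hu.ne_iff, hu.ne_iff, hu.ne_iff, hu.ne_iff]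

lemma exists_richIndex : ∀ e₀ e₁ e₂ e₃ : Bool, ∃ a b : Bool,
    RichIndex ![some e₀, some e₁, some e₂, some e₃, some a, some b] 1 2 := by
  decide +kernel

lemma exists_richIndex' : ∀ (e₀ : Option Bool) (e₂ e₃ : Bool), ∃ a b c : Bool,
    RichIndex ![e₀, some a, some e₂, some e₃, some b, some c] 0 2 := by
  decide +kernel

lemma injective_six {c₀ c₁ c₂ c₃ c₄ c₅ : ℕ} (h : [c₀, c₁, c₂, c₃, c₄, c₅].Nodup) :
    Function.Injective ![c₀, c₁, c₂, c₃, c₄, c₅] := by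
  have := List.nodup_ofFn.1 (show (List.ofFn ![c₀, c₁, c₂, c₃, c₄, c₅]).Nodup by simpa using h)
  exact this

/-- The signs `e i` of four colours `c i` extend to a partition of all colours with two large
classes; if `c₀ = c₁` and these colours receive different signs then this colour is left out. -/
lemma exists_rich {c₀ c₁ c₂ c₃ : ℕ} (h₀ : c₀ < 6) (h₁ : c₁ < 6) (h₂ : c₂ < 6) (h₃ : c₃ < 6)
    (h₂₃ : c₂ ≠ c₃) (h₂₀ : c₂ ≠ c₀) (h₂₁ : c₂ ≠ c₁) (h₃₀ : c₃ ≠ c₀) (h₃₁ : c₃ ≠ c₁) (e₀ e₁ e₂ e₃ : Bool) :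
    ∃ τ : ℕ → Option Bool, IsRich τ c₁ c₂ ∧ τ c₂ = some e₂ ∧ τ c₃ = some e₃ ∧
      (c₀ ≠ c₁ ∨ e₀ = e₁ → τ c₀ = some e₀ ∧ τ c₁ = some e₁) ∧ (c₀ = c₁ ∧ e₀ ≠ e₁ → τ c₀ = none) := by
  have hx : ∀ u v w : ℕ, ∃ x < 6, x ≠ c₂ ∧ x ≠ c₃ ∧ x ≠ u ∧ x ≠ v ∧ x ≠ w := by
    intro u v w
    by_contra! h
    have h0 := h 0 (by norm_num)
    have h1 := h 1 (by norm_num)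
    have h2 := h 2 (by norm_num)
    have h3 := h 3 (by norm_num)
    have h4 := h 4 (by norm_num)
    have h5 := h 5 (by norm_num)
    omega
  obtain ⟨x, hx6, x2, x3, x0, x1, -⟩ := hx c₀ c₁ c₁
  obtain ⟨y, hy6, y2, y3, y0, y1, yx⟩ := hx c₀ c₁ x
  by_cases h01 : c₀ = c₁
  · subst h01
    obtain ⟨z, hz6, z2, z3, z0, zx, zy⟩ := hx c₀ x y
    obtain ⟨a, b, c, hr⟩ := exists_richIndex' (if e₀ = e₁ then some e₀ else none) e₂ e₃
    have hu : Function.Injective ![c₀, z, c₂, c₃, x, y] := injective_six (by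
      simp only [List.nodup_cons, List.mem_cons, List.not_mem_nil, or_false, not_or,
        not_false_eq_true, List.nodup_nil, and_true]
      omega)
    have hu6 : ∀ i, ![c₀, z, c₂, c₃, x, y] i < 6 := by
      intro i
      fin_cases i <;> assumption
    refine ⟨_, hr.isRich hu hu6, hu.extend_apply _ _ 2, hu.extend_apply _ _ 3, ?_, ?_⟩
    · rintro (h | h)
      · exact (h rfl).elim
      · subst h
        exact ⟨(hu.extend_apply _ _ 0).trans (if_pos rfl), (hu.extend_apply _ _ 0).trans (if_pos rfl)⟩
    · rintro ⟨-, h⟩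
      exact (hu.extend_apply _ _ 0).trans (if_neg h)
  · obtain ⟨a, b, hr⟩ := exists_richIndex e₀ e₁ e₂ e₃
    have hu : Function.Injective ![c₀, c₁, c₂, c₃, x, y] := injective_six (by
      simp only [List.nodup_cons, List.mem_cons, List.not_mem_nil, or_false, not_or,
        not_false_eq_true, List.nodup_nil, and_true]
      omega)
    have hu6 : ∀ i, ![c₀, c₁, c₂, c₃, x, y] i < 6 := by
      intro i
      fin_cases i <;> assumption
    exact ⟨_, hr.isRich hu hu6, hu.extend_apply _ _ 2, hu.extend_apply _ _ 3,
      fun _ => ⟨hu.extend_apply _ _ 0, hu.extend_apply _ _ 1⟩, fun h => (h01 h.1).elim⟩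

lemma exists_backward {α : Type} {Q : ℕ → α → α → α → Prop} (h : ∀ i a b, ∃ c, Q i c a b) (k : ℕ) (x y : α) :
    ∃ C : ℕ → α, C k = x ∧ C (k + 1) = y ∧ ∀ i < k, Q i (C i) (C (i + 1)) (C (i + 2)) := by
  induction k generalizing x y with
  | zero => exact ⟨fun i => if i = 0 then x else y, by simp, by simp, by simp⟩
  | succ k ih =>
    obtain ⟨c, hc⟩ := h k x y
    obtain ⟨C, h1, h2, h3⟩ := ih c x
    refine ⟨fun i => if i = k + 2 then y else C i, by simpa using h2, by simp, ?_⟩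
    intro i hi
    simp only
    rw [if_neg (by omega), if_neg (by omega)]
    by_cases hik : i = k
    · subst hik
      rwa [if_pos rfl, h1, h2]
    · rw [if_neg (by omega)]
      exact h3 i (by omega)

lemma exists_forward {α : Type} {I : ℕ → α → Prop} {R : ℕ → α → α → Prop} (k : ℕ)
    (h : ∀ i < k, ∀ a, I i a → ∃ b, I (i + 1) b ∧ R i a b) {x : α} (hx : I 0 x) :
    ∃ P : ℕ → α, P 0 = x ∧ (∀ i ≤ k, I i (P i)) ∧ ∀ i < k, R i (P i) (P (i + 1)) := by
  induction k with
  | zero => exact ⟨fun _ => x, rfl, fun i hi => by obtain rfl : i = 0 := by omega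
                                                   exact hx, by simp⟩
  | succ k ih =>
    obtain ⟨P, h1, h2, h3⟩ := ih fun i hi => h i (by omega)
    obtain ⟨b, hb, hR⟩ := h k (by omega) _ (h2 k le_rfl)
    refine ⟨fun i => if i = k + 1 then b else P i, by simpa using h1, fun i hi => ?_, fun i hi => ?_⟩
    · simp only
      split_ifs with he
      · exact he ▸ hb
      · exact h2 i (by omega)
    · simp only
      rw [if_neg (by omega)]
      split_ifs with he
      · obtain rfl : i = k := by omega
        exact hR
      · exact h3 i (by omega)

/-- The colours along a polygon: `C 0, C 1, C 2, C k` are given, all other colours have prescribed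
signs. -/
lemma exists_colour_sequence {k : ℕ} (hk : 3 ≤ k) (ρ : ℕ → Option Bool) (δ : ℕ → Bool)
    {c₀ c₁ c₂ c₃ : ℕ} {τ : ℕ → Option Bool} (hτ : IsRich τ c₁ c₂)
    (h₀ : c₀ < 6) (h₁ : c₁ < 6) (h₂ : c₂ < 6) (h₃ : c₃ < 6)
    (h₂₃ : c₂ ≠ c₃) (h₂₀ : c₂ ≠ c₀) (h₂₁ : c₂ ≠ c₁) (h₃₀ : c₃ ≠ c₀) (h₃₁ : c₃ ≠ c₁) :
    ∃ C : ℕ → ℕ, C 0 = c₀ ∧ C 1 = c₁ ∧ C 2 = c₂ ∧ C k = c₃ ∧ C (k + 1) = c₀ ∧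
      (∀ i ≤ k, C i < 6) ∧ (∀ i, 3 ≤ i → i < k → τ (C i) = some (δ i)) ∧
      (∀ i, 1 ≤ i → i ≤ k → ρ i = none → C i ≠ C (i + 1)) ∧
      (∀ i, 1 ≤ i → i < k → ρ i ≠ none → ρ (i + 1) ≠ none → C i ≠ C (i + 2)) := by
  obtain ⟨D, hD1, hD2, hD⟩ := exists_backward
    (Q := fun i c a b => c < 6 ∧ τ c = some (δ i) ∧ c ≠ (if ρ i = none then a else b) ∧
      c ≠ (if i = 3 ∧ ρ 2 ≠ none then c₁ else c₂))
    (fun i a b => hτ _ _ _ (by split_ifs <;> simp)) k c₃ c₀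
  set C : ℕ → ℕ := fun i => if i = 0 then c₀ else if i = 1 then c₁ else if i = 2 then c₂ else D i with hC
  have e0 : C 0 = c₀ := rfl
  have e1 : C 1 = c₁ := rfl
  have e2 : C 2 = c₂ := rfl
  have e3 : ∀ i, 3 ≤ i → C i = D i := by
    intro i hi
    simp only [hC]
    rw [if_neg (by omega), if_neg (by omega), if_neg (by omega)]
  have e4 : C k = c₃ := (e3 k hk).trans hD1
  have e5 : C (k + 1) = c₀ := (e3 _ (by omega)).trans hD2
  have hC6 : ∀ i, 3 ≤ i → i < k → C i < 6 ∧ τ (C i) = some (δ i) ∧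
      C i ≠ (if ρ i = none then C (i + 1) else C (i + 2)) ∧
      C i ≠ (if i = 3 ∧ ρ 2 ≠ none then c₁ else c₂) := by
    intro i hi hik
    rw [e3 i hi, e3 _ (by omega), e3 _ (by omega)]
    exact hD i hik
  refine ⟨C, e0, e1, e2, e4, e5, ?_, fun i hi hik => (hC6 i hi hik).2.1, ?_, ?_⟩
  · intro i hi
    by_cases h : 3 ≤ i
    · by_cases hik : i = k
      · rw [hik, e4]
        exact h₃
      · exact (hC6 i h (by omega)).1
    · interval_cases i
      exacts [h₀, h₁, h₂]
  · intro i hi hik hρ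
    by_cases h : i = k
    · rw [h, e4, e5]
      exact h₃₀
    by_cases h3 : 3 ≤ i
    · have := (hC6 i h3 (by omega)).2.2.1
      rwa [if_pos hρ] at this
    · interval_cases i
      · rw [e1, e2]
        exact h₂₁.symm
      · by_cases hk3 : k = 3
        · rw [show 2 + 1 = k by omega, e2, e4]
          exact h₂₃
        · have := (hC6 3 le_rfl (by omega)).2.2.2
          rw [if_neg (fun h => h.2 hρ)] at this
          exact this.symm
  · intro i hi hik hρ hρ'
    by_cases h3 : 3 ≤ i
    · have := (hC6 i h3 (by omega)).2.2.1
      rwa [if_neg hρ] at this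
    · interval_cases i
      · by_cases hk3 : k = 3
        · rw [show 1 + 2 = k by omega, e1, e4]
          exact h₃₁.symm
        · have := (hC6 3 le_rfl (by omega)).2.2.2
          rw [if_pos ⟨rfl, hρ'⟩] at this
          exact this.symm
      · by_cases hk3 : k = 3
        · rw [show 2 + 2 = k + 1 by omega, e2, e5]
          exact h₂₀
        by_cases hk4 : k = 4
        · rw [show 2 + 2 = k by omega, e2, e4]
          exact h₂₃
        · have := (hC6 4 (by omega) (by omega)).2.2.2
          rw [if_neg (by omega)] at this
          exact this.symm

/-- The sign required at the previous colour. -/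
def signL (ρ : ℕ → Option Bool) (j : ℕ) : Bool := (ρ j).getD ((ρ (j + 1)).getD true)

/-- The sign required at the next colour. -/
def signR (ρ : ℕ → Option Bool) (j : ℕ) : Bool := (ρ (j + 1)).getD ((ρ j).getD true)

lemma signL_of {ρ : ℕ → Option Bool} {j : ℕ} {r : Bool} (h : ρ j = some r) : signL ρ j = r := by
  simp [signL, h]

lemma signR_of {ρ : ℕ → Option Bool} {j : ℕ} {r : Bool} (h : ρ (j + 1) = some r) : signR ρ j = r := by
  simp [signR, h]

lemma signL_eq_signR {ρ : ℕ → Option Bool} {j : ℕ} (h : ρ j = none ∨ ρ (j + 1) = none) :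
    signL ρ j = signR ρ j := by
  unfold signL signR
  rcases h with h | h
  · rw [h]
    cases ρ (j + 1) <;> rfl
  · rw [h]
    cases ρ j <;> rfl

lemma Source.of_sequence {ρ : ℕ → Option Bool} {C : ℕ → ℕ} {j y : ℕ} (hy : y < 480) (hyC : y / 80 = C j)
    (hb : C j = C (j + 1) → IsBalanced y)
    (h : ρ j ≠ none → ρ (j + 1) ≠ none → C j ≠ C (j + 2)) :
    Source y (C (j + 1)) (C (j + 2)) (signL ρ j) (signR ρ j) := by
  refine ⟨hy, fun h => hb (hyC.symm.trans h), fun he => signL_eq_signR ?_⟩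
  by_contra! hcon
  exact h hcon.1 hcon.2 (hyC.symm.trans he)

/-- A link which is strict on both sides. -/
def StrictLink (a b : ℕ) : Option Bool → Prop
  | some r => HasSign a r (b / 80) ∧ HasSign b r (a / 80)
  | none => a / 80 ≠ b / 80

lemma StrictLink.of {a b : ℕ} {r : Option Bool}
    (h : ∀ b', r = some b' → HasSign a b' (b / 80) ∧ HasSign b b' (a / 80))
    (h' : r = none → a / 80 ≠ b / 80) : StrictLink a b r := by
  rcases r with _ | r
  · exact h' rfl
  · exact h r rfl

lemma exists_state_sequence {k s t : ℕ} (hs : s < 480) (ht : t < 480) {ρ : ℕ → Option Bool} {C : ℕ → ℕ}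
    (h0 : C (k + 4) = s / 80) (h1 : C 1 = t / 80) (hC : ∀ i ≤ k + 3, C i < 6)
    (h12 : C 1 ≠ C 2) (hk0 : C (k + 3) ≠ C (k + 4))
    (hn : ∀ i, 1 ≤ i → i ≤ k + 3 → ρ i = none → C i ≠ C (i + 1))
    (hr : ∀ i, 1 ≤ i → i < k + 3 → ρ i ≠ none → ρ (i + 1) ≠ none → C i ≠ C (i + 2))
    (hρ1 : ∀ r, ρ 1 = some r → HasSign t r (C 2))
    (hρ2 : ∀ r, ρ (k + 3) = some r → HasSign s r (C (k + 3))) :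
    ∃ P : ℕ → ℕ, P 0 = s ∧ P 1 = t ∧ (∀ i ≤ k + 3, P i < 480) ∧
      (∀ i, 1 ≤ i → i ≤ k + 3 → P i / 80 = C i) ∧
      (∀ i, 1 ≤ i → i < k + 3 → Compat (P i) (P (i + 1)) ∧ StrictLink (P i) (P (i + 1)) (ρ i)) ∧
      Compat (P (k + 3)) s ∧ StrictLink (P (k + 3)) s (ρ (k + 3)) := by
  obtain ⟨P, hP0, hP1, hP2⟩ := exists_forward (x := t)
    (I := fun i p => p < 480 ∧ p / 80 = C (i + 1) ∧ (1 ≤ i → IsBalanced p) ∧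
      ∀ r, ρ (i + 1) = some r → HasSign p r (C (i + 2)))
    (R := fun i p q => Compat p q ∧ ∀ r, ρ (i + 1) = some r → HasSign q r (C (i + 1))) k
    (by
      rintro i hi p ⟨hp, hpC, hpb, hpr⟩
      have hsrc : Source p (C (i + 1 + 1)) (C (i + 1 + 2)) (signL ρ (i + 1)) (signR ρ (i + 1)) := by
        refine Source.of_sequence hp hpC (fun h => hpb ?_) (hr _ (by omega) (by omega))
        by_contra hi0
        obtain rfl : i = 0 := by omega
        exact h12 h
      obtain ⟨q, hq, hqC, hqb, hpq, hqL, hqR⟩ :=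
        exists_extend (hC _ (by omega)) (hC _ (by omega)) hsrc
      refine ⟨q, ⟨hq, hqC, fun _ => hqb, fun r hr => ?_⟩, hpq, fun r hr => ?_⟩
      · rw [signR_of hr] at hqR
        exact hqR
      · rw [signL_of hr, hpC] at hqL
        exact hqL)
    ⟨ht, h1.symm, fun h => absurd h (by omega), hρ1⟩
  obtain ⟨hy, hyC, hyb, hyr⟩ := hP1 k le_rfl
  have hsrc : Source (P k) (C (k + 2)) (C (k + 3)) (signL ρ (k + 1)) (signR ρ (k + 1)) := by
    refine Source.of_sequence hy hyC (fun h => hyb ?_) (hr _ (by omega) (by omega))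
    by_contra hk
    obtain rfl : k = 0 := by omega
    exact h12 h
  have hsrc' : Source s (C (k + 3)) (C (k + 2)) (signR ρ (k + 2)) (signL ρ (k + 2)) := by
    refine ⟨hs, fun h => (hk0 (by rw [h0, h])).elim, fun h => (signL_eq_signR ?_).symm⟩
    by_contra! hcon
    exact hr (k + 2) (by omega) (by omega) hcon.1 hcon.2 (h.symm.trans h0.symm)
  obtain ⟨p, hp, q, hq, hpC, hqC, -, -, c1, c2, c3, s1, s2, s3, s4⟩ :=
    exists_close (hC _ (by omega)) (hC _ (by omega)) hsrc hsrc'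
  set S : ℕ → ℕ := fun i => if i = 0 then s else if i = k + 2 then p else if i = k + 3 then q else
    P (i - 1) with hS
  have e0 : S 0 = s := rfl
  have e2 : S (k + 2) = p := by simp [hS]
  have e3 : S (k + 3) = q := by simp [hS]
  have e1 : ∀ i ≤ k, S (i + 1) = P i := by
    intro i hi
    simp only [hS]
    rw [if_neg (by omega), if_neg (by omega), if_neg (by omega), Nat.add_sub_cancel]
  have hcol : ∀ i, 1 ≤ i → i ≤ k + 3 → S i / 80 = C i := by
    intro i hi hik
    by_cases h3 : i = k + 3
    · rw [h3, e3, hqC]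
    by_cases h2 : i = k + 2
    · rw [h2, e2, hpC]
    obtain ⟨j, rfl⟩ : ∃ j, i = j + 1 := ⟨i - 1, by omega⟩
    rw [e1 j (by omega)]
    exact (hP1 j (by omega)).2.1
  have hlink : ∀ i, 1 ≤ i → i < k + 3 → Compat (S i) (S (i + 1)) ∧ ∀ r, ρ i = some r →
      HasSign (S i) r (C (i + 1)) ∧ HasSign (S (i + 1)) r (C i) := by
    intro i hi hik
    by_cases h2 : i = k + 2
    · subst h2
      rw [e2, e3]
      refine ⟨c2, fun r hr => ?_⟩
      rw [signL_of hr] at s3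
      rw [signR_of hr] at s2
      exact ⟨s2, s3⟩
    by_cases h1' : i = k + 1
    · subst h1'
      rw [e2, e1 k le_rfl]
      refine ⟨c1, fun r hr => ⟨hyr r hr, ?_⟩⟩
      rw [signL_of hr, hyC] at s1
      exact s1
    obtain ⟨j, rfl⟩ : ∃ j, i = j + 1 := ⟨i - 1, by omega⟩
    rw [e1 j (by omega), e1 (j + 1) (by omega)]
    exact ⟨(hP2 j (by omega)).1, fun r hr => ⟨(hP1 j (by omega)).2.2.2 r hr, (hP2 j (by omega)).2 r hr⟩⟩
  refine ⟨S, e0, (e1 0 (by omega)).trans hP0, ?_, hcol, ?_, ?_, ?_⟩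
  · intro i hik
    by_cases h3 : i = k + 3
    · rwa [h3, e3]
    by_cases h2 : i = k + 2
    · rwa [h2, e2]
    by_cases h0' : i = 0
    · rwa [h0', e0]
    obtain ⟨j, rfl⟩ : ∃ j, i = j + 1 := ⟨i - 1, by omega⟩
    rw [e1 j (by omega)]
    exact (hP1 j (by omega)).1
  · intro i hi hik
    refine ⟨(hlink i hi hik).1, StrictLink.of ?_ ?_⟩
    · rw [hcol i hi (by omega), hcol (i + 1) (by omega) (by omega)]
      exact (hlink i hi hik).2
    · rw [hcol i hi (by omega), hcol (i + 1) (by omega) (by omega)]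
      exact hn i hi (by omega)
  · rw [e3]
    exact c3
  · rw [e3]
    refine StrictLink.of (fun r hr => ?_) (fun h => ?_)
    · rw [signR_of (j := k + 2) hr] at s4
      refine ⟨s4, ?_⟩
      rw [hqC]
      exact hρ2 r hr
    · rw [hqC, ← h0]
      exact hn _ (by omega) le_rfl h

/-- The relation imposed on the states at the ends of an edge of sign `r`, or of a virtual edge. -/
def OkLink (a b : ℕ) : Option Bool → Prop
  | some r => ¬ HasSign a (!r) (b / 80) ∧ ¬ HasSign b (!r) (a / 80)
  | none => a / 80 ≠ b / 80

lemma OkLink.symm {a b : ℕ} {r : Option Bool} (h : OkLink a b r) : OkLink b a r := by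
  rcases r with _ | r
  · exact Ne.symm h
  · exact ⟨h.2, h.1⟩

lemma Link.okLink {a b : ℕ} {r : Option Bool} (hb : b < 480) (h : Link a b r) : OkLink a b r := by
  rcases r with _ | r
  · exact h
  · exact ⟨h.1.not_not (by omega), h.2⟩

lemma StrictLink.okLink {a b : ℕ} {r : Option Bool} (ha : a < 480) (hb : b < 480)
    (h : StrictLink a b r) : OkLink a b r := by
  rcases r with _ | r
  · exact h
  · exact ⟨h.1.not_not (by omega), h.2.not_not (by omega)⟩

lemma StrictLink.symm {a b : ℕ} {r : Option Bool} (h : StrictLink a b r) : StrictLink b a r := by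
  rcases r with _ | r
  · exact Ne.symm h
  · exact ⟨h.2, h.1⟩

lemma Link.left {a b : ℕ} {r : Bool} (h : Link a b (some r)) : HasSign a r (b / 80) := h.1

lemma StrictLink.left {a b : ℕ} {r : Bool} (h : StrictLink a b (some r)) : HasSign a r (b / 80) := h.1

section

variable {V : Type} (G : SimpleGraph V) (σ : Sym2 V → Bool)

open Classical in
/-- The sign of the edge `xy`, if there is one. -/
noncomputable def edgeSign (x y : V) : Option Bool := if G.Adj x y then some (σ s(x, y)) else none

variable {G σ}

lemma edgeSign_symm (x y : V) : edgeSign G σ x y = edgeSign G σ y x := by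
  unfold edgeSign
  by_cases h : G.Adj x y
  · rw [if_pos h, if_pos h.symm, Sym2.eq_swap]
  · rw [if_neg h, if_neg fun h' => h h'.symm]

lemma edgeSign_of_adj {x y : V} (h : G.Adj x y) : edgeSign G σ x y = some (σ s(x, y)) := if_pos h

lemma adj_of_edgeSign {x y : V} (h : edgeSign G σ x y ≠ none) : G.Adj x y := by
  by_contra h'
  exact h (if_neg h')

variable (G σ)

/-- Admissible states at `x` and `y`. -/
def OkAt (x y : V) (s t : ℕ) : Prop := Compat s t ∧ OkLink s t (edgeSign G σ x y)

/-- The state `s` of `x` has the sign of the edge `xy` at the colour of `t`. -/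
def StrictAt (x y : V) (s t : ℕ) : Prop := ∀ r, edgeSign G σ x y = some r → HasSign s r (t / 80)

/-- Nonadjacent vertices of `N` with states of the same colour are joined to `w` by edges of the same
sign. -/
def PolAt (w : V) (N : Set V) (f : V → ℕ) : Prop :=
  ∀ y ∈ N, ∀ z ∈ N, y ≠ z → ¬ G.Adj y z → f y / 80 = f z / 80 → σ s(w, y) = σ s(w, z)

variable {G σ}

lemma OkAt.symm {x y : V} {s t : ℕ} (hs : s < 480) (ht : t < 480) (h : OkAt G σ x y s t) :
    OkAt G σ y x t s := by
  refine ⟨h.1.symm hs ht, ?_⟩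
  rw [edgeSign_symm]
  exact h.2.symm

lemma OkAt.adj {x y : V} {s t : ℕ} (h : OkAt G σ x y s t) (he : s / 80 = t / 80) : G.Adj x y := by
  refine adj_of_edgeSign (σ := σ) fun hn => ?_
  have h2 := h.2
  rw [hn] at h2
  exact h2 he

lemma exists_init (x y : V) : ∃ s < 480, ∃ t < 480, OkAt G σ x y s t := by
  have key : ∀ r : Bool, ∃ t < 480, Compat 0 t ∧ t / 80 ≠ 0 ∧ HasSign 0 r (t / 80) ∧ HasSign t r 0 := by
    intro r
    have hb : IsBalanced 0 := (testBit_balanced (by norm_num)).2 (by norm_num)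
    have ht : HasSign 0 true 1 := by
      unfold HasSign
      decide +kernel
    have hf : HasSign 0 false 3 := by
      unfold HasSign
      decide +kernel
    cases r
    · obtain ⟨t, h1, h2, -, h4, h5, -⟩ := exists_extend (y := 0) (c := 3) (d := 0) (s := false)
        (t := false) (by norm_num) (by norm_num) ⟨by norm_num, fun _ => hb, fun _ => rfl⟩
      exact ⟨t, h1, h4, by omega, h2 ▸ hf, h5⟩
    · obtain ⟨t, h1, h2, -, h4, h5, -⟩ := exists_extend (y := 0) (c := 1) (d := 0) (s := true)
        (t := true) (by norm_num) (by norm_num) ⟨by norm_num, fun _ => hb, fun _ => rfl⟩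
      exact ⟨t, h1, h4, by omega, h2 ▸ ht, h5⟩
  rcases he : edgeSign G σ x y with _ | r
  · obtain ⟨t, h1, h2, h3, -⟩ := key true
    refine ⟨0, by norm_num, t, h1, h2, ?_⟩
    rw [he]
    exact fun h => h3 h.symm
  · obtain ⟨t, h1, h2, h3, h4, h5⟩ := key r
    refine ⟨0, by norm_num, t, h1, h2, ?_⟩
    rw [he]
    exact ⟨h4.not_not (by omega), h5.not_not (by norm_num)⟩

lemma exists_child_at (u a x : V) {s t : ℕ} (hs : s < 480) (ht : t < 480) (h : OkAt G σ u a s t) :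
    ∃ p < 480, OkAt G σ u x s p ∧ OkAt G σ a x t p ∧ StrictAt G σ u x s p ∧ StrictAt G σ a x t p ∧
      (¬ StrictAt G σ x u p s → ¬ StrictAt G σ x a p t → G.Adj u a) := by
  obtain ⟨p, hp, c1, c2, l1, l2⟩ := exists_child hs ht h.1 (edgeSign G σ u x) (edgeSign G σ a x)
  refine ⟨p, hp, ⟨c1, l1.okLink hp⟩, ⟨c2, l2.okLink hp⟩, ?_, ?_, ?_⟩
  · intro r hr
    rw [hr] at l1
    exact l1.left
  · intro r hr
    rw [hr] at l2
    exact l2.left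
  · have key : ∀ (v : V) (q : ℕ), Link q p (edgeSign G σ v x) → ¬ StrictAt G σ x v p q →
        ¬ (HasSign p true (q / 80) ∨ HasSign p false (q / 80)) := by
      intro v q hl hn
      unfold StrictAt at hn
      push Not at hn
      obtain ⟨r, hr, hn⟩ := hn
      rw [edgeSign_symm, hr] at hl
      have h2 : ¬ HasSign p (!r) (q / 80) := hl.2
      cases r
      · exact fun h => h.elim h2 hn
      · exact fun h => h.elim hn h2
    intro h1 h2
    refine h.adj (by_contra fun hne => ?_)
    rcases hasSign_or hp (show s / 80 < 6 by omega) (show t / 80 < 6 by omega) hne with h3 | h3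
    exacts [key u s l1 h1 h3, key a t l2 h2 h3]

end

section

variable {V : Type} {G : SimpleGraph V} {σ : Sym2 V → Bool}

/-- The conclusion of the polygon extension for states given by a sequence. -/
structure PolygonStates (G : SimpleGraph V) (σ : Sym2 V → Bool) (w : V) (n : ℕ → V) (m s t : ℕ)
    (P : ℕ → ℕ) : Prop where
  zero : P 0 = s
  one : P 1 = t
  lt : ∀ i < m, P i < 480
  ok : ∀ i, i + 1 < m → OkAt G σ (n i) (n (i + 1)) (P i) (P (i + 1))
  last : OkAt G σ (n (m - 1)) (n 0) (P (m - 1)) (P 0)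
  strict : 3 ≤ m → StrictAt G σ (n 1) (n 2) t (P 2) ∧ StrictAt G σ (n 0) (n (m - 1)) s (P (m - 1))
  bot : ∀ i, i + 2 < m → ¬ StrictAt G σ (n (i + 2)) (n (i + 3)) (P (i + 2)) (P ((i + 3) % m)) →
    ¬ StrictAt G σ (n (i + 2)) (n (i + 1)) (P (i + 2)) (P (i + 1)) → G.Adj (n (i + 1)) (n (i + 3))
  pol : ∀ i < m, ∀ j < m, n i ≠ n j → ¬ G.Adj (n i) (n j) → P i / 80 = P j / 80 →
    σ s(w, n i) = σ s(w, n j)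

lemma exists_polygon_two (w : V) (n : ℕ → V) {s t : ℕ} (hs : s < 480) (ht : t < 480)
    (h : OkAt G σ (n 0) (n 1) s t) : ∃ P, PolygonStates G σ w n 2 s t P := by
  refine ⟨fun i => if i = 0 then s else t, rfl, rfl, ?_, ?_, h.symm hs ht, by simp, by simp, ?_⟩
  · intro i _
    split_ifs <;> assumption
  · intro i hi
    obtain rfl : i = 0 := by omega
    exact h
  · intro i hi j hj hij hA he
    interval_cases i <;> interval_cases j
    · exact (hij rfl).elim
    · exact (hA (h.adj he)).elim
    · exact (hA (h.adj he.symm).symm).elim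
    · exact (hij rfl).elim

lemma exists_polygon_three (w : V) (n : ℕ → V) (h3 : n 3 = n 0) {s t : ℕ} (hs : s < 480) (ht : t < 480)
    (h : OkAt G σ (n 0) (n 1) s t) : ∃ P, PolygonStates G σ w n 3 s t P := by
  obtain ⟨p, hp, o1, o2, t1, t2, hb⟩ := exists_child_at (n 0) (n 1) (n 2) hs ht h
  refine ⟨fun i => if i = 0 then s else if i = 1 then t else p, rfl, rfl, ?_, ?_, o1.symm hs hp,
    fun _ => ⟨t2, t1⟩, ?_, ?_⟩
  · intro i _
    split_ifs <;> assumption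
  · intro i hi
    have hi : i < 2 := by omega
    interval_cases i
    exacts [h, o2]
  · intro i hi
    obtain rfl : i = 0 := by omega
    intro h1 h2
    change ¬ StrictAt G σ (n 2) (n 3) p s at h1
    change ¬ StrictAt G σ (n 2) (n 1) p t at h2
    rw [h3] at h1
    change G.Adj (n 1) (n 3)
    rw [h3]
    exact (hb h1 h2).symm
  · intro i hi j hj hij hA he
    interval_cases i <;> interval_cases j
    · exact (hij rfl).elim
    · exact (hA (h.adj he)).elim
    · exact (hA (o1.adj he)).elim
    · exact (hA (h.adj he.symm).symm).elim
    · exact (hij rfl).elim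
    · exact (hA (o2.adj he)).elim
    · exact (hA (o1.adj he.symm).symm).elim
    · exact (hA (o2.adj he.symm).symm).elim
    · exact (hij rfl).elim

lemma StrictLink.strictAt {a b : ℕ} {x y : V} (h : StrictLink a b (edgeSign G σ x y)) :
    StrictAt G σ x y a b := by
  intro r hr
  rw [hr] at h
  exact h.left

lemma exists_polygon_large (w : V) (n : ℕ → V) (k : ℕ) (hk : n (k + 4) = n 0) {s t : ℕ} (hs : s < 480)
    (ht : t < 480) (h : OkAt G σ (n 0) (n 1) s t) : ∃ P, PolygonStates G σ w n (k + 4) s t P := by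
  set ρ : ℕ → Option Bool := fun i => edgeSign G σ (n i) (n (i + 1)) with hρ
  set δ : ℕ → Bool := fun i => σ s(w, n i) with hδ
  obtain ⟨c₂, hc2, c₃, hc3, h23, h2s, h3s, h2t, h3t, hs3, ht2⟩ :=
    exists_colours hs h.1 ((ρ 1).getD true) ((ρ (k + 3)).getD true)
  have h0 : s / 80 < 6 := by omega
  have h1 : t / 80 < 6 := by omega
  obtain ⟨τ, hτ, τ2, τ3, τe, τn⟩ := exists_rich h0 h1 hc2 hc3 h23 h2s h2t h3s h3t (δ 0) (δ 1) (δ 2)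
    (δ (k + 3))
  obtain ⟨C, C0, C1, C2, C3, C4, hC, hCτ, hCn, hCr⟩ := exists_colour_sequence (k := k + 3) (by omega) ρ δ
    hτ h0 h1 hc2 hc3 h23 h2s h2t h3s h3t
  obtain ⟨P, P0, P1, hP, hPC, hPl, hPk, hPk'⟩ := exists_state_sequence hs ht C4 C1 hC
    (by rw [C1, C2]; exact h2t.symm) (by rw [C3, C4]; exact h3s) hCn hCr
    (fun r hr => by rw [hr] at ht2; rw [C2]; exact ht2)
    (fun r hr => by rw [hr] at hs3; rw [C3]; exact hs3)
  have hlast : StrictLink (P (k + 3)) s (edgeSign G σ (n (k + 3)) (n 0)) := by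
    have := hPk'
    simp only [hρ] at this
    rwa [show k + 3 + 1 = k + 4 by rfl, hk] at this
  have hcol : ∀ i < k + 4, P i / 80 = C i := by
    intro i hi
    by_cases h0 : i = 0
    · rw [h0, P0, C0]
    · exact hPC i (by omega) (by omega)
  have hτ2 : ∀ i, 2 ≤ i → i < k + 4 → τ (C i) = some (δ i) := by
    intro i hi hik
    by_cases h2 : i = 2
    · rw [h2, C2, τ2]
    by_cases h3 : i = k + 3
    · rw [h3, C3, τ3]
    exact hCτ i (by omega) (by omega)
  refine ⟨P, P0, P1, fun i hi => hP i (by omega), ?_, ?_, ?_, ?_, ?_⟩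
  · intro i hi
    by_cases h0 : i = 0
    · subst h0
      rw [P0, P1]
      exact h
    · obtain ⟨h1, h2⟩ := hPl i (by omega) (by omega)
      exact ⟨h1, h2.okLink (hP i (by omega)) (hP (i + 1) (by omega))⟩
  · change OkAt G σ (n (k + 3)) (n 0) (P (k + 3)) (P 0)
    rw [P0]
    exact ⟨hPk, hlast.okLink (hP _ le_rfl) hs⟩
  · intro _
    refine ⟨?_, ?_⟩
    · rw [← P1]
      exact StrictLink.strictAt (hPl 1 le_rfl (by omega)).2
    · change StrictAt G σ (n 0) (n (k + 3)) s (P (k + 3))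
      refine StrictLink.strictAt ?_
      rw [edgeSign_symm]
      exact hlast.symm
  · intro i hi hn
    refine (hn ?_).elim
    by_cases hik : i + 3 = k + 4
    · obtain rfl : i = k + 1 := by omega
      rw [hik, Nat.mod_self, P0]
      change StrictAt G σ (n (k + 3)) (n (k + 4)) (P (k + 3)) s
      rw [hk]
      exact StrictLink.strictAt hlast
    · rw [Nat.mod_eq_of_lt (by omega)]
      exact StrictLink.strictAt (hPl (i + 2) (by omega) (by omega)).2
  · intro i hi j hj hij hA he
    rw [hcol i hi, hcol j hj] at he
    change δ i = δ j
    by_cases hc : s / 80 ≠ t / 80 ∨ δ 0 = δ 1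
    · obtain ⟨τ0, τ1⟩ := τe hc
      have key : ∀ i < k + 4, τ (C i) = some (δ i) := by
        intro i hi
        by_cases h2 : 2 ≤ i
        · exact hτ2 i h2 hi
        · have h2 : i < 2 := by omega
          interval_cases i
          · rw [C0, τ0]
          · rw [C1, τ1]
      have := key i hi
      rw [he, key j hj] at this
      exact (Option.some.inj this).symm
    · push Not at hc
      have τ0 := τn hc
      have hA01 : G.Adj (n 0) (n 1) := h.adj hc.1
      have key : ∀ i < 2, τ (C i) = none := by
        intro i h2
        interval_cases i
        · rw [C0, τ0]
        · rw [C1, ← hc.1, τ0]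
      by_cases h2 : 2 ≤ i
      · by_cases h2' : 2 ≤ j
        · have := hτ2 i h2 hi
          rw [he, hτ2 j h2' hj] at this
          exact (Option.some.inj this).symm
        · have := hτ2 i h2 hi
          rw [he, key j (by omega)] at this
          cases this
      · by_cases h2' : 2 ≤ j
        · have := hτ2 j h2' hj
          rw [← he, key i (by omega)] at this
          cases this
        · have h2 : i < 2 := by omega
          have h2' : j < 2 := by omega
          interval_cases i <;> interval_cases j
          · rfl
          · exact (hA hA01).elim
          · exact (hA hA01.symm).elim
          · rfl

lemma exists_polygon (w : V) (n : ℕ → V) {m : ℕ} (hm : 2 ≤ m) (hmn : n m = n 0) {s t : ℕ} (hs : s < 480)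
    (ht : t < 480) (h : OkAt G σ (n 0) (n 1) s t) : ∃ P, PolygonStates G σ w n m s t P := by
  by_cases h2 : m = 2
  · subst h2
    exact exists_polygon_two w n hs ht h
  by_cases h3 : m = 3
  · subst h3
    exact exists_polygon_three w n hmn hs ht h
  obtain ⟨k, rfl⟩ : ∃ k, m = k + 4 := ⟨m - 4, by omega⟩
  exact exists_polygon_large w n k hmn hs ht h

namespace ColSystem

open Classical in
/-- The colouring problem with six colours. -/
noncomputable def stateSystem (G : SimpleGraph V) (σ : Sym2 V → Bool) (X W : Set V)
    (hXW : ∀ x ∈ X, x ∉ W) : ColSystem V (Fin 480) where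
  X := X
  W := W
  real := G.Adj
  ok x y s t := OkAt G σ x y s t
  strict x y s t := StrictAt G σ x y s t
  Pol w N f := PolAt G σ w N fun x => f x
  disj := hXW
  real_symm _ _ h := h.symm
  ok_symm _ _ s t h := h.symm s.2 t.2
  pol_congr w N f g h hp y hy z hz := by
    simp only [← h y hy, ← h z hz]
    exact hp y hy z hz
  pol_triv w N f h y hy z hz hyz := (hyz (h hy hz)).elim
  init x y _ := by
    obtain ⟨s, hs, t, ht, h⟩ := exists_init (G := G) (σ := σ) x y
    exact ⟨⟨s, hs⟩, ⟨t, ht⟩, h⟩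
  child u a x s t _ _ _ h := by
    obtain ⟨p, hp, h⟩ := exists_child_at u a x s.2 t.2 h
    exact ⟨⟨p, hp⟩, h⟩
  poly w _ n m hm hn s t h := by
    have hmn : n m = n 0 := (hn _ _).2 (by simp [Nat.ModEq])
    obtain ⟨P, hP⟩ := exists_polygon w n hm hmn s.2 t.2 h
    obtain ⟨f, hf⟩ := exists_fun_on_cycle hn fun i => if hi : i < m then (⟨P i, hP.lt i hi⟩ : Fin 480) else s
    have hfP : ∀ i, (f (n i) : ℕ) = P (i % m) := by
      intro i
      rw [hf, dif_pos (Nat.mod_lt _ (by omega))]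
    have hfP' : ∀ i < m, (f (n i) : ℕ) = P i := by
      intro i hi
      rw [hfP, Nat.mod_eq_of_lt hi]
    refine ⟨f, Fin.ext ?_, Fin.ext ?_, ?_, ?_, ?_, ?_⟩
    · rw [hfP' 0 (by omega), hP.zero]
    · rw [hfP' 1 (by omega), hP.one]
    · exact forall_cycle (F := P) (f := fun x => (f x : ℕ)) (R := OkAt G σ) (by omega) hn hfP hP.ok hP.last
    · intro h3
      rw [hfP' 2 (by omega), hfP' (m - 1) (by omega)]
      exact hP.strict h3
    · intro i hi
      rw [hfP' (i + 2) hi, hfP' (i + 1) (by omega), hfP (i + 3)]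
      exact hP.bot i hi
    · rintro _ ⟨i, rfl⟩ _ ⟨j, rfl⟩ hij hA he
      have e : ∀ i, n i = n (i % m) := fun i => (hn _ _).2 (Nat.mod_modEq i m).symm
      have hm0 : 0 < m := by omega
      simp only [hfP] at he
      rw [e i, e j] at hij hA ⊢
      exact hP.pol _ (Nat.mod_lt _ hm0) _ (Nat.mod_lt _ hm0) hij hA he

end ColSystem

end

section

variable {V : Type} {G : SimpleGraph V}

/-- A connected set adjacent to all of `X` can be added to a minor model as a further branch set. -/
lemma XMinor.isMinor_of_apex {W ι : Type} {F : SimpleGraph V} {X A : Set V} {H : SimpleGraph ι}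
    {J : Set ι} {H' : SimpleGraph W} (h : XMinor F X H J) (hH : ∀ i, ∃ j, H.Adj i j) (hFG : F ≤ G)
    (hA : (G.induce A).Connected) (hAX : ∀ x ∈ X, ∃ a ∈ A, G.Adj a x)
    (hFA : ∀ x y, F.Adj x y → x ∉ A) (e : W → Option ι) (he : e.Injective)
    (h1 : ∀ w w' i j, H'.Adj w w' → e w = some i → e w' = some j → H.Adj i j)
    (h2 : ∀ w w' i, H'.Adj w w' → e w = none → e w' = some i → i ∈ J) : IsMinor H' G := by
  obtain ⟨B, hc, hd, ha, hX⟩ := h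
  have hBA : ∀ i, Disjoint (B i) A := by
    intro i
    obtain ⟨j, hj⟩ := hH i
    obtain ⟨a, hai, b, -, hab⟩ := ha i j hj
    have hs := subset_of_connected (hc i) (support_closed F) hai ⟨b, hab⟩
    refine Set.disjoint_left.2 fun x hx => ?_
    obtain ⟨y, hy⟩ := hs hx
    exact hFA x y hy
  have hcon : ∀ o : Option ι, (G.induce (o.elim A B)).Connected := by
    rintro (_ | i)
    exacts [hA, induce_connected_mono hFG (hc i)]
  refine ⟨fun w => (e w).elim A B, fun w => ?_, fun w => hcon _, ?_, ?_⟩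
  · obtain ⟨x⟩ := (hcon (e w)).nonempty
    exact ⟨x, x.2⟩
  · intro w w' hw
    have hne := he.ne hw
    change Disjoint ((e w).elim A B) ((e w').elim A B)
    rcases hi : e w with _ | i <;> rcases hj : e w' with _ | j
    · exact (hne (hi.trans hj.symm)).elim
    · exact (hBA j).symm
    · exact hBA i
    · exact hd i j fun hij => hne (by rw [hi, hj, hij])
  · intro w w' hw
    have key : ∀ j ∈ J, ∃ u ∈ A, ∃ v ∈ B j, G.Adj u v := by
      intro j hj
      obtain ⟨x, hxB, hxX⟩ := hX j hj
      obtain ⟨a, haA, hax⟩ := hAX x hxX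
      exact ⟨a, haA, x, hxB, hax⟩
    dsimp only
    rcases hi : e w with _ | i <;> rcases hj : e w' with _ | j
    · exact (hw.ne (he (hi.trans hj.symm))).elim
    · exact key j (h2 w w' j hw hi hj)
    · obtain ⟨u, hu, v, hv, huv⟩ := key i (h2 w' w i hw.symm hj hi)
      exact ⟨v, hv, u, hu, huv.symm⟩
    · obtain ⟨u, hu, v, hv, huv⟩ := ha i j (h1 w w' i j hw hi hj)
      exact ⟨u, hu, v, hv, hFG huv⟩

lemma IsPlanar.cone (hG : IsPlanar G) {F : SimpleGraph V} {X A : Set V} (hFG : F ≤ G)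
    (hA : (G.induce A).Connected) (hAX : ∀ x ∈ X, ∃ a ∈ A, G.Adj a x)
    (hFA : ∀ x y, F.Adj x y → x ∉ A) : Cone F X := by
  refine ⟨fun h => hG.2 ?_, fun h => hG.1 ?_⟩
  · refine h.isMinor_of_apex ?_ hFG hA hAX hFA
      (Sum.elim (fun i => some (Sum.inl i)) fun j => (finSuccEquiv 2 j).map Sum.inr) ?_ ?_ ?_
    · rintro (i | i)
      · exact ⟨Sum.inr 0, by simp⟩
      · exact ⟨Sum.inl 0, by simp⟩
    · have hinj : Function.Injective fun j => (finSuccEquiv 2 j).map (Sum.inr : _ → Fin 3 ⊕ Fin 2) :=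
        (Option.map_injective Sum.inr_injective).comp (finSuccEquiv 2).injective
      refine Function.Injective.sumElim (fun i j h => by simpa using h) hinj ?_
      intro i j h
      obtain ⟨k, -, hk⟩ := Option.map_eq_some_iff.1 h.symm
      cases hk
    · rintro (w | w) (w' | w') i j hw hi hj
      · simp at hw
      · obtain ⟨k, -, rfl⟩ := Option.map_eq_some_iff.1 hj
        obtain rfl := Option.some.inj hi
        simp
      · obtain ⟨k, -, rfl⟩ := Option.map_eq_some_iff.1 hi
        obtain rfl := Option.some.inj hj
        simp
      · simp at hw
    · rintro (w | w) (w' | w') i hw hi hj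
      · simp at hw
      · cases hi
      · obtain rfl := Option.some.inj hj
        rfl
      · simp at hw
  · refine h.isMinor_of_apex (fun i => ?_) hFG hA hAX hFA (finSuccEquiv 4) (finSuccEquiv 4).injective
      ?_ fun _ _ _ _ _ _ => trivial
    · exact exists_ne i |>.imp fun j hj => hj.symm
    · rintro w w' i j hw hi hj rfl
      exact hw ((finSuccEquiv 4).injective (hi.trans hj.symm))

lemma Cone.of_subsingleton {F : SimpleGraph V} {X : Set V} (hX : X.Subsingleton) : Cone F X := by
  refine ⟨?_, ?_⟩
  · rintro ⟨B, -, hd, -, h⟩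
    obtain ⟨x, hx, hxX⟩ := h (Sum.inl 0) rfl
    obtain ⟨y, hy, hyX⟩ := h (Sum.inl 1) rfl
    exact Set.disjoint_left.1 (hd (Sum.inl 0) (Sum.inl 1) (by simp)) hx (hX hxX hyX ▸ hy)
  · rintro ⟨B, -, hd, -, h⟩
    obtain ⟨x, hx, hxX⟩ := h 0 trivial
    obtain ⟨y, hy, hyX⟩ := h 1 trivial
    exact Set.disjoint_left.1 (hd 0 1 (by simp)) hx (hX hxX hyX ▸ hy)

variable (G)

/-- The vertices at distance `i` from `r`. -/
def layer (r : V) (i : ℕ) : Set V := {x | G.Reachable r x ∧ G.dist r x = i}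

/-- The edges within the layer `i` and between the layers `i` and `i + 1`. -/
def layerGraph (r : V) (i : ℕ) : SimpleGraph V where
  Adj x y := G.Adj x y ∧ (x ∈ layer G r i ∧ (y ∈ layer G r i ∨ y ∈ layer G r (i + 1)) ∨
    x ∈ layer G r (i + 1) ∧ y ∈ layer G r i)
  symm := ⟨fun _ _ h => ⟨h.1.symm, by tauto⟩⟩
  loopless := ⟨fun _ h => h.1.ne rfl⟩

variable {G}

lemma layerGraph_adj {r x y : V} {i : ℕ} (h : G.Adj x y) (hx : x ∈ layer G r i)
    (hy : y ∈ layer G r i ∨ y ∈ layer G r (i + 1)) : (layerGraph G r i).Adj x y :=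
  ⟨h, Or.inl ⟨hx, hy⟩⟩

lemma exists_adj_dist {r x : V} {n : ℕ} (hr : G.Reachable r x) (h : G.dist r x = n + 1) :
    ∃ y, G.Adj y x ∧ y ∈ layer G r n := by
  obtain ⟨p, hp⟩ := hr.exists_walk_length_eq_dist
  have hnil : ¬ p.Nil := by
    rw [← Walk.length_eq_zero_iff]
    omega
  have hadj := p.adj_penultimate hnil
  refine ⟨p.penultimate, hadj, ⟨p.dropLast⟩, ?_⟩
  have h1 := dist_le p.dropLast
  have h2 : p.dropLast.length + 1 = p.length := Walk.length_dropLast_add_one hnil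
  obtain ⟨q, hq⟩ := p.dropLast.reachable.exists_walk_length_eq_dist
  have h3 := dist_le (q.concat hadj)
  rw [Walk.length_concat] at h3
  omega

lemma connected_ball (r : V) (i : ℕ) :
    (G.induce {x | G.Reachable r x ∧ G.dist r x < i + 1}).Connected := by
  have hr : r ∈ {x | G.Reachable r x ∧ G.dist r x < i + 1} := ⟨Reachable.refl r, by simp⟩
  have key : ∀ n x (hx : x ∈ {x | G.Reachable r x ∧ G.dist r x < i + 1}), G.dist r x = n →
      (G.induce {x | G.Reachable r x ∧ G.dist r x < i + 1}).Reachable ⟨r, hr⟩ ⟨x, hx⟩ := by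
    intro n
    induction n with
    | zero =>
      intro x hx h
      obtain rfl := hx.1.dist_eq_zero_iff.1 h
      exact Reachable.refl _
    | succ n ih =>
      intro x hx h
      obtain ⟨y, hyx, hy⟩ := exists_adj_dist hx.1 h
      have hlt := hx.2
      have hy' : y ∈ {x | G.Reachable r x ∧ G.dist r x < i + 1} := ⟨hy.1, by have := hy.2; omega⟩
      refine (ih y hy' hy.2).trans (Adj.reachable ?_)
      exact hyx
  have : Nonempty {x | G.Reachable r x ∧ G.dist r x < i + 1} := ⟨⟨r, hr⟩⟩
  exact ⟨fun a b => (key _ a a.2 rfl).symm.trans (key _ b b.2 rfl)⟩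

lemma IsPlanar.cone_layerGraph (hG : IsPlanar G) (r : V) (i : ℕ) :
    Cone (layerGraph G r i) (layer G r i) := by
  rcases i with _ | i
  · refine Cone.of_subsingleton fun x hx y hy => ?_
    rw [← hx.1.dist_eq_zero_iff.1 hx.2, ← hy.1.dist_eq_zero_iff.1 hy.2]
  · refine hG.cone (fun _ _ h => h.1) (connected_ball r i) ?_ ?_
    · intro x hx
      obtain ⟨y, hyx, hy⟩ := exists_adj_dist hx.1 hx.2
      exact ⟨y, ⟨hy.1, by have := hy.2; omega⟩, hyx⟩
    · rintro x y ⟨-, ⟨⟨-, hx⟩, -⟩ | ⟨⟨-, hx⟩, -⟩⟩ ⟨-, hlt⟩ <;> omega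

lemma layer_disjoint (r : V) (i : ℕ) : ∀ x ∈ layer G r i, x ∉ layer G r (i + 1) := by
  rintro x ⟨-, h⟩ ⟨-, h'⟩
  omega

end

section

variable {V : Type} {G : SimpleGraph V}

lemma exists_layer_colours [Finite V] (hG : IsPlanar G) (σ : Sym2 V → Bool) (r : V) (i : ℕ) :
    ∃ c : V → Fin 6, ∀ z ∈ layer G r i ∪ layer G r (i + 1), ∀ x ∈ layer G r i, ∀ y ∈ layer G r i,
      x ≠ y → ¬ G.Adj x y → G.Adj z x → G.Adj z y → c x = c y → σ s(z, x) = σ s(z, y) := by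
  obtain ⟨-, f, hf⟩ := ColSystem.rooted_and_solvable
    (ColSystem.stateSystem G σ (layer G r i) (layer G r (i + 1)) (layer_disjoint r i))
    (layerGraph G r i) (hG.cone_layerGraph r i) fun x y h => h.2
  refine ⟨fun x => ⟨f x / 80, by omega⟩, ?_⟩
  intro z hz x hx y hy hne hA hzx hzy hc
  replace hc : (f x : ℕ) / 80 = f y / 80 := congrArg Fin.val hc
  rcases hz with hz | hz
  · have key : ∀ x ∈ layer G r i, ∀ y ∈ layer G r i, G.Adj z x → G.Adj z y →
        (f x : ℕ) / 80 = f y / 80 → StrictAt G σ z x (f z) (f x) → σ s(z, x) = σ s(z, y) := by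
      intro x hx y hy hzx hzy hc hs
      have h1 := hs _ (edgeSign_of_adj hzx)
      have h2 : OkAt G σ z y (f z) (f y) := hf.ok z y hz hy (layerGraph_adj hzy hz (Or.inl hy))
      have h3 := h2.2
      rw [edgeSign_of_adj hzy] at h3
      by_contra hne
      rw [hc, Bool.eq_not_of_ne hne] at h1
      exact h3.1 h1
    by_contra hne'
    refine hA (hf.bot z x y hz hx hy (layerGraph_adj hzx hz (Or.inl hx))
      (layerGraph_adj hzy hz (Or.inl hy)) hne (fun h => ?_) fun h => ?_)
    · exact hne' (key x hx y hy hzx hzy hc h)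
    · exact hne' (key y hy x hx hzy hzx hc.symm h).symm
  · exact hf.pol z hz x (layerGraph_adj hzx.symm hx (Or.inr hz)).symm y
      (layerGraph_adj hzy.symm hy (Or.inr hz)).symm hne hA hc

lemma exists_layer_codes [Finite V] (hG : IsPlanar G) (σ : Sym2 V → Bool) (r : V) (i : ℕ) :
    ∃ a : V → Bool × Bool, ∀ z ∈ layer G r i, ∀ x ∈ layer G r (i + 1), ∀ y ∈ layer G r (i + 1),
      G.Adj z x → G.Adj z y → a x = a y → σ s(z, x) = σ s(z, y) := by
  obtain ⟨-, f, hf⟩ := ColSystem.rooted_and_solvable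
    (ColSystem.signSystem σ (layer G r i) (layer G r (i + 1)) (layer_disjoint r i))
    (layerGraph G r i) (hG.cone_layerGraph r i) fun x y h => h.2
  have hp : ∀ x : V, ∃ a : Bool × Bool, x ∈ layer G r (i + 1) → ∀ z ∈ layer G r i, G.Adj z x →
      ColSystem.val (f z) a = σ s(x, z) := by
    intro x
    by_cases hx : x ∈ layer G r (i + 1)
    · obtain ⟨a, ha⟩ := hf.pol x hx
      exact ⟨a, fun _ z hz h => ha z (layerGraph_adj h hz (Or.inr hx)).symm⟩
    · exact ⟨default, fun h => (hx h).elim⟩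
  choose a ha using hp
  refine ⟨a, fun z hz x hx y hy hzx hzy h => ?_⟩
  rw [Sym2.eq_swap, ← ha x hx z hz hzx, h, ha y hy z hz hzy, Sym2.eq_swap]

variable (G)

/-- A fixed vertex of the component of `x`. -/
noncomputable def root (x : V) : V := (G.connectedComponentMk x).out

/-- The distance from `x` to the fixed vertex of its component. -/
noncomputable def depth (x : V) : ℕ := G.dist (root G x) x

variable {G}

lemma reachable_root (x : V) : G.Reachable (root G x) x :=
  ConnectedComponent.exact (Quot.out_eq (G.connectedComponentMk x))

lemma SimpleGraph.Adj.root_eq {x y : V} (h : G.Adj x y) : root G x = root G y :=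
  congrArg Quot.out (ConnectedComponent.sound h.reachable)

lemma mem_layer_depth (x : V) : x ∈ layer G (root G x) (depth G x) := ⟨reachable_root x, rfl⟩

lemma SimpleGraph.Adj.depth_le {x y : V} (h : G.Adj x y) : depth G y ≤ depth G x + 1 := by
  obtain ⟨p, hp⟩ := (reachable_root (G := G) x).exists_walk_length_eq_dist
  have := dist_le (p.concat h)
  rw [Walk.length_concat, hp] at this
  rwa [depth, ← h.root_eq]

/-- In a planar graph, 72 colours suffice to make every common neighbour of two nonadjacent vertices
of the same colour see both along edges of the same sign. -/
theorem exists_sign_colouring [Finite V] (hG : IsPlanar G) (σ : Sym2 V → Bool) :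
    ∃ c : V → Fin 3 × (Bool × Bool) × Fin 6, ∀ x y z, x ≠ y → ¬ G.Adj x y → G.Adj z x → G.Adj z y →
      c x = c y → σ s(z, x) = σ s(z, y) := by
  choose b hb using exists_layer_colours hG σ
  choose a ha using exists_layer_codes hG σ
  refine ⟨fun x => (⟨depth G x % 3, by omega⟩, a (root G x) (depth G x - 1) x,
    b (root G x) (depth G x) x), ?_⟩
  intro x y z hne hA hzx hzy hc
  simp only [Prod.mk.injEq, Fin.mk.injEq] at hc
  obtain ⟨h1, h2, h3⟩ := hc
  have l1 := hzx.depth_le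
  have l2 := hzx.symm.depth_le
  have l3 := hzy.depth_le
  have l4 := hzy.symm.depth_le
  have hd : depth G y = depth G x := by omega
  have hr : root G y = root G x := hzy.root_eq.symm.trans hzx.root_eq
  have hx := mem_layer_depth (G := G) x
  have hy := mem_layer_depth (G := G) y
  have hz := mem_layer_depth (G := G) z
  rw [hzx.root_eq] at hz
  rw [hr, hd] at hy h2 h3
  by_cases hlt : depth G z < depth G x
  · have he : depth G x = depth G z + 1 := by omega
    rw [he] at hx hy h2
    exact ha _ _ z hz x hx y hy hzx hzy h2
  · refine hb _ _ z ?_ x hx y hy hne hA hzx hzy h3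
    by_cases he : depth G z = depth G x
    · exact Or.inl (he ▸ hz)
    · exact Or.inr ((show depth G z = depth G x + 1 by omega) ▸ hz)

lemma exactDistNeg_two_spec {σ : Sym2 V → Bool} {x y : V}
    (h : G.dist x y = 2 ∧ ∀ p : G.Walk x y, p.IsPath → p.length = 2 → IsNegWalk σ p) :
    ¬ G.Adj x y ∧ ∃ z, G.Adj z x ∧ G.Adj z y ∧ σ s(z, x) ≠ σ s(z, y) := by
  obtain ⟨hd, hp⟩ := h
  refine ⟨fun hA => by rw [dist_eq_one_iff_adj.2 hA] at hd; omega, ?_⟩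
  have hr : G.Reachable x y := by
    by_contra hr
    rw [dist_eq_zero_of_not_reachable hr] at hd
    omega
  obtain ⟨p, hpath, hl⟩ := hr.exists_path_of_dist
  rw [hd] at hl
  have hneg := hp p hpath hl
  match p, hl, hneg with
  | .cons (v := z) hxz (.cons hzy .nil), _, hneg =>
    refine ⟨z, hxz.symm, hzy, fun he => ?_⟩
    unfold IsNegWalk negCount at hneg
    rw [Sym2.eq_swap] at he
    cases hs : σ s(z, y)
    · simp [he, hs] at hneg
    · simp [he, hs, show ¬ Odd 2 by decide] at hneg

end

theorem planar_exactDistNeg_two_chromatic_le_76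
    {V : Type} [Fintype V] (G : SimpleGraph V) (σ : Sym2 V → Bool) (hG : IsPlanar G) :
    (exactDistNeg G σ 2).chromaticNumber ≤ 76 := by
  obtain ⟨c, hc⟩ := exists_sign_colouring hG σ
  let C : (exactDistNeg G σ 2).Coloring (Fin 3 × (Bool × Bool) × Fin 6) := Coloring.mk c <| by
    intro x y hxy he
    obtain ⟨hne, h | h⟩ := (fromRel_adj _ _ _).1 hxy
    · obtain ⟨hA, z, hzx, hzy, hs⟩ := exactDistNeg_two_spec h
      exact hs (hc x y z hne hA hzx hzy he)
    · obtain ⟨hA, z, hzy, hzx, hs⟩ := exactDistNeg_two_spec h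
      exact hs (hc y x z hne.symm hA hzy hzx he.symm)
  have h72 : (exactDistNeg G σ 2).Colorable 72 := by simpa using C.colorable
  exact (h72.mono (by norm_num : 72 ≤ 76)).chromaticNumber_le
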